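/- Let 0 < ν < 1/2, and let f be locally integrable on (0,∞) with f(x) = O(x^{−a}) as x → 0⁺ and f(x) = O(x^{−b}) as x → ∞, where a < ν and 5/4 < b < 3/2, with Mellin transform satisfying f*(1) = 0 and (f*)′(1) = 0, and with φ(x) = (1/(2π))·∫_ℝ Γ(1−s)·Γ(3/2−s)·Γ(s)·f*(s)/Γ(s−1/2) · x^{−s} dt (s = ν + it). Then for every x > 0, ∫_x^∞ φ(y) dy = (16/π²)·∫_0^∞ τ·sinh(2πτ)·K_{iτ}(√x)²·(F f)(τ) dτ. -/

import Mathlib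

open MeasureTheory Set Filter Asymptotics

/-- Modified Bessel function of the second kind (integral representation, for Re z > 0). -/
noncomputable def besselK (nu z : ℂ) : ℂ :=
  ∫ t in Set.Ioi (0:ℝ), Complex.exp (-z * (Real.cosh t : ℂ)) * Complex.cosh (nu * (t : ℂ))

/-- The kernel 𝒦(x,τ) = ker²_{2iτ}(2(4x)^{1/4}) + kei²_{2iτ}(2(4x)^{1/4})
    = K_{2iτ}(2(4x)^{1/4}e^{iπ/4}) · K_{2iτ}(2(4x)^{1/4}e^{-iπ/4}), which is real. -/
noncomputable def kernelK (x τ : ℝ) : ℝ :=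
  (besselK (2 * Complex.I * (τ:ℂ))
      (((2 * (4*x) ^ ((1:ℝ)/4) : ℝ) : ℂ) * Complex.exp (Complex.I * (Real.pi:ℂ) / 4)) *
   besselK (2 * Complex.I * (τ:ℂ))
      (((2 * (4*x) ^ ((1:ℝ)/4) : ℝ) : ℂ) * Complex.exp (-(Complex.I * (Real.pi:ℂ)) / 4))).re

/-- K₀(y) = ∫₀^∞ exp(−y·cosh t) dt. -/
noncomputable def besselK0 (y : ℝ) : ℝ := ∫ t in Set.Ioi (0:ℝ), Real.exp (-y * Real.cosh t)

/-- K_{iτ}(x) = ∫₀^∞ exp(−x·cosh t)·cos(τt) dt (real-valued, purely imaginary order). -/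
noncomputable def besselKi (τ x : ℝ) : ℝ :=
  ∫ t in Set.Ioi (0:ℝ), Real.exp (-x * Real.cosh t) * Real.cos (τ * t)

/-- Modified Bessel function of the first kind I_ν(z) (power series). -/
noncomputable def besselI (nu z : ℂ) : ℂ :=
  ∑' n : ℕ, (z/2) ^ (nu + 2*(n:ℂ)) / ((n.factorial : ℂ) * Complex.Gamma (nu + (n:ℂ) + 1))

/-- B_ν(w) = ber²_ν(w) + bei²_ν(w) = I_ν(w·e^{iπ/4})·I_ν(w·e^{−iπ/4}). -/
noncomputable def kelvinB (nu w : ℂ) : ℂ :=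
  besselI nu (w * Complex.exp (Complex.I * (Real.pi:ℂ) / 4)) *
  besselI nu (w * Complex.exp (-(Complex.I * (Real.pi:ℂ)) / 4))

/-- Index transform (1.1): (F f)(τ) = ∫₀^∞ 𝒦(x,τ) f(x) dx. -/
noncomputable def indexF (f : ℝ → ℝ) (τ : ℝ) : ℝ := ∫ x in Set.Ioi (0:ℝ), kernelK x τ * f x

/-- Index transform (1.2): (G g)(x) = ∫₀^∞ 𝒦(x,τ) g(τ) dτ. -/
noncomputable def indexG (g : ℝ → ℝ) (x : ℝ) : ℝ := ∫ τ in Set.Ioi (0:ℝ), kernelK x τ * g τ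

/-- Index transform (1.2) for complex-valued densities. -/
noncomputable def indexGC (g : ℝ → ℂ) (x : ℝ) : ℂ :=
  ∫ τ in Set.Ioi (0:ℝ), (kernelK x τ : ℂ) * g τ

/-- Mellin transform of a real function. -/
noncomputable def mellinT (f : ℝ → ℝ) (s : ℂ) : ℂ :=
  ∫ x in Set.Ioi (0:ℝ), (f x : ℂ) * (x:ℂ) ^ (s - 1)

/-- Mellin transform of a complex function. -/
noncomputable def mellinC (F : ℝ → ℂ) (s : ℂ) : ℂ :=
  ∫ x in Set.Ioi (0:ℝ), F x * (x:ℂ) ^ (s - 1)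

/-- The L_{ν,p}(ℝ₊) norm. -/
noncomputable def Lnorm (ν p : ℝ) (f : ℝ → ℝ) : ℝ :=
  (∫ x in Set.Ioi (0:ℝ), |f x| ^ p * x ^ (ν*p - 1)) ^ (1/p)

/-- Euler beta function B(a,b) = Γ(a)Γ(b)/Γ(a+b). -/
noncomputable def betaFn (a b : ℝ) : ℝ := Real.Gamma a * Real.Gamma b / Real.Gamma (a+b)

/-- The auxiliary function φ of (2.6), as a line integral over Re s = ν. -/
noncomputable def phiFn (f : ℝ → ℝ) (ν x : ℝ) : ℂ :=
  (1/(2*(Real.pi:ℂ))) * ∫ t : ℝ,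
    Complex.Gamma (1 - ((ν:ℂ) + (t:ℂ)*Complex.I)) * Complex.Gamma (3/2 - ((ν:ℂ) + (t:ℂ)*Complex.I))
      * Complex.Gamma ((ν:ℂ) + (t:ℂ)*Complex.I) * mellinT f ((ν:ℂ) + (t:ℂ)*Complex.I)
      / Complex.Gamma (((ν:ℂ) + (t:ℂ)*Complex.I) - 1/2)
      * (x:ℂ) ^ (-((ν:ℂ) + (t:ℂ)*Complex.I))

open scoped FourierTransform in
/-- The `L²` Fourier transform of an integrable function is given by the Fourier integral. -/
lemma fourier_toLp_ae_eq {f : ℝ → ℂ} (hf1 : Integrable f) (hf2 : MemLp f 2) :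
    (𝓕 (hf2.toLp f) : Lp ℂ 2 (volume : Measure ℝ)) =ᵐ[volume] 𝓕 f := by
  have hcont : Continuous (𝓕 f) :=
    VectorFourier.fourierIntegral_continuous Real.continuous_fourierChar continuous_inner hf1
  have key : ∀ g : SchwartzMap ℝ ℂ,
      ∫ x, g x * (𝓕 (hf2.toLp f) : Lp ℂ 2 (volume : Measure ℝ)) x = ∫ x, g x * 𝓕 f x := by
    intro g
    have h1 := congrArg (fun T : TemperedDistribution ℝ ℂ => T g)
      (Lp.fourier_toTemperedDistribution_eq (hf2.toLp f))
    simp only [TemperedDistribution.fourier_apply, Lp.toTemperedDistribution_apply] at h1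
    simp only [smul_eq_mul] at h1
    rw [← h1]
    have h2 : ∫ x, (𝓕 g) x * (hf2.toLp f) x = ∫ x, (𝓕 (g : ℝ → ℂ)) x * f x := by
      refine integral_congr_ae ?_
      filter_upwards [hf2.coeFn_toLp] with x hx
      rw [hx, SchwartzMap.fourier_coe]
    rw [h2]
    have := VectorFourier.integral_fourierIntegral_smul_eq_flip (μ := volume) (ν := volume)
      (L := innerₗ ℝ) Real.continuous_fourierChar continuous_inner g.integrable hf1
    rw [flip_innerₗ] at this
    exact this
  refine ae_eq_of_integral_contDiff_smul_eq ?_ hcont.locallyIntegrable ?_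
  · exact (Lp.memLp _).locallyIntegrable (by norm_num)
  · intro g hg hgc
    have hg' : ContDiff ℝ (⊤ : ℕ∞) (fun x => (g x : ℂ)) := Complex.ofRealCLM.contDiff.comp hg
    have hgc' : HasCompactSupport (fun x => (g x : ℂ)) :=
      hgc.comp_left (g := fun x : ℝ => (x : ℂ)) (by simp)
    have := key (hgc'.toSchwartzMap hg')
    simpa using this

open scoped FourierTransform ComplexConjugate in
/-- Parseval's formula for functions in `L¹ ∩ L²`. -/
lemma integral_conj_fourier_mul_fourier {f g : ℝ → ℂ} (hf1 : Integrable f) (hf2 : MemLp f 2)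
    (hg1 : Integrable g) (hg2 : MemLp g 2) :
    ∫ ξ, conj (𝓕 f ξ) * 𝓕 g ξ = ∫ x, conj (f x) * g x := by
  have h := Lp.inner_fourier_eq (hf2.toLp f) (hg2.toLp g)
  rw [L2.inner_def, L2.inner_def] at h
  calc _ = ∫ ξ, inner ℂ ((𝓕 (hf2.toLp f) : Lp ℂ 2 (volume : Measure ℝ)) ξ)
        ((𝓕 (hg2.toLp g) : Lp ℂ 2 (volume : Measure ℝ)) ξ) := by
        refine integral_congr_ae ?_
        filter_upwards [fourier_toLp_ae_eq hf1 hf2, fourier_toLp_ae_eq hg1 hg2] with x h1 h2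
        rw [h1, h2]; simp [mul_comm]
    _ = _ := h
    _ = _ := by
        refine integral_congr_ae ?_
        filter_upwards [hf2.coeFn_toLp, hg2.coeFn_toLp] with x h1 h2
        rw [h1, h2]; simp [mul_comm]

/-- A product of two integrals, in the variables half-sum and half-difference. -/
lemma integral_mul_integral_eq {f g : ℝ → ℂ} (hf : Integrable f) (hg : Integrable g) :
    (∫ t, f t) * ∫ t, g t = 2 * ∫ p, ∫ q, f (p + q) * g (p - q) := by
  have h := integral_convolution (ContinuousLinearMap.mul ℝ ℂ) (μ := volume) (ν := volume) hf hg
  simp only [ContinuousLinearMap.mul_apply'] at h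
  rw [← h]
  have h2 := Measure.integral_comp_mul_left
    (fun x => MeasureTheory.convolution f g (ContinuousLinearMap.mul ℝ ℂ) volume x) (2 : ℝ)
  simp only [convolution_def, ContinuousLinearMap.mul_apply'] at h2 ⊢
  have h3 : ∀ p : ℝ, ∫ q, f (p + q) * g (p - q) = ∫ t, f t * g (2 * p - t) := by
    intro p
    rw [← integral_add_left_eq_self (fun t => f t * g (2 * p - t)) p]
    congr 1; ext q; congr 2; ring
  simp_rw [h3, h2]
  norm_num [abs_of_pos]
  ring

/-- An integrable function tends to zero along some sequence `±u n` with `u n → ∞`. -/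
lemma exists_seq_tendsto_zero_of_integrable {B : ℝ → ℝ} (hB : Integrable B) :
    ∃ u : ℕ → ℝ, Tendsto u atTop atTop ∧ (∀ n, 0 < u n) ∧
      Tendsto (fun n => B (u n)) atTop (nhds 0) ∧
      Tendsto (fun n => B (-u n)) atTop (nhds 0) := by
  set h : ℝ → ℝ := fun t => |B t| + |B (-t)| with hh
  have hi : Integrable h := hB.abs.add hB.comp_neg.abs
  have h1 : Tendsto (fun n : ℕ => ∫ t in (0:ℝ)..n, h t) atTop (nhds (∫ t in Ioi 0, h t)) :=
    intervalIntegral_tendsto_integral_Ioi 0 hi.integrableOn tendsto_natCast_atTop_atTop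
  have h2 : Tendsto (fun n : ℕ => ∫ t in Ioc (n:ℝ) (n+1), h t) atTop (nhds 0) := by
    have := (h1.comp (tendsto_add_atTop_nat 1)).sub h1
    rw [sub_self] at this
    refine this.congr fun n => ?_
    simp only [Function.comp]
    rw [intervalIntegral.integral_interval_sub_left hi.intervalIntegrable hi.intervalIntegrable,
      intervalIntegral.integral_of_le (by push_cast; linarith)]
    push_cast; rfl
  have h3 : ∀ n : ℕ, ∃ t ∈ Ioc (n:ℝ) (n+1), h t ≤ ∫ t in Ioc (n:ℝ) (n+1), h t := by
    intro n
    have hv : (volume : Measure ℝ) (Ioc (n:ℝ) (n+1)) = 1 := by simp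
    obtain ⟨t, ht, hle⟩ := exists_le_setAverage (μ := volume) (s := Ioc (n:ℝ) (n+1)) (f := h)
      (by simp [hv]) (by simp [hv]) hi.integrableOn
    refine ⟨t, ht, hle.trans_eq ?_⟩
    rw [setAverage_eq]
    simp [Measure.real, hv]
  choose u hu hle using h3
  have h4 : Tendsto (fun n => h (u n)) atTop (nhds 0) :=
    squeeze_zero (fun n => by positivity) hle h2
  refine ⟨u, tendsto_atTop_mono (fun n => (hu n).1.le) tendsto_natCast_atTop_atTop,
    fun n => n.cast_nonneg.trans_lt (hu n).1, ?_, ?_⟩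
  · refine squeeze_zero_norm (fun n => ?_) h4
    simp only [hh, Real.norm_eq_abs]; linarith [abs_nonneg (B (-u n))]
  · refine squeeze_zero_norm (fun n => ?_) h4
    simp only [hh, Real.norm_eq_abs]; linarith [abs_nonneg (B (u n))]

/-- Shift of a horizontal line of integration. -/
lemma integral_shift_eq {F : ℂ → ℂ} {B : ℝ → ℝ} {θ : ℝ} (hθ : 0 ≤ θ)
    (hF : DifferentiableOn ℂ F {z | z.im ∈ Icc 0 θ}) (hB : Integrable B)
    (hbd : ∀ t : ℝ, t ≠ 0 → ∀ y ∈ Icc 0 θ, ‖F (t + y * Complex.I)‖ ≤ B t) :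
    ∫ t : ℝ, F (t + θ * Complex.I) = ∫ t : ℝ, F t := by
  have hint : ∀ y ∈ Icc 0 θ, Integrable (fun t : ℝ => F (t + y * Complex.I)) := by
    intro y hy
    refine hB.mono' ?_ ?_
    · refine Continuous.aestronglyMeasurable ?_
      refine hF.continuousOn.comp_continuous (by fun_prop) ?_
      intro t; simpa using hy
    · filter_upwards [(measure_eq_zero_iff_ae_notMem.1 (measure_singleton (0 : ℝ)) :
        ∀ᵐ t : ℝ, t ∉ ({0} : Set ℝ))] with t ht
      exact hbd t ht y hy
  have rect : ∀ T : ℝ, (∫ x : ℝ in (-T)..T, F x) - (∫ x : ℝ in (-T)..T, F (x + θ * Complex.I)) +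
      Complex.I • (∫ y : ℝ in (0:ℝ)..θ, F (T + y * Complex.I)) -
      Complex.I • (∫ y : ℝ in (0:ℝ)..θ, F ((-T : ℝ) + y * Complex.I)) = 0 := by
    intro T
    have := Complex.integral_boundary_rect_eq_zero_of_differentiableOn F (-T : ℝ)
      ((T : ℝ) + θ * Complex.I) (hF.mono ?_)
    · simpa using this
    · intro z hz
      have := hz.2
      simpa [uIcc_of_le hθ] using this
  obtain ⟨u, hu, hu0, hBp, hBm⟩ := exists_seq_tendsto_zero_of_integrable hB
  have v : ∀ w : ℕ → ℝ, (∀ n, w n ≠ 0) → Tendsto (fun n => B (w n)) atTop (nhds 0) →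
      Tendsto (fun n => ∫ y : ℝ in (0:ℝ)..θ, F (w n + y * Complex.I)) atTop (nhds 0) := by
    intro w hw0 hw
    have hlim : Tendsto (fun n => B (w n) * |θ - 0|) atTop (nhds 0) := by
      simpa using hw.mul_const (|θ - 0|)
    refine squeeze_zero_norm (fun n => ?_) hlim
    refine intervalIntegral.norm_integral_le_of_norm_le_const ?_
    intro y hy
    rw [uIoc_of_le hθ] at hy
    exact hbd _ (hw0 n) y ⟨hy.1.le, hy.2⟩
  have v2 := v u (fun n => (hu0 n).ne') hBp
  have v3 := v (fun n => -u n) (fun n => neg_ne_zero.2 (hu0 n).ne') hBm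
  have h0 := intervalIntegral_tendsto_integral (hint 0 ⟨le_rfl, hθ⟩)
    (tendsto_neg_atTop_atBot.comp hu) hu
  have h1 := intervalIntegral_tendsto_integral (hint θ ⟨hθ, le_rfl⟩)
    (tendsto_neg_atTop_atBot.comp hu) hu
  have htot := ((h0.sub h1).add (v2.const_smul Complex.I)).sub (v3.const_smul Complex.I)
  simp only [Complex.ofReal_zero, zero_mul, add_zero] at htot
  have htot' := htot.congr (fun n => rect (u n))
  have := tendsto_nhds_unique htot' tendsto_const_nhds
  simp only [smul_zero, add_zero, sub_zero] at this
  exact (sub_eq_zero.1 this).symm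

/-- Shift of a horizontal line of integration up to a line where the integrand may be singular. -/
lemma integral_shift_limit {F : ℂ → ℂ} {G : ℝ → ℂ} {B : ℝ → ℝ} {β : ℝ} (hβ : 0 < β)
    (hF : DifferentiableOn ℂ F {z | z.im ∈ Ico 0 β}) (hB : Integrable B)
    (hbd : ∀ t : ℝ, t ≠ 0 → ∀ y ∈ Ico 0 β, ‖F (t + y * Complex.I)‖ ≤ B t)
    (hG : ∀ t : ℝ, t ≠ 0 →
      Tendsto (fun y : ℝ => F (t + y * Complex.I)) (nhdsWithin β (Iio β)) (nhds (G t))) :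
    ∫ t : ℝ, G t = ∫ t : ℝ, F t := by
  have hae : ∀ᵐ t : ℝ, t ≠ 0 :=
    (measure_eq_zero_iff_ae_notMem.1 (measure_singleton (0 : ℝ)))
  have hev : ∀ᶠ y in nhdsWithin β (Iio β), y ∈ Ico 0 β := by
    filter_upwards [Ioo_mem_nhdsLT hβ] with y hy using ⟨hy.1.le, hy.2⟩
  have h1 : Tendsto (fun y : ℝ => ∫ t : ℝ, F (t + y * Complex.I)) (nhdsWithin β (Iio β))
      (nhds (∫ t : ℝ, G t)) := by
    refine tendsto_integral_filter_of_dominated_convergence B ?_ ?_ hB ?_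
    · filter_upwards [hev] with y hy
      refine Continuous.aestronglyMeasurable ?_
      refine hF.continuousOn.comp_continuous (by fun_prop) ?_
      intro t; simpa using hy
    · filter_upwards [hev] with y hy
      filter_upwards [hae] with t ht
      exact hbd t ht y hy
    · filter_upwards [hae] with t ht using hG t ht
  have h2 : ∀ᶠ y : ℝ in nhdsWithin β (Iio β), ∫ t : ℝ, F (t + y * Complex.I) = ∫ t : ℝ, F t := by
    filter_upwards [hev] with y hy
    refine integral_shift_eq hy.1 (hF.mono ?_) hB ?_
    · intro z hz; exact ⟨hz.1, hz.2.trans_lt hy.2⟩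
    · intro t ht x hx; exact hbd t ht x ⟨hx.1, hx.2.trans_lt hy.2⟩
  exact tendsto_nhds_unique h1 (tendsto_const_nhds.congr' (h2.mono fun y hy => hy.symm))

/-- Two-sided shift of the line of integration to the boundary of a strip, on which the integrand
may be singular at one point. -/
lemma integral_boundary_strip {F : ℂ → ℂ} {B : ℝ → ℝ} {β : ℝ} (hβ : 0 < β)
    (hF : ∀ z : ℂ, |z.im| < β → DifferentiableAt ℂ F z) (hB : Integrable B)
    (hbd : ∀ t : ℝ, t ≠ 0 → ∀ y : ℝ, |y| < β → ‖F (t + y * Complex.I)‖ ≤ B t)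
    (hp : ∀ t : ℝ, t ≠ 0 → ContinuousAt F (t + β * Complex.I))
    (hm : ∀ t : ℝ, t ≠ 0 → ContinuousAt F (t - β * Complex.I)) :
    ∫ t : ℝ, F (t + β * Complex.I) = ∫ t : ℝ, F t ∧
    ∫ t : ℝ, F (t - β * Complex.I) = ∫ t : ℝ, F t := by
  constructor
  · refine integral_shift_limit hβ (fun z hz => (hF z ?_).differentiableWithinAt) hB ?_ ?_
    · exact abs_lt.2 ⟨by linarith [hz.1], hz.2⟩
    · exact fun t ht y hy => hbd t ht y (abs_lt.2 ⟨by linarith [hy.1], hy.2⟩)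
    · intro t ht
      have : ContinuousAt (fun y : ℝ => F (t + y * Complex.I)) β :=
        ContinuousAt.comp (f := fun y : ℝ => (t : ℂ) + y * Complex.I) (hp t ht) (by fun_prop)
      exact this.tendsto.mono_left nhdsWithin_le_nhds
  · have := integral_shift_limit (F := fun z => F (-z)) (B := fun t => B (-t))
      (G := fun t => F ((-t : ℝ) - β * Complex.I)) hβ
      (fun z hz => ((hF (-z) ?_).comp z differentiableAt_id.neg).differentiableWithinAt)
      hB.comp_neg ?_ ?_
    · have e1 := integral_neg_eq_self (fun t : ℝ => F (t - β * Complex.I)) volume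
      have e2 := integral_neg_eq_self (fun t : ℝ => F t) volume
      rw [← e1, ← e2, this]
      simp
    · simpa using abs_lt.2 ⟨by linarith [hz.1], hz.2⟩
    · intro t ht y hy
      have := hbd (-t) (neg_ne_zero.2 ht) (-y) (by
        rw [abs_neg]; exact abs_lt.2 ⟨by linarith [hy.1], hy.2⟩)
      rw [show -((t : ℂ) + y * Complex.I) = (-t : ℝ) + (-y : ℝ) * Complex.I by push_cast; ring]
      exact this
    · intro t ht
      have : ContinuousAt (fun y : ℝ => F (-((t : ℂ) + y * Complex.I))) β := by
        refine ContinuousAt.comp (g := F) (f := fun y : ℝ => -((t : ℂ) + y * Complex.I)) ?_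
          (by fun_prop)
        have := hm (-t) (neg_ne_zero.2 ht)
        rw [show -((t : ℂ) + β * Complex.I) = (-t : ℝ) - β * Complex.I by push_cast; ring]
        exact this
      have h := this.tendsto.mono_left (nhdsWithin_le_nhds (s := Iio β))
      convert h using 2
      congr 1; push_cast; ring

/-- The substitution `x = exp t`. -/
lemma integral_Ioi_eq_integral_exp {E : Type*} [NormedAddCommGroup E] [NormedSpace ℝ E]
    (g : ℝ → E) : ∫ x in Ioi (0 : ℝ), g x = ∫ t : ℝ, Real.exp t • g (Real.exp t) := by
  have h := integral_image_eq_integral_abs_deriv_smul (s := univ) (f := Real.exp)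
    (f' := Real.exp) MeasurableSet.univ
    (fun x _ => (Real.hasDerivAt_exp x).hasDerivWithinAt) Real.exp_injective.injOn g
  simpa [image_univ, Real.range_exp, abs_of_pos (Real.exp_pos _)] using h

lemma integrableOn_Ioi_iff_integrable_exp {E : Type*} [NormedAddCommGroup E] [NormedSpace ℝ E]
    (g : ℝ → E) : IntegrableOn g (Ioi (0 : ℝ)) ↔
      Integrable fun t : ℝ => Real.exp t • g (Real.exp t) := by
  have h := integrableOn_image_iff_integrableOn_abs_deriv_smul (s := univ) (f := Real.exp)
    (f' := Real.exp) MeasurableSet.univ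
    (fun x _ => (Real.hasDerivAt_exp x).hasDerivWithinAt) Real.exp_injective.injOn g
  simpa [image_univ, Real.range_exp, abs_of_pos (Real.exp_pos _)] using h

lemma integrable_comp_abs {f : ℝ → ℝ} (h : IntegrableOn f (Ioi 0)) :
    Integrable fun t : ℝ => f |t| := by
  rw [← integrableOn_univ, ← Iio_union_Ici (a := (0 : ℝ)), integrableOn_union,
    integrableOn_Ici_iff_integrableOn_Ioi]
  constructor
  · refine (IntegrableOn.comp_neg_Iio (c := 0) (f := f) (by simpa using h)).congr_fun
      (fun t ht => ?_) measurableSet_Iio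
    simp only [abs_of_neg (show t < 0 from ht)]
  · refine h.congr_fun (fun t ht => ?_) measurableSet_Ioi
    simp only [abs_of_pos (show 0 < t from ht)]

lemma integrable_exp_neg_mul_abs {δ : ℝ} (hδ : 0 < δ) :
    Integrable fun t : ℝ => Real.exp (-(δ * |t|)) :=
  integrable_comp_abs (f := fun t => Real.exp (-(δ * t)))
    ((exp_neg_integrableOn_Ioi 0 hδ).congr_fun (fun t _ => by simp) measurableSet_Ioi)

/-- The Gamma integral after the substitution `x = exp t`. -/
lemma integral_exp_neg_exp_add {s : ℂ} (hs : 0 < s.re) :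
    Integrable (fun t : ℝ => Complex.exp (-Complex.exp t + s * t)) ∧
      ∫ t : ℝ, Complex.exp (-Complex.exp t + s * t) = Complex.Gamma s := by
  have key : ∀ t : ℝ, Real.exp t • (((Real.exp (-Real.exp t) : ℝ) : ℂ) *
      ((Real.exp t : ℝ) : ℂ) ^ (s - 1)) = Complex.exp (-Complex.exp t + s * t) := by
    intro t
    rw [Complex.cpow_def_of_ne_zero (by exact_mod_cast (Real.exp_pos t).ne'),
      ← Complex.ofReal_log (Real.exp_pos t).le, Real.log_exp, Complex.real_smul]
    push_cast
    rw [← Complex.exp_add, ← Complex.exp_add]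
    ring_nf
  constructor
  · have := (integrableOn_Ioi_iff_integrable_exp _).1 (Complex.GammaIntegral_convergent hs)
    exact this.congr (Eventually.of_forall key)
  · rw [Complex.Gamma_eq_integral hs, Complex.GammaIntegral, integral_Ioi_eq_integral_exp]
    exact (integral_congr_ae (Eventually.of_forall key)).symm

lemma integrable_exp_neg_mul_exp_add {c σ : ℝ} (hc : 0 < c) (hσ : 0 < σ) :
    Integrable fun t : ℝ => Real.exp (-(c * Real.exp t) + σ * t) := by
  have h := ((integral_exp_neg_exp_add (s := σ) (by simpa)).1.norm.comp_add_right
    (Real.log c)).const_mul (Real.exp (-(σ * Real.log c)))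
  refine h.congr (Eventually.of_forall fun t => ?_)
  have : (-Complex.exp ((t + Real.log c : ℝ) : ℂ) + σ * ((t + Real.log c : ℝ) : ℂ)) =
      ((-Real.exp (t + Real.log c) + σ * (t + Real.log c) : ℝ) : ℂ) := by push_cast; ring
  simp only
  rw [this, Complex.norm_exp, Complex.ofReal_re, ← Real.exp_add, Real.exp_add t,
    Real.exp_log hc]
  ring_nf

/-- Exponential decay of the Gamma function on vertical strips. -/
lemma norm_Gamma_le_exp_neg {σ₀ σ₁ θ : ℝ} (hσ₀ : 0 < σ₀) (hθ : 0 ≤ θ) (hθ' : θ < Real.pi / 2) :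
    ∃ C : ℝ, 0 ≤ C ∧ ∀ s : ℂ, σ₀ ≤ s.re → s.re ≤ σ₁ →
      ‖Complex.Gamma s‖ ≤ C * Real.exp (-(θ * |s.im|)) := by
  rcases lt_or_ge σ₁ σ₀ with h01 | h01
  · exact ⟨0, le_rfl, fun s h1 h2 => absurd (h1.trans h2) (not_le.2 h01)⟩
  have hσ₁ : 0 < σ₁ := hσ₀.trans_le h01
  have hcos : 0 < Real.cos θ := Real.cos_pos_of_mem_Ioo ⟨by linarith, hθ'⟩
  set M : ℝ → ℝ := fun t => Real.exp (-(Real.cos θ * Real.exp t) + σ₀ * t) +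
    Real.exp (-(Real.cos θ * Real.exp t) + σ₁ * t) with hM
  have hMi : Integrable M := (integrable_exp_neg_mul_exp_add hcos hσ₀).add
    (integrable_exp_neg_mul_exp_add hcos hσ₁)
  have hM0 : ∀ t, 0 ≤ M t := fun t => by positivity
  refine ⟨∫ t, M t, integral_nonneg hM0, ?_⟩
  have hnorm : ∀ s : ℂ, σ₀ ≤ s.re → s.re ≤ σ₁ → ∀ t y : ℝ, y ∈ Icc 0 θ →
      ‖Complex.exp (-Complex.exp (t + y * Complex.I) + s * (t + y * Complex.I))‖ ≤
        M t * Real.exp (-(s.im * y)) := by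
    intro s h1 h2 t y hy
    have hre : (-Complex.exp (t + y * Complex.I) + s * (t + y * Complex.I)).re =
        -(Real.exp t * Real.cos y) + s.re * t + -(s.im * y) := by
      simp [Complex.exp_re, Complex.mul_re]
      ring
    rw [Complex.norm_exp, hre, Real.exp_add]
    gcongr
    have hc : Real.cos θ ≤ Real.cos y := Real.cos_le_cos_of_nonneg_of_le_pi hy.1
      (by linarith [Real.pi_pos]) hy.2
    have h3 : -(Real.exp t * Real.cos y) ≤ -(Real.cos θ * Real.exp t) := by
      nlinarith [Real.exp_pos t]
    rcases le_total 0 t with ht | ht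
    · refine le_trans ?_ (le_add_of_nonneg_left (Real.exp_pos _).le)
      gcongr
    · refine le_trans ?_ (le_add_of_nonneg_right (Real.exp_pos _).le)
      exact Real.exp_le_exp.2 (add_le_add h3 (mul_le_mul_of_nonpos_right h1 ht))
  have hpos : ∀ s : ℂ, σ₀ ≤ s.re → s.re ≤ σ₁ → 0 ≤ s.im →
      ‖Complex.Gamma s‖ ≤ (∫ t, M t) * Real.exp (-(θ * s.im)) := by
    intro s h1 h2 h3
    have hs := integral_shift_eq (F := fun z => Complex.exp (-Complex.exp z + s * z)) (B := M)
      hθ (by fun_prop) hMi (fun t _ y hy => (hnorm s h1 h2 t y hy).trans (by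
        refine mul_le_of_le_one_right (hM0 t) ?_
        rw [Real.exp_le_one_iff]
        nlinarith [hy.1]))
    rw [(integral_exp_neg_exp_add (hσ₀.trans_le h1)).2] at hs
    rw [← hs, ← integral_mul_const]
    refine norm_integral_le_of_norm_le (hMi.mul_const _) (Eventually.of_forall fun t => ?_)
    refine (hnorm s h1 h2 t θ ⟨hθ, le_rfl⟩).trans_eq ?_
    rw [mul_comm s.im]
  intro s h1 h2
  rcases le_total 0 s.im with h | h
  · rw [abs_of_nonneg h]; exact hpos s h1 h2 h
  · rw [abs_of_nonpos h, ← RCLike.norm_conj, ← Complex.Gamma_conj]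
    simpa using hpos ((starRingEnd ℂ) s) (by simpa) (by simpa) (by simpa)

/-- The Macdonald function `K₀` on the closed right half-plane without the origin. -/
noncomputable def macdonaldK0 (z : ℂ) : ℂ :=
  Complex.exp (-z) * ∫ p in Ioi (0 : ℝ), ((Real.exp (-p) * p ^ (-(1/2) : ℝ) : ℝ) : ℂ) *
    (2 * z + p) ^ (((-(1/2) : ℝ)) : ℂ)

lemma two_mul_norm_le_norm_two_mul_add {z : ℂ} {p : ℝ} (hz : 0 ≤ z.re) (hp : 0 ≤ p) :
    2 * ‖z‖ ≤ ‖2 * z + p‖ := by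
  refine (sq_le_sq₀ (by positivity) (by positivity)).1 ?_
  rw [mul_pow, Complex.sq_norm, Complex.sq_norm, Complex.normSq_apply, Complex.normSq_apply]
  simp
  nlinarith [mul_nonneg hz hp]

lemma le_norm_two_mul_add {z : ℂ} {p : ℝ} (hz : 0 ≤ z.re) : p ≤ ‖2 * z + p‖ := by
  refine le_trans ?_ (Complex.re_le_norm _)
  simpa

lemma two_mul_add_mem_slitPlane {z : ℂ} {p : ℝ} (hz : 0 ≤ z.re) (hp : 0 < p) :
    2 * z + p ∈ Complex.slitPlane := by
  left
  simp
  positivity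

lemma norm_two_mul_add_rpow_le {z : ℂ} {p ε : ℝ} (hz : 0 ≤ z.re) (hz0 : z ≠ 0) (hp : 0 < p)
    (hε : 0 ≤ ε) (hε' : ε ≤ 1/2) :
    ‖2 * z + p‖ ^ (-(1/2) : ℝ) ≤ (2 * ‖z‖) ^ (-ε) * p ^ (ε - 1/2) := by
  have h0 : 0 < ‖z‖ := norm_pos_iff.2 hz0
  have h1 := two_mul_norm_le_norm_two_mul_add hz hp.le
  have h2 := le_norm_two_mul_add (p := p) hz
  have h3 : 0 < ‖2 * z + p‖ := hp.trans_le h2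
  rw [show (-(1/2) : ℝ) = -ε + (ε - 1/2) by ring, Real.rpow_add h3]
  gcongr ?_ * ?_
  · exact Real.rpow_le_rpow_of_nonpos (by positivity) h1 (by linarith)
  · exact Real.rpow_le_rpow_of_nonpos hp h2 (by linarith)

lemma norm_macdonaldK0_integrand_le {z : ℂ} {p ε : ℝ} (hz : 0 ≤ z.re) (hz0 : z ≠ 0) (hp : 0 < p)
    (hε : 0 ≤ ε) (hε' : ε ≤ 1/2) :
    ‖((Real.exp (-p) * p ^ (-(1/2) : ℝ) : ℝ) : ℂ) * (2 * z + p) ^ (((-(1/2) : ℝ)) : ℂ)‖ ≤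
      (2 * ‖z‖) ^ (-ε) * (Real.exp (-p) * p ^ (ε - 1)) := by
  rw [norm_mul, Complex.norm_cpow_real, Complex.norm_real, Real.norm_of_nonneg (by positivity)]
  refine (mul_le_mul_of_nonneg_left (norm_two_mul_add_rpow_le hz hz0 hp hε hε')
    (by positivity)).trans_eq ?_
  rw [show ε - 1 = -(1/2) + (ε - 1/2) by ring, Real.rpow_add hp]
  ring

lemma norm_macdonaldK0_le {z : ℂ} {ε : ℝ} (hz : 0 ≤ z.re) (hz0 : z ≠ 0)
    (hε : 0 < ε) (hε' : ε ≤ 1/2) :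
    ‖macdonaldK0 z‖ ≤ Real.Gamma ε * (2 * ‖z‖) ^ (-ε) * Real.exp (-z.re) := by
  rw [macdonaldK0, norm_mul, Complex.norm_exp, Complex.neg_re, mul_comm]
  gcongr
  rw [Real.Gamma_eq_integral hε, mul_comm (∫ x in _, _) _, ← integral_const_mul]
  refine norm_integral_le_of_norm_le ((Real.GammaIntegral_convergent hε).const_mul _) ?_
  filter_upwards [ae_restrict_mem measurableSet_Ioi] with p hp
  exact norm_macdonaldK0_integrand_le hz hz0 hp hε.le hε'

lemma differentiableAt_macdonaldK0 {z : ℂ} (hz : 0 ≤ z.re) (hz0 : z ≠ 0) :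
    DifferentiableAt ℂ macdonaldK0 z := by
  have h0 : 0 < ‖z‖ := norm_pos_iff.2 hz0
  refine DifferentiableAt.mul (by fun_prop) ?_
  have hnear : ∀ w ∈ Metric.ball z (‖z‖ / 4), ∀ p : ℝ, 0 < p →
      ‖z‖ ≤ ‖2 * w + p‖ ∧ 2 * w + p ∈ Complex.slitPlane := by
    intro w hw p hp
    have h1 : ‖2 * w + p - (2 * z + p)‖ ≤ ‖z‖ / 2 := by
      rw [show 2 * w + p - (2 * z + p) = 2 * (w - z) by ring, norm_mul]
      rw [Metric.mem_ball, dist_eq_norm] at hw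
      simp only [Complex.norm_ofNat]
      linarith
    have h2 := two_mul_norm_le_norm_two_mul_add hz hp.le
    have h3 : ‖z‖ ≤ ‖2 * w + p‖ := by
      have := norm_sub_norm_le (2 * z + p : ℂ) (2 * w + p)
      rw [norm_sub_rev] at this
      linarith
    refine ⟨h3, ?_⟩
    by_contra hcon
    rw [Complex.mem_slitPlane_iff, not_or, not_lt, not_not] at hcon
    have h4 := (Complex.abs_re_le_norm _).trans h1
    have h5 : ‖2 * w + p‖ = -(2 * w + p).re := by
      rw [← abs_of_nonpos hcon.1]
      exact (Complex.abs_re_eq_norm.2 hcon.2).symm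
    have h6 : (0 : ℝ) ≤ (2 * z + p : ℂ).re := by simp; positivity
    rw [Complex.sub_re, abs_le] at h4
    linarith [h4.1, h4.2]
  have hmeas : ∀ w : ℂ, (∀ p : ℝ, 0 < p → 2 * w + p ∈ Complex.slitPlane) → ∀ c : ℝ,
      AEStronglyMeasurable (fun p : ℝ => ((Real.exp (-p) * p ^ (-(1/2) : ℝ) : ℝ) : ℂ) *
        (2 * w + p) ^ (c : ℂ)) (volume.restrict (Ioi (0 : ℝ))) := by
    intro w hw c
    refine ContinuousOn.aestronglyMeasurable (ContinuousOn.mul ?_ ?_) measurableSet_Ioi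
    · refine Complex.continuous_ofReal.comp_continuousOn (ContinuousOn.mul (by fun_prop) ?_)
      exact fun p hp => (Real.continuousAt_rpow_const _ _
        (Or.inl (ne_of_gt hp))).continuousWithinAt
    · exact fun p hp => (ContinuousAt.cpow (f := fun p : ℝ => 2 * w + (p : ℂ))
        (by fun_prop) continuousAt_const (hw p hp)).continuousWithinAt
  have hGi : IntegrableOn (fun p : ℝ => Real.exp (-p) * p ^ (-(1/2) : ℝ)) (Ioi 0) := by
    rw [show (-(1/2) : ℝ) = 1/2 - 1 by norm_num]
    exact Real.GammaIntegral_convergent (by norm_num)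
  refine (hasDerivAt_integral_of_dominated_loc_of_deriv_le
    (F' := fun w p => ((Real.exp (-p) * p ^ (-(1/2) : ℝ) : ℝ) : ℂ) *
      ((((-(1/2) : ℝ)) : ℂ) * (2 * w + p) ^ (((-(3/2) : ℝ)) : ℂ) * 2))
    (bound := fun p => ‖z‖ ^ (-(3/2) : ℝ) * (Real.exp (-p) * p ^ (-(1/2) : ℝ)))
    (Metric.ball_mem_nhds z (by positivity : 0 < ‖z‖ / 4)) ?_ ?_ ?_ ?_ ?_ ?_).2.differentiableAt
  · filter_upwards [Metric.ball_mem_nhds z (by positivity : 0 < ‖z‖ / 4)] with w hw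
    exact hmeas w (fun p hp => (hnear w hw p hp).2) _
  · refine ((Real.GammaIntegral_convergent (s := 1/2) (by norm_num)).const_mul
      ((2 * ‖z‖) ^ (-(1/2) : ℝ))).mono' (hmeas z (fun p hp =>
        two_mul_add_mem_slitPlane hz hp) _) ?_
    filter_upwards [ae_restrict_mem measurableSet_Ioi] with p hp
    exact norm_macdonaldK0_integrand_le hz hz0 hp (by norm_num) le_rfl
  · refine ((hmeas z (fun p hp => two_mul_add_mem_slitPlane hz hp) (-(3/2))).const_mul
      (-1)).congr (Eventually.of_forall fun p => ?_)
    push_cast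
    ring
  · filter_upwards [ae_restrict_mem measurableSet_Ioi] with p hp w hw
    have hp : 0 < p := hp
    rw [norm_mul, norm_mul, norm_mul, Complex.norm_cpow_real, Complex.norm_real,
      Real.norm_of_nonneg (by positivity), mul_comm]
    refine mul_le_mul_of_nonneg_right ?_ (by positivity)
    rw [Complex.norm_real, Complex.norm_ofNat, Real.norm_eq_abs, abs_neg]
    norm_num [abs_of_pos]
    have := Real.rpow_le_rpow_of_nonpos h0 (hnear w hw p hp).1
      (show (-(3/2) : ℝ) ≤ 0 by norm_num)
    linarith
  · exact hGi.const_mul _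
  · filter_upwards [ae_restrict_mem measurableSet_Ioi] with p hp w hw
    refine HasDerivAt.const_mul _ ?_
    have h1 : HasDerivAt (fun w : ℂ => 2 * w + p) 2 w := by
      simpa using ((hasDerivAt_id w).const_mul 2).add_const (p : ℂ)
    have h2 := h1.cpow_const (c := (((-(1/2) : ℝ)) : ℂ)) (hnear w hw p hp).2
    rwa [show (((-(1/2) : ℝ)) : ℂ) - 1 = (((-(3/2) : ℝ)) : ℂ) by push_cast; norm_num] at h2

lemma integral_even_eq_two_mul {f : ℝ → ℝ} (hf : ∀ t, f (-t) = f t) :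
    ∫ t, f t = 2 * ∫ t in Ioi (0 : ℝ), f t := by
  rw [← integral_comp_abs]
  refine integral_congr_ae (Eventually.of_forall fun t => ?_)
  rcases abs_choice t with h | h <;> simp [h, hf]

lemma macdonaldK0_ofReal {y : ℝ} (hy : 0 < y) :
    macdonaldK0 y = ((∫ t in Ioi (0 : ℝ), Real.exp (-(y * Real.cosh t)) : ℝ) : ℂ) := by
  have himg : (fun t => y * (Real.cosh t - 1)) '' Ioi 0 = Ioi (0 : ℝ) := by
    ext p
    constructor
    · rintro ⟨t, ht, rfl⟩
      have : 1 < Real.cosh t := Real.one_lt_cosh.2 (ne_of_gt ht)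
      exact mul_pos hy (by linarith)
    · intro hp
      have hp : 0 < p / y := div_pos hp hy
      refine ⟨Real.arcosh (1 + p / y), Real.arcosh_pos (by linarith), ?_⟩
      simp only
      rw [Real.cosh_arcosh (by linarith)]
      field_simp
      ring
  have hinj : InjOn (fun t => y * (Real.cosh t - 1)) (Ioi 0) := by
    intro s hs t ht hst
    have : Real.cosh s = Real.cosh t := by
      have := mul_left_cancel₀ hy.ne' hst
      linarith
    rw [← Real.arcosh_cosh (le_of_lt hs), this, Real.arcosh_cosh (le_of_lt ht)]
  have h := integral_image_eq_integral_abs_deriv_smul (s := Ioi 0)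
    (f := fun t => y * (Real.cosh t - 1)) (f' := fun t => y * Real.sinh t) measurableSet_Ioi
    (fun t _ => (((Real.hasDerivAt_cosh t).sub_const 1).const_mul y).hasDerivWithinAt) hinj
    (fun p => ((Real.exp (-p) * p ^ (-(1/2) : ℝ) : ℝ) : ℂ) *
      (2 * (y : ℂ) + p) ^ (((-(1/2) : ℝ)) : ℂ))
  rw [himg] at h
  rw [macdonaldK0, h, ← integral_complex_ofReal, ← integral_const_mul]
  refine setIntegral_congr_fun measurableSet_Ioi fun t ht => ?_
  have hs : 0 < Real.sinh t := Real.sinh_pos_iff.2 ht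
  have hc : 1 < Real.cosh t := Real.one_lt_cosh.2 (ne_of_gt ht)
  have h2 : (2 * (y : ℂ) + ((y * (Real.cosh t - 1) : ℝ) : ℂ)) =
      ((y * (Real.cosh t + 1) : ℝ) : ℂ) := by push_cast; ring
  have h3 : (y * (Real.cosh t - 1)) ^ (-(1/2) : ℝ) * (y * (Real.cosh t + 1)) ^ (-(1/2) : ℝ) =
      (y * Real.sinh t)⁻¹ := by
    have hpos : 0 ≤ y * (Real.cosh t - 1) := mul_nonneg hy.le (by linarith)
    have hsq : y * (Real.cosh t - 1) * (y * (Real.cosh t + 1)) = (y * Real.sinh t) ^ 2 := by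
      rw [mul_pow, Real.sinh_sq]
      ring
    rw [← Real.mul_rpow hpos (by positivity), hsq, Real.rpow_neg (by positivity),
      ← Real.sqrt_eq_rpow, Real.sqrt_sq (by positivity)]
  rw [h2, ← Complex.ofReal_cpow (by positivity), ← Complex.ofReal_mul, mul_assoc (Real.exp _), h3,
    abs_of_pos (by positivity), Complex.real_smul, ← Complex.ofReal_neg, ← Complex.ofReal_exp,
    ← Complex.ofReal_mul, ← Complex.ofReal_mul]
  congr 1
  rw [show -(y * Real.cosh t) = -y + -(y * (Real.cosh t - 1)) by ring, Real.exp_add]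
  field_simp

lemma integral_exp_neg_mul_cosh {y : ℝ} (hy : 0 < y) :
    ∫ t : ℝ, ((Real.exp (-(y * Real.cosh t)) : ℝ) : ℂ) = 2 * macdonaldK0 y := by
  rw [macdonaldK0_ofReal hy, integral_complex_ofReal, integral_even_eq_two_mul (by simp)]
  push_cast
  ring

lemma integral_macdonaldK0_exp {p : ℂ} (hp : 0 < p.re) :
    ∫ u : ℝ, macdonaldK0 (Complex.exp u) * Complex.exp (p * u) =
      2 ^ (p - 2) * Complex.Gamma (p / 2) ^ 2 := by
  have hp2 : 0 < (p / 2).re := by simpa using hp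
  obtain ⟨hi, hG⟩ := integral_exp_neg_exp_add hp2
  have h := integral_mul_integral_eq hi hi
  have h2 : ∀ u : ℝ, ∫ q : ℝ,
      Complex.exp (-Complex.exp ((u + q : ℝ) : ℂ) + p / 2 * ((u + q : ℝ) : ℂ)) *
      Complex.exp (-Complex.exp ((u - q : ℝ) : ℂ) + p / 2 * ((u - q : ℝ) : ℂ)) =
      2 * (macdonaldK0 (Complex.exp ((u + Real.log 2 : ℝ) : ℂ)) * Complex.exp (p * u)) := by
    intro u
    have hpt : ∀ q : ℝ, Complex.exp (-Complex.exp ((u + q : ℝ) : ℂ) + p / 2 * ((u + q : ℝ) : ℂ)) *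
        Complex.exp (-Complex.exp ((u - q : ℝ) : ℂ) + p / 2 * ((u - q : ℝ) : ℂ)) =
        ((Real.exp (-(2 * Real.exp u * Real.cosh q)) : ℝ) : ℂ) * Complex.exp (p * u) := by
      intro q
      rw [← Complex.exp_add, Complex.ofReal_exp, ← Complex.exp_add, Real.cosh_eq]
      congr 1
      push_cast
      rw [sub_eq_add_neg (u : ℂ), Complex.exp_add, Complex.exp_add]
      ring
    rw [integral_congr_ae (Eventually.of_forall hpt), integral_mul_const,
      integral_exp_neg_mul_cosh (by positivity), ← Complex.ofReal_exp, Real.exp_add,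
      Real.exp_log two_pos, mul_comm (Real.exp u)]
    ring
  rw [hG, integral_congr_ae (Eventually.of_forall h2), integral_const_mul] at h
  have h3 := integral_add_right_eq_self (μ := volume) (fun u : ℝ =>
    macdonaldK0 (Complex.exp u) * Complex.exp (p * u)) (Real.log 2)
  rw [← h3]
  have h4 : ∀ u : ℝ, macdonaldK0 (Complex.exp ((u + Real.log 2 : ℝ) : ℂ)) *
      Complex.exp (p * ((u + Real.log 2 : ℝ) : ℂ)) =
      macdonaldK0 (Complex.exp ((u + Real.log 2 : ℝ) : ℂ)) * Complex.exp (p * u) * 2 ^ p := by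
    intro u
    rw [Complex.cpow_def_of_ne_zero two_ne_zero, mul_assoc, ← Complex.exp_add, Complex.ofReal_add,
      Complex.ofReal_log (by norm_num)]
    push_cast
    ring_nf
  rw [integral_congr_ae (Eventually.of_forall h4), integral_mul_const,
    Complex.cpow_sub _ _ two_ne_zero, pow_two, h]
  norm_num
  ring

lemma norm_macdonaldK0_exp_mul_exp_le {p : ℂ} (hp : 0 < p.re) (hp' : p.re < 1/2) :
    ∃ C δ : ℝ, 0 < δ ∧ ∀ t y : ℝ, |y| ≤ Real.pi / 2 →
      ‖macdonaldK0 (Complex.exp (t + y * Complex.I)) * Complex.exp (p * (t + y * Complex.I))‖ ≤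
        C * Real.exp (-(δ * |t|)) := by
  set E := Real.exp (|p.im| * (Real.pi / 2))
  have hgen : ∀ ε : ℝ, 0 < ε → ε ≤ 1/2 → ∀ t y : ℝ, |y| ≤ Real.pi / 2 →
      ‖macdonaldK0 (Complex.exp (t + y * Complex.I)) * Complex.exp (p * (t + y * Complex.I))‖ ≤
        Real.Gamma ε * 2 ^ (-ε) * E * Real.exp ((p.re - ε) * t) := by
    intro ε h1 h2 t y hy
    have hre : 0 ≤ (Complex.exp (t + y * Complex.I)).re := by
      rw [Complex.exp_re]
      simp only [Complex.add_im, Complex.ofReal_im, Complex.mul_im, Complex.ofReal_re,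
        Complex.I_im, Complex.I_re]
      have := Real.cos_nonneg_of_mem_Icc (abs_le.1 hy)
      simp
      positivity
    have hn : ‖Complex.exp (t + y * Complex.I)‖ = Real.exp t := by
      rw [Complex.norm_exp]; simp
    have h3 := norm_macdonaldK0_le hre (Complex.exp_ne_zero _) h1 h2
    have h4 : ‖Complex.exp (p * (t + y * Complex.I))‖ ≤ E * Real.exp (p.re * t) := by
      rw [Complex.norm_exp, ← Real.exp_add, Real.exp_le_exp]
      have : (p * (t + y * Complex.I)).re = p.re * t - p.im * y := by simp [Complex.mul_re]
      rw [this]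
      have : |p.im * y| ≤ |p.im| * (Real.pi / 2) := by rw [abs_mul]; gcongr
      linarith [neg_abs_le (p.im * y)]
    rw [norm_mul]
    have hG := Real.Gamma_pos_of_pos h1
    calc _ ≤ (Real.Gamma ε * (2 * Real.exp t) ^ (-ε) * 1) * (E * Real.exp (p.re * t)) := by
            refine mul_le_mul (h3.trans ?_) h4 (norm_nonneg _) (by positivity)
            rw [hn]
            gcongr
            exact Real.exp_le_one_iff.2 (by linarith)
      _ = _ := by
            rw [Real.mul_rpow (by norm_num) (by positivity), ← Real.exp_mul,
              show (p.re - ε) * t = t * (-ε) + p.re * t by ring, Real.exp_add]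
            ring
  refine ⟨Real.Gamma (p.re / 2) * 2 ^ (-(p.re / 2)) * E + Real.Gamma (1/2) * 2 ^ (-(1/2) : ℝ) * E,
    min (p.re / 2) (1/2 - p.re), lt_min (by linarith) (by linarith), fun t y hy => ?_⟩
  have hG1 := Real.Gamma_pos_of_pos (show 0 < p.re / 2 by linarith)
  have hG2 := Real.Gamma_pos_of_pos (show (0 : ℝ) < 1/2 by norm_num)
  rcases le_total t 0 with ht | ht
  · refine (hgen (p.re / 2) (by linarith) (by linarith) t y hy).trans ?_
    refine mul_le_mul (le_add_of_nonneg_right (by positivity)) (Real.exp_le_exp.2 ?_)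
      (by positivity) (by positivity)
    rw [abs_of_nonpos ht]
    nlinarith [min_le_left (p.re / 2) (1/2 - p.re)]
  · refine (hgen (1/2) (by norm_num) le_rfl t y hy).trans ?_
    refine mul_le_mul (le_add_of_nonneg_left (by positivity)) (Real.exp_le_exp.2 ?_)
      (by positivity) (by positivity)
    rw [abs_of_nonneg ht]
    nlinarith [min_le_right (p.re / 2) (1/2 - p.re)]

lemma Complex.exp_re_nonneg {z : ℂ} (hz : |z.im| ≤ Real.pi / 2) : 0 ≤ (Complex.exp z).re := by
  rw [Complex.exp_re]
  exact mul_nonneg (Real.exp_pos _).le (Real.cos_nonneg_of_mem_Icc (abs_le.1 hz))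

/-- Mellin transforms of `K₀` along the two halves of the imaginary axis. -/
lemma integral_macdonaldK0_mul_I {p : ℂ} (hp : 0 < p.re) (hp' : p.re < 1/2) :
    (∫ u : ℝ, macdonaldK0 (Complex.exp u * Complex.I) * Complex.exp (p * u) =
      Complex.exp (-(p * (Real.pi / 2 * Complex.I))) * (2 ^ (p - 2) * Complex.Gamma (p / 2) ^ 2)) ∧
    (∫ u : ℝ, macdonaldK0 (-(Complex.exp u * Complex.I)) * Complex.exp (p * u) =
      Complex.exp (p * (Real.pi / 2 * Complex.I)) * (2 ^ (p - 2) * Complex.Gamma (p / 2) ^ 2)) := by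
  obtain ⟨C, δ, hδ, hC⟩ := norm_macdonaldK0_exp_mul_exp_le hp hp'
  have hdiff : ∀ z : ℂ, |z.im| ≤ Real.pi / 2 → DifferentiableAt ℂ
      (fun z => macdonaldK0 (Complex.exp z) * Complex.exp (p * z)) z := fun z hz =>
    ((differentiableAt_macdonaldK0 (Complex.exp_re_nonneg hz) (Complex.exp_ne_zero z)).comp z
      (by fun_prop)).mul (by fun_prop)
  have hpi := Real.pi_pos
  obtain ⟨h1, h2⟩ := integral_boundary_strip (β := Real.pi / 2)
    (F := fun z => macdonaldK0 (Complex.exp z) * Complex.exp (p * z)) (by positivity)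
    (fun z hz => hdiff z hz.le) ((integrable_exp_neg_mul_abs hδ).const_mul C)
    (fun t _ y hy => hC t y hy.le)
    (fun t _ => (hdiff _ (by simp [abs_of_pos, hpi])).continuousAt)
    (fun t _ => (hdiff _ (by simp [abs_of_pos, hpi])).continuousAt)
  rw [integral_macdonaldK0_exp hp] at h1 h2
  constructor
  · rw [← h1, ← integral_const_mul]
    refine integral_congr_ae (Eventually.of_forall fun u => ?_)
    simp only
    push_cast
    rw [Complex.exp_add, Complex.exp_pi_div_two_mul_I, mul_left_comm, ← Complex.exp_add]
    ring_nf
  · rw [← h2, ← integral_const_mul]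
    refine integral_congr_ae (Eventually.of_forall fun u => ?_)
    simp only
    push_cast
    rw [Complex.exp_sub, Complex.exp_pi_div_two_mul_I, mul_left_comm, ← Complex.exp_add,
      Complex.div_I]
    ring_nf

lemma integrable_abs_rpow_mul_exp_neg {α δ : ℝ} (hα : α < 1) (hδ : 0 < δ) :
    Integrable fun t : ℝ => |t| ^ (-α) * Real.exp (-(δ * |t|)) :=
  integrable_comp_abs (f := fun t => t ^ (-α) * Real.exp (-(δ * t)))
    ((integrableOn_rpow_mul_exp_neg_mul_rpow (s := -α) (p := 1) (b := δ) (by linarith)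
      one_pos hδ).congr_fun (fun t _ => by simp) measurableSet_Ioi)

lemma abs_mul_exp_le_abs_sinh (t : ℝ) : |t| * Real.exp (|t| / 2) / 2 ≤ |Real.sinh t| := by
  rw [Real.abs_sinh]
  have h0 := abs_nonneg t
  have h1 : |t| / 2 ≤ Real.sinh (|t| / 2) := Real.self_le_sinh_iff.2 (by positivity)
  have h2 : Real.exp (|t| / 2) / 2 ≤ Real.cosh (|t| / 2) := by
    rw [Real.cosh_eq]
    linarith [Real.exp_pos (-(|t| / 2))]
  have h3 : Real.sinh |t| = 2 * Real.sinh (|t| / 2) * Real.cosh (|t| / 2) := by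
    rw [← Real.sinh_two_mul]; ring_nf
  rw [h3]
  nlinarith [mul_le_mul h1 h2 (by positivity) (by positivity)]

lemma abs_sinh_rpow_neg_le {α : ℝ} (hα : 0 ≤ α) {t : ℝ} (ht : t ≠ 0) :
    |Real.sinh t| ^ (-α) ≤ 2 ^ α * (|t| ^ (-α) * Real.exp (-(α / 2 * |t|))) := by
  have h0 : 0 < |t| := abs_pos.2 ht
  refine (Real.rpow_le_rpow_of_nonpos (by positivity) (abs_mul_exp_le_abs_sinh t)
    (by linarith)).trans_eq ?_
  rw [Real.div_rpow (by positivity) (by norm_num), Real.mul_rpow h0.le (by positivity),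
    Real.rpow_neg two_pos.le, ← Real.exp_mul, div_inv_eq_mul]
  ring_nf

lemma integrable_exp_neg_mul_cosh_add {c σ : ℝ} (hc : 0 < c) :
    Integrable fun t : ℝ => Real.exp (-(c * Real.cosh t) + σ * t) := by
  have h := integrable_comp_abs (integrable_exp_neg_mul_exp_add (c := c / 2) (σ := |σ| + 1)
    (by positivity) (by positivity)).integrableOn
  refine h.mono' (by fun_prop) (Eventually.of_forall fun t => ?_)
  rw [Real.norm_of_nonneg (Real.exp_pos _).le, Real.exp_le_exp]
  have h1 : Real.exp |t| / 2 ≤ Real.cosh t := by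
    rw [← Real.cosh_abs, Real.cosh_eq]
    linarith [Real.exp_pos (-|t|)]
  have h2 : σ * t ≤ |σ| * |t| := by rw [← abs_mul]; exact le_abs_self _
  nlinarith [abs_nonneg t]

lemma two_mul_besselK (ν : ℂ) {z : ℂ} (hz : 0 < z.re) :
    Integrable (fun t : ℝ => Complex.exp (-(z * Complex.cosh t) + ν * t)) ∧
      ∫ t : ℝ, Complex.exp (-(z * Complex.cosh t) + ν * t) = 2 * besselK ν z := by
  have hi : Integrable (fun t : ℝ => Complex.exp (-(z * Complex.cosh t) + ν * t)) := by
    refine (integrable_exp_neg_mul_cosh_add (σ := ν.re) hz).mono' (by fun_prop)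
      (Eventually.of_forall fun t => ?_)
    rw [Complex.norm_exp, ← Complex.ofReal_cosh]
    simp
  refine ⟨hi, ?_⟩
  rw [← intervalIntegral.integral_Iic_add_Ioi (b := 0) hi.integrableOn hi.integrableOn]
  have h1 := integral_comp_neg_Ioi (0 : ℝ)
    (fun t : ℝ => Complex.exp (-(z * Complex.cosh t) + ν * t))
  rw [neg_zero] at h1
  rw [← h1, besselK, ← integral_const_mul, ← integral_add ?_ hi.integrableOn]
  · refine integral_congr_ae (Eventually.of_forall fun t => ?_)
    simp only [Complex.cosh, Complex.ofReal_cosh, Complex.ofReal_neg]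
    rw [Complex.exp_add, Complex.exp_add]
    simp only [mul_neg, neg_neg, neg_mul, add_comm (Complex.exp (-(t : ℂ)))]
    ring
  · exact hi.comp_neg.integrableOn

lemma ofReal_besselKi (τ x : ℝ) : (besselKi τ x : ℂ) = besselK (Complex.I * τ) x := by
  rw [besselKi, besselK, ← integral_complex_ofReal]
  refine integral_congr_ae (Eventually.of_forall fun t => ?_)
  simp only
  rw [mul_comm Complex.I, mul_assoc, mul_comm Complex.I, ← mul_assoc, Complex.cosh_mul_I]
  push_cast
  rfl

/-- The square of a Macdonald function of imaginary order as a Fourier transform. -/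
lemma besselKi_sq_eq_integral {x : ℝ} (hx : 0 < x) (τ : ℝ) :
    ((besselKi τ x ^ 2 : ℝ) : ℂ) =
      ∫ t : ℝ, macdonaldK0 (2 * x * Complex.cosh t) * Complex.exp (2 * Complex.I * τ * t) := by
  obtain ⟨hi, hK⟩ := two_mul_besselK (Complex.I * τ) (z := x) (by simpa)
  have h := integral_mul_integral_eq hi hi
  have h2 : ∀ p q : ℝ,
      Complex.exp (-(x * Complex.cosh ((p + q : ℝ) : ℂ)) + Complex.I * τ * ((p + q : ℝ) : ℂ)) *
      Complex.exp (-(x * Complex.cosh ((p - q : ℝ) : ℂ)) + Complex.I * τ * ((p - q : ℝ) : ℂ)) =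
      ((Real.exp (-(2 * x * Real.cosh p * Real.cosh q)) : ℝ) : ℂ) *
        Complex.exp (2 * Complex.I * τ * p) := by
    intro p q
    rw [← Complex.exp_add, Complex.ofReal_exp, ← Complex.exp_add]
    congr 1
    push_cast
    rw [Complex.cosh_add, Complex.cosh_sub]
    ring
  have h3 : ∀ p : ℝ, ∫ q : ℝ, ((Real.exp (-(2 * x * Real.cosh p * Real.cosh q)) : ℝ) : ℂ) *
        Complex.exp (2 * Complex.I * τ * p) =
      2 * (macdonaldK0 (2 * x * Complex.cosh p) * Complex.exp (2 * Complex.I * τ * p)) := by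
    intro p
    rw [integral_mul_const, integral_exp_neg_mul_cosh (mul_pos (by positivity) (Real.cosh_pos p))]
    push_cast
    ring
  simp only [h2, h3] at h
  rw [hK, integral_const_mul] at h
  push_cast
  rw [ofReal_besselKi]
  linear_combination h / 4

lemma integral_exp_neg_mul_cosh_add_I {c β : ℝ} (hc : 0 < c) (hβ : |β| < Real.pi / 2) :
    ∫ q : ℝ, Complex.exp (-(c * Complex.cosh (q + β * Complex.I))) = 2 * macdonaldK0 c := by
  wlog h0 : 0 ≤ β generalizing β
  · rw [← this (β := -β) (by rwa [abs_neg]) (by linarith), ← integral_neg_eq_self]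
    refine integral_congr_ae (Eventually.of_forall fun q => ?_)
    simp only [Complex.ofReal_neg]
    rw [← Complex.cosh_neg]
    ring_nf
  rw [abs_of_nonneg h0] at hβ
  have hcos : 0 < Real.cos β := Real.cos_pos_of_mem_Ioo ⟨by linarith [Real.pi_pos], hβ⟩
  have hB := integrable_exp_neg_mul_cosh_add (c := c * Real.cos β) (σ := 0) (mul_pos hc hcos)
  rw [integral_shift_eq (F := fun z => Complex.exp (-(c * Complex.cosh z))) h0 (by fun_prop) hB,
    ← integral_exp_neg_mul_cosh hc]
  · push_cast; rfl
  · intro t _ y hy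
    rw [Complex.norm_exp, Real.exp_le_exp, Complex.cosh_add, Complex.cosh_mul_I,
      Complex.sinh_mul_I, ← Complex.ofReal_cosh, ← Complex.ofReal_cos, ← Complex.ofReal_sinh,
      ← Complex.ofReal_sin]
    have hc' : Real.cos β ≤ Real.cos y := Real.cos_le_cos_of_nonneg_of_le_pi hy.1
      (by linarith [Real.pi_pos]) hy.2
    simp [Complex.mul_re]
    rw [Complex.cos_ofReal_re]
    have := mul_le_mul_of_nonneg_left hc' (mul_pos hc (Real.cosh_pos t)).le
    linarith

lemma integral_exp_neg_mul_cosh_cosh_add_sinh_sinh {c : ℝ} (hc : 0 < c) (p : ℝ) :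
    ∫ q : ℝ, Complex.exp (-(c * (Complex.cosh p * Complex.cosh q +
      Complex.I * (Complex.sinh p * Complex.sinh q)))) =
    2 * macdonaldK0 (c * (Real.sqrt (Real.cosh (2 * p)) : ℝ)) := by
  set R := Real.sqrt (Real.cosh (2 * p)) with hR
  have hcosh := Real.cosh_pos p
  have hR0 : 0 < R := Real.sqrt_pos.2 (Real.cosh_pos _)
  have hR2 : R ^ 2 = Real.cosh p ^ 2 + Real.sinh p ^ 2 := by
    rw [hR, Real.sq_sqrt (Real.cosh_pos _).le, Real.cosh_two_mul]
  set β := Real.arctan (Real.sinh p / Real.cosh p) with hβ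
  have hs : Real.sqrt (1 + (Real.sinh p / Real.cosh p) ^ 2) = R / Real.cosh p := by
    rw [show 1 + (Real.sinh p / Real.cosh p) ^ 2 = (R / Real.cosh p) ^ 2 by
      rw [div_pow R, hR2]; field_simp, Real.sqrt_sq (by positivity)]
  have h1 : R * Real.cos β = Real.cosh p := by
    rw [hβ, Real.cos_arctan, hs]; field_simp
  have h2 : R * Real.sin β = Real.sinh p := by
    rw [hβ, Real.sin_arctan, hs]; field_simp
  have h := integral_exp_neg_mul_cosh_add_I (c := c * R) (β := β) (by positivity)
    (abs_lt.2 ⟨Real.neg_pi_div_two_lt_arctan _, Real.arctan_lt_pi_div_two _⟩)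
  push_cast at h
  rw [← h]
  refine integral_congr_ae (Eventually.of_forall fun q => ?_)
  simp only
  rw [← Complex.ofReal_cosh p, ← Complex.ofReal_sinh p, ← h1, ← h2, Complex.cosh_add,
    Complex.cosh_mul_I, Complex.sinh_mul_I]
  push_cast
  ring_nf

lemma conj_macdonaldK0_ofReal {y : ℝ} (hy : 0 < y) :
    (starRingEnd ℂ) (macdonaldK0 y) = macdonaldK0 y := by
  rw [macdonaldK0_ofReal hy, Complex.conj_ofReal]

/-- The kernel of the index transforms as a Fourier transform. -/
lemma kernelK_eq_integral {u : ℝ} (hu : 0 < u) (τ : ℝ) :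
    (kernelK u τ : ℂ) = 1 / 2 * ∫ t : ℝ,
      macdonaldK0 ((4 * u ^ ((1 : ℝ) / 4) * Real.sqrt (Real.cosh t) : ℝ) : ℂ) *
        Complex.exp (2 * Complex.I * τ * t) := by
  set ρ : ℝ := 2 * (4 * u) ^ ((1 : ℝ) / 4) with hρ
  have hρ0 : 0 < ρ := by positivity
  have hs2 : Real.sqrt 2 * Real.sqrt 2 = 2 := Real.mul_self_sqrt (by norm_num)
  have hs0 : 0 < Real.sqrt 2 := by positivity
  have hρ' : ρ * Real.sqrt 2 = 4 * u ^ ((1 : ℝ) / 4) := by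
    have h4 : (4 : ℝ) ^ ((1 : ℝ) / 4) = Real.sqrt 2 := by
      rw [show (4 : ℝ) = 2 ^ (2 : ℝ) by norm_num, ← Real.rpow_mul (by norm_num), Real.sqrt_eq_rpow]
      norm_num
    rw [hρ, Real.mul_rpow (by norm_num) hu.le, h4]
    linear_combination (2 * u ^ ((1 : ℝ) / 4)) * hs2
  have he : Complex.exp (Complex.I * Real.pi / 4) = (Real.sqrt 2 / 2) * (1 + Complex.I) := by
    rw [show Complex.I * Real.pi / 4 = ((Real.pi / 4 : ℝ) : ℂ) * Complex.I by push_cast; ring,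
      Complex.exp_mul_I, ← Complex.ofReal_cos, ← Complex.ofReal_sin, Real.cos_pi_div_four,
      Real.sin_pi_div_four]
    push_cast; ring
  have he' : Complex.exp (-(Complex.I * Real.pi) / 4) = (Real.sqrt 2 / 2) * (1 - Complex.I) := by
    rw [show -(Complex.I * Real.pi) / 4 = ((-(Real.pi / 4) : ℝ) : ℂ) * Complex.I by
        push_cast; ring,
      Complex.exp_mul_I, ← Complex.ofReal_cos, ← Complex.ofReal_sin, Real.cos_neg, Real.sin_neg,
      Real.cos_pi_div_four, Real.sin_pi_div_four]
    push_cast; ring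
  set z := (ρ : ℂ) * ((Real.sqrt 2 / 2) * (1 + Complex.I)) with hz
  set z' := (ρ : ℂ) * ((Real.sqrt 2 / 2) * (1 - Complex.I)) with hz'
  have hre : 0 < z.re := by simp [hz, Complex.mul_re]; positivity
  have hre' : 0 < z'.re := by simp [hz', Complex.mul_re]; positivity
  obtain ⟨hi, hK⟩ := two_mul_besselK (2 * Complex.I * τ) hre
  obtain ⟨hi', hK'⟩ := two_mul_besselK (2 * Complex.I * τ) hre'
  have h := integral_mul_integral_eq hi hi'
  rw [hK, hK'] at h
  have h2 : ∀ p q : ℝ,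
      Complex.exp (-(z * Complex.cosh ((p + q : ℝ) : ℂ)) + 2 * Complex.I * τ * ((p + q : ℝ) : ℂ)) *
      Complex.exp (-(z' * Complex.cosh ((p - q : ℝ) : ℂ)) + 2 * Complex.I * τ * ((p - q : ℝ) : ℂ)) =
      Complex.exp (-(((ρ * Real.sqrt 2 : ℝ) : ℂ) * (Complex.cosh p * Complex.cosh q +
        Complex.I * (Complex.sinh p * Complex.sinh q)))) *
        Complex.exp (4 * Complex.I * τ * p) := by
    intro p q
    rw [← Complex.exp_add, ← Complex.exp_add, hz, hz']
    congr 1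
    push_cast
    rw [Complex.cosh_add, Complex.cosh_sub]
    ring
  set G : ℝ → ℂ := fun t =>
      macdonaldK0 ((4 * u ^ ((1 : ℝ) / 4) * Real.sqrt (Real.cosh t) : ℝ) : ℂ) *
        Complex.exp (2 * Complex.I * τ * t) with hG
  have h3 : ∀ p : ℝ, ∫ q : ℝ, Complex.exp (-(((ρ * Real.sqrt 2 : ℝ) : ℂ) *
        (Complex.cosh p * Complex.cosh q + Complex.I * (Complex.sinh p * Complex.sinh q)))) *
        Complex.exp (4 * Complex.I * τ * p) = 2 * G (2 * p) := by
    intro p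
    rw [integral_mul_const, integral_exp_neg_mul_cosh_cosh_add_sinh_sinh (by positivity), hρ', hG]
    push_cast
    ring_nf
  simp only [h2, h3] at h
  rw [integral_const_mul, Measure.integral_comp_mul_left] at h
  have h4 : besselK (2 * Complex.I * τ) z * besselK (2 * Complex.I * τ) z' = 1 / 2 * ∫ t, G t := by
    rw [abs_of_pos (by norm_num), Complex.real_smul] at h
    push_cast at h
    linear_combination h / 4
  have h5 : (starRingEnd ℂ) (∫ t, G t) = ∫ t, G t := by
    rw [← integral_conj, ← integral_neg_eq_self]
    refine integral_congr_ae (Eventually.of_forall fun t => ?_)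
    simp only [hG, map_mul, ← Complex.exp_conj]
    rw [conj_macdonaldK0_ofReal (mul_pos (by positivity) (Real.sqrt_pos.2 (Real.cosh_pos _)))]
    simp [Complex.conj_ofNat]
  rw [kernelK, he, he', ← hz, ← hz', h4]
  obtain ⟨r, hr⟩ := Complex.conj_eq_iff_real.1 h5
  rw [hr, show (1 / 2 * (r : ℂ)) = ((1 / 2 * r : ℝ) : ℂ) by push_cast; ring, Complex.ofReal_re]

/-- `V` is holomorphic on the vertical strip `α < Re s < β`, and `O(exp (-κ |Im s|))` on every
closed vertical substrip. -/
structure StripDecay (V : ℂ → ℂ) (α β κ : ℝ) : Prop where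
  diff : ∀ s : ℂ, α < s.re → s.re < β → DifferentiableAt ℂ V s
  bound : ∀ σ₀ σ₁ : ℝ, α < σ₀ → σ₁ < β → ∃ M : ℝ, 0 ≤ M ∧ ∀ s : ℂ, σ₀ ≤ s.re → s.re ≤ σ₁ →
    ‖V s‖ ≤ M * Real.exp (-(κ * |s.im|))

namespace StripDecay

variable {V U : ℂ → ℂ} {α β κ κ' σ σ' : ℝ}

lemma mul (hV : StripDecay V α β κ) (hU : StripDecay U α β κ') :
    StripDecay (fun s => V s * U s) α β (κ + κ') where
  diff s h1 h2 := (hV.diff s h1 h2).mul (hU.diff s h1 h2)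
  bound σ₀ σ₁ h0 h1 := by
    obtain ⟨M, hM0, hM⟩ := hV.bound σ₀ σ₁ h0 h1
    obtain ⟨N, hN0, hN⟩ := hU.bound σ₀ σ₁ h0 h1
    refine ⟨M * N, by positivity, fun s hs0 hs1 => ?_⟩
    rw [norm_mul, show -((κ + κ') * |s.im|) = -(κ * |s.im|) + -(κ' * |s.im|) by ring, Real.exp_add]
    calc _ ≤ (M * Real.exp (-(κ * |s.im|))) * (N * Real.exp (-(κ' * |s.im|))) := by
          gcongr
          exacts [hM s hs0 hs1, hN s hs0 hs1]
      _ = _ := by ring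

lemma mono (hV : StripDecay V α β κ) {α' β' : ℝ} (hα : α ≤ α') (hβ : β' ≤ β) (hκ : κ' ≤ κ) :
    StripDecay V α' β' κ' where
  diff s h1 h2 := hV.diff s (hα.trans_lt h1) (h2.trans_le hβ)
  bound σ₀ σ₁ h0 h1 := by
    obtain ⟨M, hM0, hM⟩ := hV.bound σ₀ σ₁ (hα.trans_lt h0) (h1.trans_le hβ)
    refine ⟨M, hM0, fun s hs0 hs1 => (hM s hs0 hs1).trans ?_⟩
    gcongr

lemma const_mul (hV : StripDecay V α β κ) (c : ℂ) : StripDecay (fun s => c * V s) α β κ where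
  diff s h1 h2 := (hV.diff s h1 h2).const_mul c
  bound σ₀ σ₁ h0 h1 := by
    obtain ⟨M, hM0, hM⟩ := hV.bound σ₀ σ₁ h0 h1
    refine ⟨‖c‖ * M, by positivity, fun s hs0 hs1 => ?_⟩
    rw [norm_mul, mul_assoc]
    gcongr
    exact hM s hs0 hs1

/-- `exp (c s)` with real `c` is bounded on vertical strips. -/
lemma exp_mul (c : ℝ) : StripDecay (fun s => Complex.exp (c * s)) α β 0 where
  diff s _ _ := by fun_prop
  bound σ₀ σ₁ h0 h1 := by
    refine ⟨Real.exp (c * σ₀) + Real.exp (c * σ₁), by positivity, fun s hs0 hs1 => ?_⟩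
    rw [Complex.norm_exp]
    simp only [Complex.re_ofReal_mul, zero_mul, neg_zero, Real.exp_zero, mul_one]
    rcases le_total 0 c with hc | hc
    · refine le_trans ?_ (le_add_of_nonneg_left (Real.exp_pos _).le)
      gcongr
    · refine le_trans ?_ (le_add_of_nonneg_right (Real.exp_pos _).le)
      exact Real.exp_le_exp.2 (mul_le_mul_of_nonpos_left hs0 hc)

lemma norm_le (hV : StripDecay V α β κ) (hσ : α < σ) (hσ' : σ' < β) :
    ∃ M : ℝ, 0 ≤ M ∧ ∀ ρ ∈ Icc σ σ', ∀ (ζ : ℂ) (r : ℝ),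
      ‖V (ρ + r * Complex.I) * Complex.exp ((ρ + r * Complex.I) * ζ)‖ ≤
        M * Real.exp (ρ * ζ.re) * Real.exp (-((κ - |ζ.im|) * |r|)) := by
  obtain ⟨M, hM0, hM⟩ := hV.bound σ σ' hσ hσ'
  refine ⟨M, hM0, fun ρ hρ ζ r => ?_⟩
  have h := hM (ρ + r * Complex.I) (by simpa using hρ.1) (by simpa using hρ.2)
  rw [norm_mul, Complex.norm_exp]
  have h2 : ((ρ + r * Complex.I) * ζ).re = ρ * ζ.re - r * ζ.im := by simp [Complex.mul_re]
  have h3 : ‖V (ρ + r * Complex.I)‖ ≤ M * Real.exp (-(κ * |r|)) := by simpa using h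
  rw [h2]
  calc _ ≤ M * Real.exp (-(κ * |r|)) * Real.exp (ρ * ζ.re - r * ζ.im) := by gcongr
    _ = M * Real.exp (-(κ * |r|) + (ρ * ζ.re - r * ζ.im)) := by rw [Real.exp_add]; ring
    _ ≤ M * Real.exp (ρ * ζ.re + -((κ - |ζ.im|) * |r|)) := by
      refine mul_le_mul_of_nonneg_left (Real.exp_le_exp.2 ?_) hM0
      have : |r * ζ.im| = |r| * |ζ.im| := abs_mul _ _
      nlinarith [neg_abs_le (r * ζ.im)]
    _ = _ := by rw [Real.exp_add]; ring

lemma continuous_line (hV : StripDecay V α β κ) (h1 : α < σ) (h2 : σ < β) :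
    Continuous fun r : ℝ => V (σ + r * Complex.I) := by
  rw [continuous_iff_continuousAt]
  intro r
  exact ((hV.diff (σ + r * Complex.I) (by simpa) (by simpa)).continuousAt).comp
    (f := fun r : ℝ => (σ + r * Complex.I : ℂ)) (by fun_prop)

lemma integrable (hV : StripDecay V α β κ) (h1 : α < σ) (h2 : σ < β) {ζ : ℂ} (hζ : |ζ.im| < κ) :
    Integrable fun r : ℝ => V (σ + r * Complex.I) * Complex.exp ((σ + r * Complex.I) * ζ) := by
  obtain ⟨M, hM0, hM⟩ := hV.norm_le h1 h2
  refine ((integrable_exp_neg_mul_abs (sub_pos.2 hζ)).const_mul (M * Real.exp (σ * ζ.re))).mono'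
    ?_ (Eventually.of_forall fun r => hM σ ⟨le_rfl, le_rfl⟩ ζ r)
  exact ((hV.continuous_line h1 h2).mul (by fun_prop)).aestronglyMeasurable

end StripDecay

/-- The inverse Mellin type integral of `V s * exp (s ζ)` along the line `Re s = σ`. -/
noncomputable def verticalIntegral (V : ℂ → ℂ) (σ : ℝ) (ζ : ℂ) : ℂ :=
  1 / (2 * (Real.pi : ℂ)) *
    ∫ r : ℝ, V (σ + r * Complex.I) * Complex.exp ((σ + r * Complex.I) * ζ)

namespace StripDecay

variable {V : ℂ → ℂ} {α β κ κ' σ σ' : ℝ}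

lemma hasDerivAt_verticalIntegral (hV : StripDecay V α β κ) (h1 : α < σ) (h2 : σ < β) {ζ : ℂ}
    (hζ : |ζ.im| < κ) : HasDerivAt (verticalIntegral V σ)
      (verticalIntegral (fun s => s * V s) σ ζ) ζ := by
  obtain ⟨M, hM0, hM⟩ := hV.norm_le h1 h2
  set δ := (κ - |ζ.im|) / 2 with hδ
  have hδ0 : 0 < δ := by linarith
  have him : ∀ w ∈ Metric.ball ζ δ, δ ≤ κ - |w.im| ∧ w.re ≤ ζ.re + δ ∧ ζ.re - δ ≤ w.re := by
    intro w hw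
    rw [Metric.mem_ball, dist_eq_norm] at hw
    have h3 := (Complex.abs_im_le_norm (w - ζ)).trans hw.le
    have h4 := abs_le.1 ((Complex.abs_re_le_norm (w - ζ)).trans hw.le)
    rw [Complex.sub_im] at h3
    rw [Complex.sub_re] at h4
    have := abs_sub_abs_le_abs_sub w.im ζ.im
    exact ⟨by linarith, by linarith, by linarith⟩
  have hint := integrable_exp_neg_mul_abs (half_pos hδ0)
  set K := M * (Real.exp (σ * (ζ.re + δ)) + Real.exp (σ * (ζ.re - δ))) * (|σ| + 2 / δ)
  refine HasDerivAt.const_mul _ ?_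
  have hb : ∀ r : ℝ, ∀ w ∈ Metric.ball ζ δ, ‖(σ + r * Complex.I) * V (σ + r * Complex.I) *
      Complex.exp ((σ + r * Complex.I) * w)‖ ≤ K * Real.exp (-(δ / 2 * |r|)) := by
    intro r w hw
    obtain ⟨e1, e2, e3⟩ := him w hw
    have h4 : ‖(σ + r * Complex.I : ℂ)‖ ≤ |σ| + |r| := by
      refine (norm_add_le _ _).trans_eq ?_
      simp
    have h5 : |r| ≤ 2 / δ * Real.exp (δ / 2 * |r|) := by
      have := Real.add_one_le_exp (δ / 2 * |r|)
      rw [div_mul_eq_mul_div, le_div_iff₀ hδ0]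
      nlinarith
    have h6 : |σ| + |r| ≤ (|σ| + 2 / δ) * Real.exp (δ / 2 * |r|) := by
      have h7 : 1 ≤ Real.exp (δ / 2 * |r|) := Real.one_le_exp (by positivity)
      nlinarith [abs_nonneg σ]
    have h8 : Real.exp (σ * w.re) ≤ Real.exp (σ * (ζ.re + δ)) + Real.exp (σ * (ζ.re - δ)) := by
      rcases le_total 0 σ with hc | hc
      · refine le_trans ?_ (le_add_of_nonneg_right (Real.exp_pos _).le)
        gcongr
      · refine le_trans ?_ (le_add_of_nonneg_left (Real.exp_pos _).le)
        exact Real.exp_le_exp.2 (mul_le_mul_of_nonpos_left e3 hc)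
    rw [mul_assoc, norm_mul]
    calc _ ≤ ((|σ| + 2 / δ) * Real.exp (δ / 2 * |r|)) *
        (M * (Real.exp (σ * (ζ.re + δ)) + Real.exp (σ * (ζ.re - δ))) * Real.exp (-(δ * |r|))) := by
          refine mul_le_mul (h4.trans h6) ((hM σ ⟨le_rfl, le_rfl⟩ w r).trans ?_)
            (norm_nonneg _) (by positivity)
          gcongr
      _ = K * (Real.exp (δ / 2 * |r|) * Real.exp (-(δ * |r|))) := by ring
      _ = _ := by rw [← Real.exp_add]; ring_nf
  refine (hasDerivAt_integral_of_dominated_loc_of_deriv_le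
    (F' := fun w r => (σ + r * Complex.I) * V (σ + r * Complex.I) *
      Complex.exp ((σ + r * Complex.I) * w))
    (bound := fun r => K * Real.exp (-(δ / 2 * |r|)))
    (Metric.ball_mem_nhds ζ hδ0) ?_ (hV.integrable h1 h2 hζ) ?_ ?_ (hint.const_mul K) ?_).2
  · exact Eventually.of_forall fun w =>
      ((hV.continuous_line h1 h2).mul (by fun_prop)).aestronglyMeasurable
  · exact (((Continuous.mul (by fun_prop) (hV.continuous_line h1 h2))).mul
      (by fun_prop)).aestronglyMeasurable
  · exact Eventually.of_forall hb
  · refine Eventually.of_forall fun r w _ => ?_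
    have := ((((hasDerivAt_id w).const_mul (σ + r * Complex.I : ℂ)).cexp).const_mul
      (V (σ + r * Complex.I)))
    exact this.congr_deriv (by simp only [id]; ring)

lemma verticalIntegral_eq (hV : StripDecay V α β κ) (h1 : α < σ) (h2 : σ < β) (h1' : α < σ')
    (h2' : σ' < β) {ζ : ℂ} (hζ : |ζ.im| < κ) :
    verticalIntegral V σ ζ = verticalIntegral V σ' ζ := by
  wlog hle : σ' ≤ σ generalizing σ σ'
  · exact (this h1' h2' h1 h2 (not_le.1 hle).le).symm
  obtain ⟨M, hM0, hM⟩ := hV.norm_le h1' h2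
  rw [verticalIntegral, verticalIntegral]
  congr 1
  have h := integral_shift_eq (θ := σ - σ') (F := fun z => V (σ + z * Complex.I) *
    Complex.exp ((σ + z * Complex.I) * ζ)) (B := fun r => M * (Real.exp (σ * ζ.re) +
      Real.exp (σ' * ζ.re)) * Real.exp (-((κ - |ζ.im|) * |r|))) (by linarith) ?_
    ((integrable_exp_neg_mul_abs (sub_pos.2 hζ)).const_mul _) ?_
  · rw [← h]
    refine integral_congr_ae (Eventually.of_forall fun r => ?_)
    simp only
    have : (σ + (r + ((σ - σ' : ℝ) : ℂ) * Complex.I) * Complex.I : ℂ) = σ' + r * Complex.I := by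
      push_cast
      linear_combination ((σ : ℂ) - σ') * Complex.I_mul_I
    rw [this]
  · intro z hz
    have hz : 0 ≤ z.im ∧ z.im ≤ σ - σ' := hz
    have hre : (σ + z * Complex.I).re = σ - z.im := by simp; ring
    refine (DifferentiableAt.mul ?_ (by fun_prop)).differentiableWithinAt
    exact (hV.diff _ (by linarith) (by linarith)).comp z (f := fun z : ℂ => σ + z * Complex.I)
      (by fun_prop)
  · intro t _ y hy
    have : (σ + (t + y * Complex.I) * Complex.I : ℂ) = ((σ - y : ℝ) : ℂ) + t * Complex.I := by
      push_cast
      linear_combination (y : ℂ) * Complex.I_mul_I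
    rw [this]
    refine (hM (σ - y) ⟨by linarith [hy.2], by linarith [hy.1]⟩ ζ t).trans ?_
    gcongr
    rcases le_total 0 ζ.re with hc | hc
    · refine le_trans ?_ (le_add_of_nonneg_right (Real.exp_pos _).le)
      gcongr
      linarith [hy.1]
    · refine le_trans ?_ (le_add_of_nonneg_left (Real.exp_pos _).le)
      exact Real.exp_le_exp.2 (mul_le_mul_of_nonpos_right (by linarith [hy.2]) hc)

lemma norm_verticalIntegral_le (hV : StripDecay V α β κ) (h1 : α < σ) (h2 : σ < β) (hκ : κ' < κ) :
    ∃ C : ℝ, 0 ≤ C ∧ ∀ ζ : ℂ, |ζ.im| ≤ κ' →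
      ‖verticalIntegral V σ ζ‖ ≤ C * Real.exp (σ * ζ.re) := by
  obtain ⟨M, hM0, hM⟩ := hV.norm_le h1 h2
  have hint := integrable_exp_neg_mul_abs (sub_pos.2 hκ)
  refine ⟨‖1 / (2 * (Real.pi : ℂ))‖ * (M * ∫ r : ℝ, Real.exp (-((κ - κ') * |r|))), by positivity,
    fun ζ hζ => ?_⟩
  rw [verticalIntegral, norm_mul, mul_assoc, mul_right_comm, ← integral_const_mul]
  gcongr
  refine norm_integral_le_of_norm_le (hint.const_mul _) (Eventually.of_forall fun r => ?_)
  refine (hM σ ⟨le_rfl, le_rfl⟩ ζ r).trans ?_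
  gcongr

end StripDecay

lemma Complex.differentiableAt_Gamma_of_re_pos {s : ℂ} (hs : 0 < s.re) :
    DifferentiableAt ℂ Complex.Gamma s := by
  refine Complex.differentiableAt_Gamma s fun m h => ?_
  rw [h] at hs
  simp only [Complex.neg_re, Complex.natCast_re] at hs
  linarith [m.cast_nonneg (α := ℝ)]

namespace StripDecay

variable {V : ℂ → ℂ} {α β κ : ℝ}

lemma dslope_ofReal (hV : StripDecay V α β 0) {c : ℝ} (h1 : α < c) (h2 : c < β) (hVc : V c = 0) :
    StripDecay (dslope V c) α β 0 := by
  have hopen : IsOpen {s : ℂ | α < s.re ∧ s.re < β} :=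
    (isOpen_lt continuous_const Complex.continuous_re).inter
      (isOpen_lt Complex.continuous_re continuous_const)
  have hd : DifferentiableOn ℂ (dslope V c) {s : ℂ | α < s.re ∧ s.re < β} :=
    (Complex.differentiableOn_dslope (hopen.mem_nhds ⟨by simpa, by simpa⟩)).2
      fun s hs => (hV.diff s hs.1 hs.2).differentiableWithinAt
  refine ⟨fun s hs hs' => hd.differentiableAt (hopen.mem_nhds ⟨hs, hs'⟩), fun σ₀ σ₁ h0 h3 => ?_⟩
  obtain ⟨M, hM0, hM⟩ := hV.bound σ₀ σ₁ h0 h3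
  have hcomp : IsCompact (Icc σ₀ σ₁ ×ℂ Icc (-1) 1) := isCompact_Icc.reProdIm isCompact_Icc
  obtain ⟨N, hN⟩ := hcomp.exists_bound_of_continuousOn (f := dslope V c) <|
    hd.continuousOn.mono fun s hs => ⟨h0.trans_le hs.1.1, hs.1.2.trans_lt h3⟩
  refine ⟨max M N, le_max_of_le_left hM0, fun s hs hs' => ?_⟩
  simp only [zero_mul, neg_zero, Real.exp_zero, mul_one]
  rcases le_total |s.im| 1 with h | h
  · exact (hN s ⟨⟨hs, hs'⟩, abs_le.1 h⟩).trans (le_max_right _ _)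
  · refine le_trans ?_ (le_max_left _ _)
    have hne : s ≠ c := by
      rintro rfl
      simp at h
      linarith
    have h4 : 1 ≤ ‖s - c‖ := h.trans (by simpa using Complex.abs_im_le_norm (s - c))
    have h5 : ‖V s‖ ≤ M := by simpa using hM s hs hs'
    rw [dslope_of_ne _ hne, slope_def_field, hVc, sub_zero, norm_div]
    exact div_le_of_le_mul₀ (by positivity) hM0 (by nlinarith)

lemma Gamma_mul_sub {c d θ : ℝ} (hd : 0 < d) (hθ : 0 ≤ θ) (hθ' : θ < Real.pi / 2) :
    StripDecay (fun s => Complex.Gamma (d * (c - s))) α c (d * θ) where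
  diff s _ h := by
    refine (Complex.differentiableAt_Gamma_of_re_pos ?_).comp s
      (f := fun s : ℂ => (d * (c - s) : ℂ)) (by fun_prop)
    simpa using mul_pos hd (sub_pos.2 h)
  bound σ₀ σ₁ h0 h1 := by
    obtain ⟨C, hC0, hC⟩ := norm_Gamma_le_exp_neg (σ₀ := d * (c - σ₁)) (σ₁ := d * (c - σ₀))
      (mul_pos hd (sub_pos.2 h1)) hθ hθ'
    refine ⟨C, hC0, fun s hs hs' => (hC _ ?_ ?_).trans_eq ?_⟩
    · simp only [Complex.re_ofReal_mul, Complex.sub_re, Complex.ofReal_re]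
      gcongr
    · simp only [Complex.re_ofReal_mul, Complex.sub_re, Complex.ofReal_re]
      gcongr
    · simp only [Complex.im_ofReal_mul, Complex.sub_im, Complex.ofReal_im, zero_sub, abs_mul,
        abs_neg, abs_of_pos hd]
      ring_nf

lemma Gamma {θ : ℝ} (hθ : 0 ≤ θ) (hθ' : θ < Real.pi / 2) :
    StripDecay Complex.Gamma 0 β θ where
  diff _ h _ := Complex.differentiableAt_Gamma_of_re_pos h
  bound _ _ h0 _ := norm_Gamma_le_exp_neg h0 hθ hθ'

lemma cos_pi_mul : StripDecay (fun s => Complex.cos (Real.pi * s)) α β (-Real.pi) where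
  diff s _ _ := by fun_prop
  bound _ _ _ _ := by
    refine ⟨1, zero_le_one, fun s _ _ => ?_⟩
    have hre : (Real.pi * s * Complex.I).re = -(Real.pi * s.im) := by simp
    have hre' : (-(Real.pi * s) * Complex.I).re = Real.pi * s.im := by simp
    have hπ : |Real.pi * s.im| = Real.pi * |s.im| := by rw [abs_mul, abs_of_pos Real.pi_pos]
    rw [Complex.cos, norm_div, Complex.norm_two, div_le_iff₀ two_pos]
    refine (norm_add_le _ _).trans ?_
    rw [Complex.norm_exp, Complex.norm_exp, hre, hre', one_mul, neg_mul, neg_neg, ← hπ, mul_two]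
    gcongr
    · exact neg_le_abs _
    · exact le_abs_self _

end StripDecay

lemma mellinT_eq_mellin (f : ℝ → ℝ) : mellinT f = mellin (fun x => (f x : ℂ)) := by
  ext s
  simp only [mellinT, mellin, smul_eq_mul, mul_comm]

section Mellin

variable {f : ℝ → ℝ} {a b : ℝ}

lemma integrableOn_abs_mul_rpow (hf : LocallyIntegrableOn f (Ioi 0))
    (hO0 : f =O[nhdsWithin 0 (Ioi 0)] fun x => x ^ (-a)) (hOinf : f =O[atTop] fun x => x ^ (-b))
    {σ : ℝ} (h1 : a < σ) (h2 : σ < b) :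
    IntegrableOn (fun x => |f x| * x ^ (σ - 1)) (Ioi 0) := by
  have h := mellin_convergent_of_isBigO_scalar hf hOinf h2 hO0 h1
  refine IntegrableOn.congr_fun h.norm (fun x hx => ?_) measurableSet_Ioi
  simp only [norm_mul, Real.norm_eq_abs, abs_of_pos (Real.rpow_pos_of_pos hx _)]
  ring

lemma stripDecay_mellinT (hf : LocallyIntegrableOn f (Ioi 0))
    (hO0 : f =O[nhdsWithin 0 (Ioi 0)] fun x => x ^ (-a)) (hOinf : f =O[atTop] fun x => x ^ (-b)) :
    StripDecay (mellinT f) a b 0 where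
  diff s h1 h2 := by
    rw [mellinT_eq_mellin]
    refine mellin_differentiableAt_of_isBigO_rpow (a := b) (b := a) ?_ ?_ h2 ?_ h1
    · exact fun x hx => let ⟨t, ht, hft⟩ := hf x hx; ⟨t, ht, hft.ofReal⟩
    · exact (Complex.isBigO_ofReal_left.2 hOinf)
    · exact (Complex.isBigO_ofReal_left.2 hO0)
  bound σ₀ σ₁ h0 h1 := by
    by_cases h01 : σ₁ < σ₀
    · exact ⟨0, le_rfl, fun s hs hs' => by linarith⟩
    rw [not_lt] at h01
    have i0 := integrableOn_abs_mul_rpow hf hO0 hOinf h0 (h01.trans_lt h1)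
    have i1 := integrableOn_abs_mul_rpow hf hO0 hOinf (h0.trans_le h01) h1
    refine ⟨∫ x in Ioi 0, (|f x| * x ^ (σ₀ - 1) + |f x| * x ^ (σ₁ - 1)), ?_, fun s hs hs' => ?_⟩
    · refine setIntegral_nonneg measurableSet_Ioi fun x hx => ?_
      have : 0 < x := hx
      positivity
    · simp only [zero_mul, neg_zero, Real.exp_zero, mul_one]
      refine norm_integral_le_of_norm_le (i0.add i1) ?_
      refine (ae_restrict_iff' measurableSet_Ioi).2 (Eventually.of_forall fun x hx => ?_)
      have hx : 0 < x := hx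
      rw [norm_mul, Complex.norm_real, Real.norm_eq_abs, Complex.norm_cpow_eq_rpow_re_of_pos hx,
        ← mul_add]
      gcongr
      rcases le_total 1 x with h | h
      · refine le_trans ?_ (le_add_of_nonneg_left (by positivity))
        exact Real.rpow_le_rpow_of_exponent_le h (by simpa using hs')
      · refine le_trans ?_ (le_add_of_nonneg_right (by positivity))
        exact Real.rpow_le_rpow_of_exponent_ge hx h (by simpa using hs)

/-- The symbol of `y ↦ K₀(4 √y)` in the Mellin-Barnes representation. -/
noncomputable def macdonaldSymbol (s : ℂ) : ℂ :=
  1 / 16 * (Complex.exp ((Real.log 16 : ℝ) * s) *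
    (Complex.Gamma ((2 : ℝ) * ((1 : ℝ) - s)) * Complex.Gamma ((2 : ℝ) * ((1 : ℝ) - s))))

/-- The Mellin symbol of `y ↦ ∫ f u K₀(4 u^{1/4} √y) du`. -/
noncomputable def mellinSymbol (f : ℝ → ℝ) (s : ℂ) : ℂ :=
  macdonaldSymbol s * mellinT f s

/-- `(2 s - 2) * mellinSymbol f s`, with the singularity at `s = 1` removed when
`mellinT f 1 = 0`. -/
noncomputable def derivSymbol (f : ℝ → ℝ) (s : ℂ) : ℂ :=
  1 / 32 * (Complex.exp ((Real.log 16 : ℝ) * s) *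
    (Complex.Gamma ((2 : ℝ) * ((3 / 2 : ℝ) - s)) * Complex.Gamma ((2 : ℝ) * ((3 / 2 : ℝ) - s)) *
      dslope (mellinT f) (1 : ℝ) s))

/-- The Mellin transform of `φ`, with the singularity at `s = 1` removed. -/
noncomputable def phiSymbol (f : ℝ → ℝ) (s : ℂ) : ℂ :=
  (√Real.pi / (4 * Real.pi) : ℝ) * (Complex.exp ((Real.log 4 : ℝ) * s) *
    (Complex.Gamma ((2 : ℝ) * ((3 / 2 : ℝ) - s)) * (Complex.Gamma s *
      (Complex.Gamma ((1 : ℝ) * ((3 / 2 : ℝ) - s)) * (Complex.cos (Real.pi * s) *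
        dslope (mellinT f) (1 : ℝ) s)))))

lemma stripDecay_macdonaldSymbol : StripDecay macdonaldSymbol a 1 (3 * Real.pi / 2) := by
  have hπ := Real.pi_pos
  have hG : StripDecay (fun s => Complex.Gamma ((2 : ℝ) * ((1 : ℝ) - s))) a 1 _ :=
    .Gamma_mul_sub (θ := 3 * Real.pi / 8) two_pos (by positivity) (by linarith)
  exact (((StripDecay.exp_mul _).mul (hG.mul hG)).const_mul _).mono le_rfl le_rfl (by linarith)

lemma stripDecay_mellinSymbol (hf : LocallyIntegrableOn f (Ioi 0))
    (hO0 : f =O[nhdsWithin 0 (Ioi 0)] fun x => x ^ (-a)) (hOinf : f =O[atTop] fun x => x ^ (-b))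
    (hb : 1 ≤ b) : StripDecay (mellinSymbol f) a 1 (3 * Real.pi / 2) :=
  (stripDecay_macdonaldSymbol.mul ((stripDecay_mellinT hf hO0 hOinf).mono le_rfl hb le_rfl)).mono
    le_rfl le_rfl (add_zero _).ge

lemma stripDecay_derivSymbol (hf : LocallyIntegrableOn f (Ioi 0))
    (hO0 : f =O[nhdsWithin 0 (Ioi 0)] fun x => x ^ (-a)) (hOinf : f =O[atTop] fun x => x ^ (-b))
    (ha : a < 1) (hb : 1 < b) (hb' : b ≤ 3 / 2) (hm1 : mellinT f 1 = 0) :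
    StripDecay (derivSymbol f) a b (3 * Real.pi / 2) := by
  have hπ := Real.pi_pos
  have hG : StripDecay (fun s => Complex.Gamma ((2 : ℝ) * ((3 / 2 : ℝ) - s))) a b _ :=
    (StripDecay.Gamma_mul_sub (θ := 3 * Real.pi / 8) two_pos (by positivity) (by linarith)).mono
      le_rfl hb' le_rfl
  have hm := (stripDecay_mellinT hf hO0 hOinf).dslope_ofReal ha hb (by simpa using hm1)
  exact (((StripDecay.exp_mul _).mul ((hG.mul hG).mul hm)).const_mul _).mono le_rfl le_rfl
    (by linarith)

lemma stripDecay_phiSymbol (hf : LocallyIntegrableOn f (Ioi 0))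
    (hO0 : f =O[nhdsWithin 0 (Ioi 0)] fun x => x ^ (-a)) (hOinf : f =O[atTop] fun x => x ^ (-b))
    (ha : a < 1) (hb : 1 < b) (hb' : b ≤ 3 / 2) (hm1 : mellinT f 1 = 0) :
    StripDecay (phiSymbol f) (max a 0) b (Real.pi / 2) := by
  have hπ := Real.pi_pos
  have hG : StripDecay (fun s => Complex.Gamma ((2 : ℝ) * ((3 / 2 : ℝ) - s))) (max a 0) b _ :=
    (StripDecay.Gamma_mul_sub (θ := 3 * Real.pi / 8) two_pos (by positivity) (by linarith)).mono
      le_rfl hb' le_rfl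
  have hG1 : StripDecay (fun s => Complex.Gamma ((1 : ℝ) * ((3 / 2 : ℝ) - s))) (max a 0) b _ :=
    (StripDecay.Gamma_mul_sub (θ := 3 * Real.pi / 8) one_pos (by positivity) (by linarith)).mono
      le_rfl hb' le_rfl
  have hG2 : StripDecay Complex.Gamma (max a 0) b _ :=
    (StripDecay.Gamma (θ := 3 * Real.pi / 8) (by positivity) (by linarith)).mono
      (le_max_right _ _) le_rfl le_rfl
  have hm := ((stripDecay_mellinT hf hO0 hOinf).dslope_ofReal ha hb (by simpa using hm1)).mono
    (le_max_left a 0) le_rfl le_rfl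
  exact (((StripDecay.exp_mul _).mul (hG.mul (hG2.mul (hG1.mul
    (StripDecay.cos_pi_mul.mul hm))))).const_mul _).mono le_rfl le_rfl (by linarith)

lemma derivSymbol_eq (hm1 : mellinT f 1 = 0) {s : ℂ} (hs : s ≠ 1) :
    derivSymbol f s = (2 * s - 2) * mellinSymbol f s := by
  have hs' : (1 : ℂ) - s ≠ 0 := sub_ne_zero.2 hs.symm
  have hs'' : s - 1 ≠ 0 := sub_ne_zero.2 hs
  have hG : Complex.Gamma ((2 : ℝ) * ((3 / 2 : ℝ) - s)) =
      2 * (1 - s) * Complex.Gamma ((2 : ℝ) * ((1 : ℝ) - s)) := by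
    rw [show (((2 : ℝ) : ℂ) * ((3 / 2 : ℝ) - s)) = 2 * (1 - s) + 1 by push_cast; ring,
      Complex.Gamma_add_one _ (mul_ne_zero two_ne_zero hs')]
    norm_num
  rw [derivSymbol, mellinSymbol, macdonaldSymbol, hG, dslope_of_ne _ (by simpa using hs),
    slope_def_field]
  simp only [Complex.ofReal_one, hm1, sub_zero]
  field_simp
  ring

end Mellin

lemma norm_macdonaldK0_ofReal_le {x : ℝ} (hx : 0 < x) :
    ‖macdonaldK0 x‖ ≤ Real.Gamma (1 / 2) * x ^ (-(1 / 2) : ℝ) * Real.exp (-x) := by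
  have h := norm_macdonaldK0_le (z := x) (ε := 1 / 2) (by simpa using hx.le)
    (by exact_mod_cast hx.ne') (by norm_num) le_rfl
  have hG : 0 < Real.Gamma (1 / 2) := Real.Gamma_pos_of_pos (by norm_num)
  simp only [Complex.norm_real, Real.norm_eq_abs, abs_of_pos hx, Complex.ofReal_re] at h
  refine h.trans ?_
  refine mul_le_mul_of_nonneg_right ?_ (Real.exp_pos _).le
  exact mul_le_mul_of_nonneg_left
      (Real.rpow_le_rpow_of_nonpos hx (by linarith) (by norm_num)) hG.le

lemma norm_macdonaldK0_ofReal_le_inv {x : ℝ} (hx : 0 < x) :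
    ‖macdonaldK0 x‖ ≤ Real.Gamma (1 / 2) * x⁻¹ := by
  refine (norm_macdonaldK0_ofReal_le hx).trans ?_
  have hG : 0 < Real.Gamma (1 / 2) := Real.Gamma_pos_of_pos (by norm_num)
  rw [mul_assoc]
  gcongr
  have h1 : x ^ (-(1 / 2) : ℝ) = x⁻¹ * x ^ (1 / 2 : ℝ) := by
    rw [← Real.rpow_neg_one, ← Real.rpow_add hx]
    norm_num
  have h2 : x ^ (1 / 2 : ℝ) ≤ Real.exp x := by
    rw [← Real.sqrt_eq_rpow, Real.sqrt_le_left (Real.exp_pos x).le]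
    have := Real.add_one_le_exp x
    nlinarith
  rw [h1, mul_assoc]
  refine mul_le_of_le_one_right (by positivity) ?_
  rw [Real.exp_neg]
  exact mul_inv_le_one_of_le₀ h2 (Real.exp_pos _).le

lemma continuousAt_macdonaldK0_ofReal {x : ℝ} (hx : 0 < x) :
    ContinuousAt (fun y : ℝ => macdonaldK0 y) x :=
  ((differentiableAt_macdonaldK0 (z := x) (by simpa using hx.le)
    (by exact_mod_cast hx.ne')).continuousAt).comp (f := fun y : ℝ => (y : ℂ)) (by fun_prop)

lemma mellin_macdonaldK0 {p : ℂ} (hp : 0 < p.re) :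
    mellin (fun x : ℝ => macdonaldK0 x) p = 2 ^ (p - 2) * Complex.Gamma (p / 2) ^ 2 := by
  rw [← integral_macdonaldK0_exp hp, mellin, integral_Ioi_eq_integral_exp]
  refine integral_congr_ae (Eventually.of_forall fun t => ?_)
  simp only [Complex.real_smul, smul_eq_mul, Complex.ofReal_exp]
  rw [Complex.cpow_def_of_ne_zero (Complex.exp_ne_zero _), ← Complex.ofReal_exp,
    ← Complex.ofReal_log (Real.exp_pos t).le, Real.log_exp, Complex.ofReal_exp,
    ← mul_assoc, ← Complex.exp_add]
  ring_nf

lemma mellinConvergent_macdonaldK0 : MellinConvergent (fun x : ℝ => macdonaldK0 x) (1 : ℝ) := by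
  have h := (Real.GammaIntegral_convergent (s := 1 / 2) (by norm_num)).const_mul
    (Real.Gamma (1 / 2))
  have hm : AEStronglyMeasurable (fun x : ℝ => macdonaldK0 x) (volume.restrict (Ioi 0)) :=
    ContinuousOn.aestronglyMeasurable (fun x hx =>
      (continuousAt_macdonaldK0_ofReal hx).continuousWithinAt) measurableSet_Ioi
  simp only [MellinConvergent, Complex.ofReal_one, sub_self, Complex.cpow_zero, one_smul]
  refine h.mono' hm ((ae_restrict_iff' measurableSet_Ioi).2 (Eventually.of_forall fun x hx => ?_))
  refine (norm_macdonaldK0_ofReal_le hx).trans_eq ?_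
  norm_num
  ring

lemma four_mul_mellin_macdonaldK0 {s : ℂ} (hs : s.re < 1) {x : ℝ} (hx : 0 < x) :
    (x : ℂ) ^ (-(4 * (1 - s))) * (4 * mellin (fun x : ℝ => macdonaldK0 x) (4 * (1 - s))) =
      macdonaldSymbol s * Complex.exp (s * (4 * Real.log (x / 4) : ℝ)) *
        Complex.exp (-(4 * Real.log (x / 4) : ℝ)) := by
  rw [mellin_macdonaldK0 (by simpa using hs), macdonaldSymbol,
    Complex.cpow_def_of_ne_zero (by exact_mod_cast hx.ne'), Complex.cpow_def_of_ne_zero two_ne_zero,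
    ← Complex.ofReal_log hx.le, Real.log_div hx.ne' (by norm_num),
    show (16 : ℝ) = 2 ^ 4 by norm_num, show Real.log 4 = 2 * Real.log 2 by
      rw [show (4 : ℝ) = 2 ^ 2 by norm_num, Real.log_pow]; norm_num, Real.log_pow]
  have h2 : Complex.log 2 = (Real.log 2 : ℝ) := by simp
  have h4 : (4 : ℂ) = Complex.exp (2 * (Real.log 2 : ℝ)) := by
    rw [← h2, two_mul, Complex.exp_add, Complex.exp_log two_ne_zero]
    norm_num
  have h16 : (1 / 16 : ℂ) = Complex.exp (-(4 * (Real.log 2 : ℝ))) := by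
    rw [show -(4 * ((Real.log 2 : ℝ) : ℂ)) = -(2 * (Real.log 2 : ℝ)) + -(2 * (Real.log 2 : ℝ)) by
      ring, Complex.exp_add, Complex.exp_neg, ← h4]
    norm_num
  have hG : 4 * (1 - s) / 2 = (2 : ℝ) * ((1 : ℝ) - s) := by push_cast; ring
  rw [hG, h2, h16]
  set G := Complex.Gamma ((2 : ℝ) * ((1 : ℝ) - s))
  calc _ = Complex.exp (Real.log x * -(4 * (1 - s))) * (4 * (Complex.exp ((Real.log 2 : ℝ) *
        (4 * (1 - s) - 2)) * G ^ 2)) := by ring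
    _ = Complex.exp (Real.log x * -(4 * (1 - s))) * (Complex.exp (2 * (Real.log 2 : ℝ)) *
      (Complex.exp ((Real.log 2 : ℝ) * (4 * (1 - s) - 2)) * G ^ 2)) := by rw [← h4]
    _ = Complex.exp (Real.log x * -(4 * (1 - s)) + 2 * (Real.log 2 : ℝ) +
      (Real.log 2 : ℝ) * (4 * (1 - s) - 2)) * G ^ 2 := by
        rw [Complex.exp_add, Complex.exp_add]; ring
    _ = Complex.exp (-(4 * (Real.log 2 : ℝ)) + ((4 : ℕ) * Real.log 2 : ℝ) * s +
      s * (4 * (Real.log x - 2 * Real.log 2) : ℝ) + -(4 * (Real.log x - 2 * Real.log 2) : ℝ)) *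
        G ^ 2 := by
        congr 2
        push_cast
        ring
    _ = _ := by rw [Complex.exp_add, Complex.exp_add, Complex.exp_add]; ring

lemma verticalIntegrable_mellin_macdonaldK0 :
    Complex.VerticalIntegrable (mellin fun x : ℝ => macdonaldK0 x) 1 := by
  have h := (((stripDecay_macdonaldSymbol (a := 0)).integrable (σ := 3 / 4) (by norm_num)
    (by norm_num) (ζ := (4 * Real.log (1 / 4) : ℝ))
    (by simp only [Complex.ofReal_im, abs_zero]; positivity)).mul_const
      (Complex.exp (-(4 * Real.log (1 / 4) : ℝ)) / 4)).comp_mul_left' (R := -(1 / 4)) (by norm_num)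
  refine h.congr (Eventually.of_forall fun r => ?_)
  have h1 := four_mul_mellin_macdonaldK0 (s := (3 / 4 : ℝ) + (-(1 / 4) * r : ℝ) * Complex.I)
    (by norm_num) one_pos
  rw [Complex.ofReal_one, Complex.one_cpow, one_mul, show (4 * (1 - (((3 / 4 : ℝ) : ℂ) +
    (-(1 / 4) * r : ℝ) * Complex.I))) = (1 : ℝ) + r * Complex.I by push_cast; ring] at h1
  simp only
  rw [← mul_div_assoc, ← h1]
  ring

lemma macdonaldK0_eq_verticalIntegral {x : ℝ} (hx : 0 < x) :
    macdonaldK0 x = verticalIntegral macdonaldSymbol (3 / 4 : ℝ) (4 * Real.log (x / 4) : ℝ) *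
      Complex.exp (-(4 * Real.log (x / 4) : ℝ)) := by
  rw [← mellinInv_mellin_eq 1 (fun x : ℝ => macdonaldK0 x) hx mellinConvergent_macdonaldK0
    verticalIntegrable_mellin_macdonaldK0 (continuousAt_macdonaldK0_ofReal hx), mellinInv,
    verticalIntegral, mul_assoc, ← integral_mul_const]
  have h := Measure.integral_comp_mul_left (fun q : ℝ =>
    (x : ℂ) ^ (-(((1 : ℝ) : ℂ) + q * Complex.I)) *
    mellin (fun x : ℝ => macdonaldK0 x) ((1 : ℝ) + q * Complex.I)) (-4)
  have h4 : |((-4)⁻¹ : ℝ)| = 1 / 4 := by rw [abs_of_neg] <;> norm_num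
  rw [h4] at h
  simp only [smul_eq_mul, Complex.real_smul]
  push_cast at h ⊢
  rw [← sub_eq_zero, ← mul_sub, mul_eq_zero]
  right
  rw [sub_eq_zero]
  trans 4 * ∫ (r : ℝ), (x : ℂ) ^ (-(1 + (-4 * r) * Complex.I)) *
    mellin (fun x : ℝ => macdonaldK0 x) (1 + (-4 * r) * Complex.I)
  · rw [h, Complex.real_smul]; push_cast; ring
  rw [← integral_const_mul]
  refine integral_congr_ae (Eventually.of_forall fun r => ?_)
  have h1 := four_mul_mellin_macdonaldK0 (s := (3 / 4 : ℝ) + r * Complex.I) (by norm_num) hx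
  rw [show (4 * (1 - (((3 / 4 : ℝ) : ℂ) + r * Complex.I))) = 1 + (-4 * r) * Complex.I by
    push_cast; ring] at h1
  push_cast at h1
  simp only
  rw [← h1]
  ring

section IndexTransform

variable {f : ℝ → ℝ} {a b : ℝ}

lemma integral_mul_macdonaldK0_eq_verticalIntegral (hf : LocallyIntegrableOn f (Ioi 0))
    (hO0 : f =O[nhdsWithin 0 (Ioi 0)] fun x => x ^ (-a)) (hOinf : f =O[atTop] fun x => x ^ (-b))
    (ha : a < 3 / 4) (hb : 3 / 4 < b) {y : ℝ} (hy : 0 < y) :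
    ∫ u in Ioi (0 : ℝ), macdonaldK0 ((4 * u ^ ((1 : ℝ) / 4) * √y : ℝ) : ℂ) * f u =
      verticalIntegral (mellinSymbol f) (3 / 4 : ℝ) (2 * Real.log y : ℝ) *
        Complex.exp (-(2 * Real.log y : ℝ)) := by
  have hfm : AEStronglyMeasurable f (volume.restrict (Ioi 0)) := hf.aestronglyMeasurable
  have hK : ∀ u ∈ Ioi (0 : ℝ), macdonaldK0 ((4 * u ^ ((1 : ℝ) / 4) * √y : ℝ) : ℂ) * f u =
      1 / (2 * (Real.pi : ℂ)) * (∫ r : ℝ, (macdonaldSymbol ((3 / 4 : ℝ) + r * Complex.I) *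
        Complex.exp (((3 / 4 : ℝ) + r * Complex.I) * (2 * Real.log y : ℝ))) *
          (f u * (u : ℂ) ^ (((3 / 4 : ℝ) + r * Complex.I : ℂ) - 1))) *
        Complex.exp (-(2 * Real.log y : ℝ)) := by
    intro u hu
    have hu : 0 < u := hu
    have hlog : 4 * Real.log (4 * u ^ ((1 : ℝ) / 4) * √y / 4) = Real.log u + 2 * Real.log y := by
      rw [show 4 * u ^ ((1 : ℝ) / 4) * √y / 4 = u ^ ((1 : ℝ) / 4) * √y by ring,
        Real.log_mul (by positivity) (by positivity), Real.log_rpow hu, Real.log_sqrt hy.le]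
      ring
    rw [macdonaldK0_eq_verticalIntegral (by positivity), hlog, verticalIntegral, mul_assoc,
      mul_assoc, mul_assoc, ← integral_mul_const, ← integral_mul_const]
    congr 1
    refine integral_congr_ae (Eventually.of_forall fun r => ?_)
    simp only
    rw [Complex.cpow_def_of_ne_zero (by exact_mod_cast hu.ne'), ← Complex.ofReal_log hu.le]
    push_cast
    have e1 : Complex.exp ((3 / 4 + r * Complex.I) * (Real.log u + 2 * Real.log y)) *
        Complex.exp (-(Real.log u + 2 * Real.log y)) =
        Complex.exp ((3 / 4 + r * Complex.I) * (2 * Real.log y)) *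
          Complex.exp (Real.log u * (3 / 4 + r * Complex.I - 1)) *
            Complex.exp (-(2 * Real.log y)) := by
      rw [← Complex.exp_add, ← Complex.exp_add, ← Complex.exp_add]
      ring_nf
    linear_combination macdonaldSymbol (3 / 4 + r * Complex.I) * f u * e1
  rw [setIntegral_congr_fun measurableSet_Ioi hK, integral_mul_const, integral_const_mul,
    verticalIntegral]
  congr 2
  rw [integral_integral_swap]
  · refine integral_congr_ae (Eventually.of_forall fun r => ?_)
    simp only
    rw [integral_const_mul, mellinSymbol, mellinT]
    ring
  · have i1 := integrableOn_abs_mul_rpow hf hO0 hOinf ha hb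
    have i2 := ((stripDecay_macdonaldSymbol (a := 0)).integrable (σ := 3 / 4) (by norm_num)
      (by norm_num) (ζ := (2 * Real.log y : ℝ))
      (by simp only [Complex.ofReal_im, abs_zero]; positivity))
    have i3 := i1.mul_prod i2.norm
    refine i3.mono' ?_ ?_
    · refine (i2.aestronglyMeasurable.comp_snd).mul
        ((Complex.continuous_ofReal.comp_aestronglyMeasurable hfm.comp_fst).mul ?_)
      exact (Measurable.pow (by fun_prop) (by fun_prop)).aestronglyMeasurable
    · have : ∀ᵐ p : ℝ × ℝ ∂(volume.restrict (Ioi 0)).prod volume, 0 < p.1 := by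
        refine (Measure.quasiMeasurePreserving_fst (μ := volume.restrict (Ioi (0 : ℝ)))
          (ν := (volume : Measure ℝ))).ae (p := fun x => 0 < x) ?_
        exact (ae_restrict_iff' measurableSet_Ioi).2 (Eventually.of_forall fun x hx => hx)
      filter_upwards [this] with p hp
      simp only [Function.uncurry]
      rw [norm_mul, mul_comm, norm_mul (f p.1 : ℂ), Complex.norm_real, Real.norm_eq_abs,
        Complex.norm_cpow_eq_rpow_re_of_pos hp]
      refine le_of_eq ?_
      simp

end IndexTransform

lemma cosh_add_mul_I (t y : ℝ) : Complex.cosh (t + y * Complex.I) =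
    (Real.cosh t * Real.cos y : ℝ) + (Real.sinh t * Real.sin y : ℝ) * Complex.I := by
  rw [Complex.cosh_add, Complex.cosh_mul_I, Complex.sinh_mul_I]
  push_cast
  ring

lemma sinh_add_mul_I (t y : ℝ) : Complex.sinh (t + y * Complex.I) =
    (Real.sinh t * Real.cos y : ℝ) + (Real.cosh t * Real.sin y : ℝ) * Complex.I := by
  rw [Complex.sinh_add, Complex.cosh_mul_I, Complex.sinh_mul_I]
  push_cast
  ring

lemma abs_sinh_le_norm_cosh_add_mul_I (t y : ℝ) :
    |Real.sinh t| ≤ ‖Complex.cosh (t + y * Complex.I)‖ := by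
  rw [cosh_add_mul_I, Complex.norm_add_mul_I]
  refine Real.le_sqrt_of_sq_le ?_
  rw [sq_abs]
  nlinarith [Real.cosh_sq t, Real.sin_sq_add_cos_sq y, sq_nonneg (Real.cos y)]

lemma norm_sinh_add_mul_I_le (t y : ℝ) :
    ‖Complex.sinh (t + y * Complex.I)‖ ≤ Real.cosh t := by
  rw [sinh_add_mul_I, Complex.norm_add_mul_I]
  refine (Real.sqrt_le_left (Real.cosh_pos t).le).2 ?_
  nlinarith [Real.cosh_sq t, Real.sin_sq_add_cos_sq y, sq_nonneg (Real.cos y)]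

lemma cosh_add_mul_I_re_nonneg (t : ℝ) {y : ℝ} (hy : |y| ≤ Real.pi / 2) :
    0 ≤ (Complex.cosh (t + y * Complex.I)).re := by
  rw [cosh_add_mul_I]
  simp only [Complex.add_re, Complex.ofReal_re, Complex.mul_re, Complex.I_re, Complex.ofReal_im,
    Complex.I_im, mul_zero, zero_mul, sub_zero, add_zero]
  exact mul_nonneg (Real.cosh_pos t).le (Real.cos_nonneg_of_neg_pi_div_two_le_of_le
    (by linarith [(abs_le.1 hy).1]) (abs_le.1 hy).2)

lemma cosh_add_mul_I_ne_zero {t y : ℝ} (h : t ≠ 0 ∨ |y| < Real.pi / 2) :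
    Complex.cosh (t + y * Complex.I) ≠ 0 := by
  rcases h with h | h
  · exact norm_pos_iff.1 ((abs_pos.2 (Real.sinh_ne_zero.2 h)).trans_le
      (abs_sinh_le_norm_cosh_add_mul_I t y))
  · rw [cosh_add_mul_I]
    intro h0
    have h1 := congrArg Complex.re h0
    simp only [Complex.add_re, Complex.ofReal_re, Complex.mul_re, Complex.I_re, Complex.ofReal_im,
      Complex.I_im, mul_zero, zero_mul, sub_zero, add_zero, Complex.zero_re] at h1
    exact (mul_pos (Real.cosh_pos t) (Real.cos_pos_of_mem_Ioo (abs_lt.1 h |>.imp_left fun h => by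
      linarith))).ne' h1

lemma cosh_add_pi_div_two_mul_I (t : ℝ) :
    Complex.cosh (t + (Real.pi / 2 : ℝ) * Complex.I) = Real.sinh t * Complex.I := by
  rw [cosh_add_mul_I]; simp

lemma cosh_sub_pi_div_two_mul_I (t : ℝ) :
    Complex.cosh (t - (Real.pi / 2 : ℝ) * Complex.I) = -(Real.sinh t * Complex.I) := by
  rw [sub_eq_add_neg, ← neg_mul, ← Complex.ofReal_neg, cosh_add_mul_I]; simp

/-- Shifting the contour to the boundary of the strip `|Im z| < π / 2`, on which `cosh` becomes
`± i sinh`. -/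
lemma integral_comp_cosh_boundary {g k : ℂ → ℂ} {B : ℝ → ℝ}
    (hg : ∀ z : ℂ, 0 ≤ z.re → z ≠ 0 → DifferentiableAt ℂ g z) (hk : Differentiable ℂ k)
    (hB : Integrable B) (hbd : ∀ t : ℝ, t ≠ 0 → ∀ y : ℝ, |y| < Real.pi / 2 →
      ‖g (Complex.cosh (t + y * Complex.I)) * k (t + y * Complex.I)‖ ≤ B t) (τ : ℝ) :
    (∫ t : ℝ, g (Real.sinh t * Complex.I) * k (t + (Real.pi / 2 : ℝ) * Complex.I) *
      Complex.exp (2 * Complex.I * τ * t) = Complex.exp (Real.pi * τ) *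
        ∫ t : ℝ, g (Complex.cosh t) * k t * Complex.exp (2 * Complex.I * τ * t)) ∧
    ∫ t : ℝ, g (-(Real.sinh t * Complex.I)) * k (t - (Real.pi / 2 : ℝ) * Complex.I) *
      Complex.exp (2 * Complex.I * τ * t) = Complex.exp (-(Real.pi * τ)) *
        ∫ t : ℝ, g (Complex.cosh t) * k t * Complex.exp (2 * Complex.I * τ * t) := by
  have hπ := Real.pi_pos
  have hd : ∀ t y : ℝ, |y| ≤ Real.pi / 2 → (t ≠ 0 ∨ |y| < Real.pi / 2) →
      DifferentiableAt ℂ (fun z => g (Complex.cosh z) * k z * Complex.exp (2 * Complex.I * τ * z))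
        (t + y * Complex.I) := by
    intro t y hy h
    refine (DifferentiableAt.mul ?_ hk.differentiableAt).mul (by fun_prop)
    exact (hg _ (cosh_add_mul_I_re_nonneg t hy) (cosh_add_mul_I_ne_zero h)).comp _
      Complex.differentiable_cosh.differentiableAt
  have hbs := fun h1 h2 h3 h4 => integral_boundary_strip (β := Real.pi / 2) (B := fun t => B t *
    Real.exp (Real.pi * |τ|)) (F := fun z => g (Complex.cosh z) * k z *
      Complex.exp (2 * Complex.I * τ * z)) (by positivity)
    h1 (hB.mul_const _) h2 h3 h4
  obtain ⟨h1, h2⟩ := by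
    refine hbs ?_ ?_ ?_ ?_
    · intro z hz
      have := hd z.re z.im hz.le (Or.inr hz)
      rwa [Complex.re_add_im] at this
    · intro t ht y hy
      rw [norm_mul, Complex.norm_exp]
      refine mul_le_mul (hbd t ht y hy) (Real.exp_le_exp.2 ?_) (Real.exp_pos _).le
        ((norm_nonneg _).trans (hbd t ht y hy))
      have : (2 * Complex.I * τ * (t + y * Complex.I)).re = -(2 * τ * y) := by
        simp [Complex.mul_re, Complex.mul_im]
      rw [this]
      have h3 : -(τ * y) ≤ |τ| * |y| := by rw [← abs_mul]; exact neg_le_abs _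
      nlinarith [abs_nonneg τ, hy.le]
    · exact fun t ht => (hd t (Real.pi / 2) (by rw [abs_of_pos (by positivity)])
        (Or.inl ht)).continuousAt
    · intro t ht
      have := (hd t (-(Real.pi / 2)) (by rw [abs_neg, abs_of_pos (by positivity)])
        (Or.inl ht)).continuousAt
      simpa [sub_eq_add_neg] using this
  rw [← h1]
  constructor
  · rw [← integral_const_mul]
    refine integral_congr_ae (Eventually.of_forall fun t => ?_)
    simp only
    rw [cosh_add_pi_div_two_mul_I, mul_left_comm, ← Complex.exp_add]
    congr 2
    push_cast
    linear_combination (-(τ : ℂ) * Real.pi) * Complex.I_mul_I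
  · rw [h1, ← h2, ← integral_const_mul]
    refine integral_congr_ae (Eventually.of_forall fun t => ?_)
    simp only
    rw [cosh_sub_pi_div_two_mul_I, mul_left_comm, ← Complex.exp_add]
    congr 2
    push_cast
    linear_combination ((τ : ℂ) * Real.pi) * Complex.I_mul_I

lemma integral_exp_mul_deriv_eq {c d : ℝ → ℂ} (hcd : ∀ t, HasDerivAt c (d t) t)
    (hc : Integrable c) (hd : Integrable d) (τ : ℝ) :
    2 * Complex.I * τ * ∫ t : ℝ, c t * Complex.exp (2 * Complex.I * τ * t) =
      -∫ t : ℝ, d t * Complex.exp (2 * Complex.I * τ * t) := by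
  have hn : ∀ t : ℝ, ‖Complex.exp (2 * Complex.I * τ * t)‖ = 1 := by
    intro t
    rw [Complex.norm_exp]
    simp [Complex.mul_re, Complex.mul_im]
  have hmul : ∀ {g : ℝ → ℂ}, Integrable g →
      Integrable fun t : ℝ => g t * Complex.exp (2 * Complex.I * τ * t) := by
    intro g hg
    refine hg.mul_bdd (c := 1) (Continuous.aestronglyMeasurable (by fun_prop)) ?_
    exact Eventually.of_forall fun t => (hn t).le
  have h := integral_mul_deriv_eq_deriv_mul_of_integrable (u := c) (u' := d)
    (v := fun t => Complex.exp (2 * Complex.I * τ * t))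
    (v' := fun t => 2 * Complex.I * τ * Complex.exp (2 * Complex.I * τ * t))
    (fun t _ => hcd t) ?_ ?_ (hmul hd) (hmul hc)
  · rw [← h, ← integral_const_mul]
    refine integral_congr_ae (Eventually.of_forall fun t => ?_)
    simp only
    ring
  · intro t _
    have := ((hasDerivAt_id t).ofReal_comp.const_mul (2 * Complex.I * τ)).cexp
    exact this.congr_deriv (by simp only [id, Complex.ofReal_one, mul_one]; ring)
  · refine ((hmul hc).const_mul (2 * Complex.I * τ)).congr (Eventually.of_forall fun t => ?_)
    simp only [Pi.mul_apply]
    ring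

/-- The Mellin-Barnes integral of `V s * z ^ (2 s - 3)` along the line `Re s = σ`. -/
noncomputable def stripTransform (V : ℂ → ℂ) (σ : ℝ) (z : ℂ) : ℂ :=
  verticalIntegral V σ (2 * Complex.log z) * Complex.exp (-(3 * Complex.log z))

lemma Complex.abs_arg_le_pi_div_two {z : ℂ} (hz : 0 ≤ z.re) : |z.arg| ≤ Real.pi / 2 :=
  Complex.abs_arg_le_pi_div_two_iff.2 hz

lemma Complex.mem_slitPlane_of_re_nonneg {z : ℂ} (hz : 0 ≤ z.re) (hz0 : z ≠ 0) :
    z ∈ Complex.slitPlane := by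
  rcases hz.lt_or_eq with h | h
  · exact Or.inl h
  · exact Or.inr fun h' => hz0 (Complex.ext h.symm h')

lemma Complex.abs_im_two_mul_log_le {z : ℂ} (hz : 0 ≤ z.re) :
    |(2 * Complex.log z).im| ≤ Real.pi := by
  have := Complex.abs_arg_le_pi_div_two hz
  simp only [Complex.mul_im, Complex.re_ofNat, Complex.log_im, Complex.im_ofNat, zero_mul,
    add_zero, abs_mul, abs_two]
  linarith

namespace StripDecay

variable {V : ℂ → ℂ} {α β κ σ σ' : ℝ}

lemma differentiableAt_stripTransform (hV : StripDecay V α β κ) (h1 : α < σ) (h2 : σ < β)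
    (hκ : Real.pi < κ) {z : ℂ} (hz : 0 ≤ z.re) (hz0 : z ≠ 0) :
    DifferentiableAt ℂ (stripTransform V σ) z := by
  have hlog := Complex.differentiableAt_log (Complex.mem_slitPlane_of_re_nonneg hz hz0)
  refine DifferentiableAt.mul ?_ (hlog.const_mul 3).neg.cexp
  exact (hV.hasDerivAt_verticalIntegral h1 h2
    ((Complex.abs_im_two_mul_log_le hz).trans_lt hκ)).differentiableAt.comp z
    (f := fun z => 2 * Complex.log z) (hlog.const_mul 2)

lemma norm_stripTransform_le (hV : StripDecay V α β κ) (h1 : α < σ) (h2 : σ < β)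
    (h1' : α < σ') (h2' : σ' < β) (hκ : Real.pi < κ) :
    ∃ C : ℝ, 0 ≤ C ∧ ∀ z : ℂ, 0 ≤ z.re → z ≠ 0 →
      ‖stripTransform V σ z‖ ≤ C * ‖z‖ ^ (2 * σ' - 3) := by
  obtain ⟨C, hC0, hC⟩ := hV.norm_verticalIntegral_le h1' h2' hκ
  refine ⟨C, hC0, fun z hz hz0 => ?_⟩
  have him := Complex.abs_im_two_mul_log_le hz
  rw [stripTransform, hV.verticalIntegral_eq h1 h2 h1' h2' (him.trans_lt hκ), norm_mul,
    Complex.norm_exp]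
  refine (mul_le_mul_of_nonneg_right (hC _ him) (Real.exp_pos _).le).trans_eq ?_
  rw [Real.rpow_def_of_pos (norm_pos_iff.2 hz0), mul_assoc, ← Real.exp_add]
  congr 2
  simp only [Complex.mul_re, Complex.re_ofNat, Complex.log_re, Complex.im_ofNat, zero_mul,
    sub_zero, Complex.neg_re]
  ring

lemma norm_stripTransform_mul_cosh_le (hV : StripDecay V α β κ) (h1 : α < σ) (h2 : σ < β)
    (hκ : Real.pi < κ) {γ : ℝ} (hγ0 : 0 ≤ γ) (h3 : α < 1 - γ / 2)
    (h4 : (3 - γ) / 2 < β) :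
    ∃ C : ℝ, 0 ≤ C ∧ ∀ t : ℝ, t ≠ 0 → ∀ z : ℂ, 0 ≤ z.re → |Real.sinh t| ≤ ‖z‖ →
      ‖stripTransform V σ z‖ * Real.cosh t ≤ C * (|t| ^ (-γ) * Real.exp (-(γ / 2 * |t|))) := by
  obtain ⟨C, hC0, hC⟩ := hV.norm_stripTransform_le h1 h2 (σ' := 1 - γ / 2) h3 (by linarith) hκ
  obtain ⟨D, hD0, hD⟩ := hV.norm_stripTransform_le h1 h2 (σ' := (3 - γ) / 2) (by linarith) h4 hκ
  refine ⟨(C + D) * 2 ^ γ, by positivity, fun t ht z hz htz => ?_⟩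
  have hs : 0 < |Real.sinh t| := abs_pos.2 (Real.sinh_ne_zero.2 ht)
  have hz0 : z ≠ 0 := norm_pos_iff.1 (hs.trans_le htz)
  have e1 := hC z hz hz0
  have e2 := hD z hz hz0
  rw [show 2 * (1 - γ / 2) - 3 = -1 + -γ by ring] at e1
  rw [show 2 * ((3 - γ) / 2) - 3 = -γ by ring] at e2
  have e3 : ‖z‖ ^ (-1 + -γ) ≤ |Real.sinh t| ^ (-1 + -γ) :=
    Real.rpow_le_rpow_of_nonpos hs htz (by linarith)
  have e4 : ‖z‖ ^ (-γ) ≤ |Real.sinh t| ^ (-γ) :=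
    Real.rpow_le_rpow_of_nonpos hs htz (by linarith)
  have e5 : Real.cosh t ≤ 1 + |Real.sinh t| := by
    have := Real.cosh_sq t
    nlinarith [Real.one_le_cosh t, sq_abs (Real.sinh t)]
  have e6 : |Real.sinh t| ^ (-1 + -γ) * |Real.sinh t| = |Real.sinh t| ^ (-γ) := by
    rw [Real.rpow_add hs, Real.rpow_neg_one]
    field_simp
  calc _ ≤ ‖stripTransform V σ z‖ * (1 + |Real.sinh t|) := by gcongr
    _ = ‖stripTransform V σ z‖ + ‖stripTransform V σ z‖ * |Real.sinh t| := by ring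
    _ ≤ D * |Real.sinh t| ^ (-γ) + C * |Real.sinh t| ^ (-1 + -γ) * |Real.sinh t| := by
        gcongr
        · exact e2.trans (by gcongr)
        · exact e1.trans (by gcongr)
    _ = (C + D) * |Real.sinh t| ^ (-γ) := by rw [mul_assoc, e6]; ring
    _ ≤ (C + D) * (2 ^ γ * (|t| ^ (-γ) * Real.exp (-(γ / 2 * |t|)))) := by
        gcongr
        exact abs_sinh_rpow_neg_le hγ0 ht
    _ = _ := by ring

end StripDecay

section IndexTransform

variable {f : ℝ → ℝ} {a b : ℝ}

lemma indexF_eq_integral (hf : LocallyIntegrableOn f (Ioi 0))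
    (hO0 : f =O[nhdsWithin 0 (Ioi 0)] fun x => x ^ (-a)) (hOinf : f =O[atTop] fun x => x ^ (-b))
    (ha : a < 3 / 4) (hb : 3 / 4 < b) (τ : ℝ) :
    (indexF f τ : ℂ) = 1 / 2 * ∫ t : ℝ,
      verticalIntegral (mellinSymbol f) (3 / 4 : ℝ) (2 * Real.log (Real.cosh t) : ℝ) *
        Complex.exp (-(2 * Real.log (Real.cosh t) : ℝ)) * Complex.exp (2 * Complex.I * τ * t) := by
  have hn : ∀ t : ℝ, ‖Complex.exp (2 * Complex.I * τ * t)‖ = 1 := by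
    intro t
    rw [Complex.norm_exp]
    simp [Complex.mul_re, Complex.mul_im]
  rw [indexF, ← integral_complex_ofReal]
  have hK : ∀ u ∈ Ioi (0 : ℝ), ((kernelK u τ * f u : ℝ) : ℂ) = 1 / 2 * ∫ t : ℝ,
      macdonaldK0 ((4 * u ^ ((1 : ℝ) / 4) * √(Real.cosh t) : ℝ) : ℂ) * f u *
        Complex.exp (2 * Complex.I * τ * t) := by
    intro u hu
    rw [Complex.ofReal_mul, kernelK_eq_integral hu, mul_assoc, ← integral_mul_const]
    congr 1
    refine integral_congr_ae (Eventually.of_forall fun t => ?_)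
    simp only
    ring
  rw [setIntegral_congr_fun measurableSet_Ioi hK, integral_const_mul, integral_integral_swap]
  · congr 1
    refine integral_congr_ae (Eventually.of_forall fun t => ?_)
    simp only
    rw [integral_mul_const, integral_mul_macdonaldK0_eq_verticalIntegral hf hO0 hOinf ha hb
      (Real.cosh_pos t)]
  · have i1 := integrableOn_abs_mul_rpow hf hO0 hOinf ha hb
    have i2 : Integrable fun t : ℝ => |t| ^ (-(1 / 2) : ℝ) * Real.exp (-(1 / 2 / 2 * |t|)) :=
      integrable_abs_rpow_mul_exp_neg (by norm_num) (by norm_num)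
    have i3 := (i1.mul_prod i2).const_mul (Real.Gamma (1 / 2) / 4 * 2 ^ (1 / 2 : ℝ))
    have hfm : AEStronglyMeasurable f (volume.restrict (Ioi 0)) := hf.aestronglyMeasurable
    have hprod : (volume.restrict (Ioi (0 : ℝ))).prod (volume : Measure ℝ) =
        (volume : Measure (ℝ × ℝ)).restrict (Ioi 0 ×ˢ univ) := by
      rw [Measure.volume_eq_prod, ← Measure.prod_restrict, Measure.restrict_univ]
    refine i3.mono' ?_ ?_
    · refine (AEStronglyMeasurable.mul ?_
        (Complex.continuous_ofReal.comp_aestronglyMeasurable hfm.comp_fst)).mul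
          (Continuous.aestronglyMeasurable (by fun_prop))
      rw [hprod]
      refine ContinuousOn.aestronglyMeasurable (fun p hp => ?_)
        (measurableSet_Ioi.prod MeasurableSet.univ)
      have hp : 0 < p.1 := hp.1
      have hc : ContinuousAt (fun p : ℝ × ℝ => 4 * p.1 ^ ((1 : ℝ) / 4) * √(Real.cosh p.2)) p := by
        have : ContinuousAt (fun p : ℝ × ℝ => p.1 ^ ((1 : ℝ) / 4)) p :=
          continuousAt_fst.rpow_const (Or.inl hp.ne')
        exact (continuousAt_const.mul this).mul
          (Continuous.continuousAt (by have := Real.continuous_cosh; fun_prop))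
      exact (ContinuousAt.comp (f := fun p : ℝ × ℝ => 4 * p.1 ^ ((1 : ℝ) / 4) *
        √(Real.cosh p.2)) (continuousAt_macdonaldK0_ofReal
          (by have := Real.cosh_pos p.2; positivity)) hc).continuousWithinAt
    · have h0 : ∀ᵐ p : ℝ × ℝ ∂(volume.restrict (Ioi 0)).prod volume, 0 < p.1 :=
        (Measure.quasiMeasurePreserving_fst (μ := volume.restrict (Ioi (0 : ℝ)))
          (ν := (volume : Measure ℝ))).ae (p := fun x => 0 < x)
            ((ae_restrict_iff' measurableSet_Ioi).2 (Eventually.of_forall fun x hx => hx))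
      have h1 : ∀ᵐ p : ℝ × ℝ ∂(volume.restrict (Ioi 0)).prod volume, p.2 ≠ 0 :=
        (Measure.quasiMeasurePreserving_snd (μ := volume.restrict (Ioi (0 : ℝ)))
          (ν := (volume : Measure ℝ))).ae (p := fun x => x ≠ 0)
            (measure_eq_zero_iff_ae_notMem.1 (measure_singleton (0 : ℝ)))
      filter_upwards [h0, h1] with ⟨u, t⟩ hu ht
      simp only at hu ht
      simp only [Function.uncurry]
      have hG : 0 < Real.Gamma (1 / 2) := Real.Gamma_pos_of_pos (by norm_num)
      have hc := Real.cosh_pos t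
      have hsq : (√(Real.cosh t))⁻¹ ≤ |Real.sinh t| ^ (-(1 / 2) : ℝ) := by
        rw [Real.sqrt_eq_rpow, ← Real.rpow_neg hc.le]
        refine Real.rpow_le_rpow_of_nonpos (abs_pos.2 (Real.sinh_ne_zero.2 ht)) ?_ (by norm_num)
        exact abs_le_of_sq_le_sq (by nlinarith [Real.cosh_sq t]) hc.le
      have hu4 : (u ^ ((1 : ℝ) / 4))⁻¹ = u ^ ((3 / 4 : ℝ) - 1) := by
        rw [← Real.rpow_neg hu.le]
        norm_num
      rw [norm_mul, hn, mul_one, norm_mul, Complex.norm_real, Real.norm_eq_abs]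
      calc _ ≤ Real.Gamma (1 / 2) * (4 * u ^ ((1 : ℝ) / 4) * √(Real.cosh t))⁻¹ * |f u| := by
            gcongr
            exact norm_macdonaldK0_ofReal_le_inv (by positivity)
        _ = Real.Gamma (1 / 2) / 4 * (|f u| * u ^ ((3 / 4 : ℝ) - 1) * (√(Real.cosh t))⁻¹) := by
            rw [mul_inv, mul_inv, hu4]
            ring
        _ ≤ Real.Gamma (1 / 2) / 4 * (|f u| * u ^ ((3 / 4 : ℝ) - 1) *
            (2 ^ (1 / 2 : ℝ) * (|t| ^ (-(1 / 2) : ℝ) * Real.exp (-(1 / 2 / 2 * |t|))))) := by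
            gcongr
            exact hsq.trans (abs_sinh_rpow_neg_le (by norm_num) ht)
        _ = _ := by ring

end IndexTransform

section IndexTransform

variable {f : ℝ → ℝ} {a b : ℝ}

lemma verticalIntegral_derivSymbol (hf : LocallyIntegrableOn f (Ioi 0))
    (hO0 : f =O[nhdsWithin 0 (Ioi 0)] fun x => x ^ (-a)) (hOinf : f =O[atTop] fun x => x ^ (-b))
    (hb : 1 < b) (hb' : b ≤ 3 / 2) (hm1 : mellinT f 1 = 0) {σ : ℝ} (hσ : a < σ) (hσ' : σ < 1)
    {ζ : ℂ} (hζ : |ζ.im| < 3 * Real.pi / 2) :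
    verticalIntegral (derivSymbol f) σ ζ =
      2 * verticalIntegral (fun s => s * mellinSymbol f s) σ ζ -
        2 * verticalIntegral (mellinSymbol f) σ ζ := by
  have hW := (stripDecay_mellinSymbol hf hO0 hOinf hb.le).integrable hσ hσ' hζ
  have hV := (stripDecay_derivSymbol hf hO0 hOinf (hσ.trans hσ') hb hb' hm1).integrable hσ
    (hσ'.trans hb) hζ
  have hs : ∀ r : ℝ, (σ + r * Complex.I) * mellinSymbol f (σ + r * Complex.I) *
      Complex.exp ((σ + r * Complex.I) * ζ) = 1 / 2 * (derivSymbol f (σ + r * Complex.I) *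
      Complex.exp ((σ + r * Complex.I) * ζ)) + mellinSymbol f (σ + r * Complex.I) *
      Complex.exp ((σ + r * Complex.I) * ζ) := by
    intro r
    have hne : (σ + r * Complex.I : ℂ) ≠ 1 := by
      intro h
      have := congrArg Complex.re h
      simp at this
      exact hσ'.ne this
    rw [derivSymbol_eq hm1 hne]
    ring
  simp only [verticalIntegral]
  rw [integral_congr_ae (Eventually.of_forall hs), integral_add (hV.const_mul _) hW,
    integral_const_mul]
  ring

lemma log_complex_cosh (t : ℝ) :
    Complex.log (Complex.cosh t) = (Real.log (Real.cosh t) : ℝ) := by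
  rw [← Complex.ofReal_cosh, Complex.ofReal_log (Real.cosh_pos t).le]

lemma hasDerivAt_verticalIntegral_cosh (hf : LocallyIntegrableOn f (Ioi 0))
    (hO0 : f =O[nhdsWithin 0 (Ioi 0)] fun x => x ^ (-a)) (hOinf : f =O[atTop] fun x => x ^ (-b))
    (ha : a < 3 / 4) (hb : 1 < b) (hb' : b ≤ 3 / 2) (hm1 : mellinT f 1 = 0) (t : ℝ) :
    HasDerivAt (fun t : ℝ => verticalIntegral (mellinSymbol f) (3 / 4 : ℝ)
        (2 * Real.log (Real.cosh t) : ℝ) * Complex.exp (-(2 * Real.log (Real.cosh t) : ℝ)))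
      (stripTransform (derivSymbol f) (3 / 4 : ℝ) (Complex.cosh t) * Complex.sinh t) t := by
  have hL : HasDerivAt (fun t : ℝ => ((2 * Real.log (Real.cosh t) : ℝ) : ℂ))
      ((2 * (Real.sinh t / Real.cosh t) : ℝ) : ℂ) t :=
    (((Real.hasDerivAt_cosh t).log (Real.cosh_pos t).ne').const_mul 2).ofReal_comp
  have him : |((2 * Real.log (Real.cosh t) : ℝ) : ℂ).im| < 3 * Real.pi / 2 := by
    simp only [Complex.ofReal_im, abs_zero]
    positivity
  have h1 := ((stripDecay_mellinSymbol hf hO0 hOinf hb.le).hasDerivAt_verticalIntegral ha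
    (by norm_num) him).scomp t hL
  refine (h1.mul hL.neg.cexp).congr_deriv ?_
  have hV := verticalIntegral_derivSymbol hf hO0 hOinf hb hb' hm1 ha (by norm_num) him
  have hc : Complex.cosh t ≠ 0 := by
    rw [← Complex.ofReal_cosh]
    exact_mod_cast (Real.cosh_pos t).ne'
  have he : Complex.exp (-(3 * (Real.log (Real.cosh t) : ℝ))) * Complex.cosh t =
      Complex.exp (-(2 * (Real.log (Real.cosh t) : ℝ))) := by
    rw [← Complex.exp_log hc, log_complex_cosh, ← Complex.exp_add]
    ring_nf
  rw [stripTransform, log_complex_cosh]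
  simp only [Function.comp_apply, Pi.neg_apply, smul_eq_mul]
  push_cast at hV ⊢
  rw [hV, ← he]
  field_simp
  ring

lemma integrable_verticalIntegral_cosh (hf : LocallyIntegrableOn f (Ioi 0))
    (hO0 : f =O[nhdsWithin 0 (Ioi 0)] fun x => x ^ (-a)) (hOinf : f =O[atTop] fun x => x ^ (-b))
    (ha : a < 3 / 4) (hb : 1 < b) (hb' : b ≤ 3 / 2) (hm1 : mellinT f 1 = 0) :
    Integrable fun t : ℝ => verticalIntegral (mellinSymbol f) (3 / 4 : ℝ)
        (2 * Real.log (Real.cosh t) : ℝ) *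
          Complex.exp (-(2 * Real.log (Real.cosh t) : ℝ)) := by
  have hcont : Continuous fun t : ℝ => verticalIntegral (mellinSymbol f) (3 / 4 : ℝ)
      (2 * Real.log (Real.cosh t) : ℝ) * Complex.exp (-(2 * Real.log (Real.cosh t) : ℝ)) :=
    continuous_iff_continuousAt.2 fun t =>
      (hasDerivAt_verticalIntegral_cosh hf hO0 hOinf ha hb hb' hm1 t).continuousAt
  obtain ⟨C, hC0, hC⟩ := (stripDecay_mellinSymbol hf hO0 hOinf hb.le).norm_verticalIntegral_le ha
    (by norm_num) (κ' := 0) (by positivity)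
  refine ((integrable_exp_neg_mul_abs (δ := 1 / 2) (by norm_num)).const_mul
    (C * 2 ^ (1 / 2 : ℝ))).mono' hcont.aestronglyMeasurable (Eventually.of_forall fun t => ?_)
  have hc := Real.cosh_pos t
  rw [norm_mul, Complex.norm_exp, ← Complex.ofReal_neg, Complex.ofReal_re]
  refine (mul_le_mul_of_nonneg_right (hC _ (by simp)) (Real.exp_pos _).le).trans ?_
  rw [mul_assoc, ← Real.exp_add, mul_assoc, Complex.ofReal_re]
  gcongr
  rw [Real.rpow_def_of_pos two_pos, ← Real.exp_add]
  refine Real.exp_le_exp.2 ?_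
  have h1 : |t| - Real.log 2 ≤ Real.log (Real.cosh t) := by
    rw [Real.le_log_iff_exp_le hc, Real.exp_sub, Real.exp_log two_pos, ← Real.cosh_abs,
      Real.cosh_eq]
    have := Real.exp_pos (-|t|)
    linarith
  linarith

end IndexTransform

open scoped FourierTransform ComplexConjugate in
lemma integral_mul_integral_mul_cexp {D N : ℝ → ℂ} (hD : Integrable D) (hD' : MemLp D 2)
    (hN : Integrable N) (hN' : MemLp N 2) (hodd : ∀ t, N (-t) = -N t) :
    ∫ τ : ℝ, (∫ t : ℝ, D t * Complex.exp (2 * Complex.I * τ * t)) *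
      (∫ t : ℝ, N t * Complex.exp (2 * Complex.I * τ * t)) =
      -(Real.pi * ∫ t : ℝ, D t * N t) := by
  have hDc : Integrable fun t => conj (D t) :=
    hD.mono (Complex.continuous_conj.comp_aestronglyMeasurable hD.1)
      (Eventually.of_forall fun t => by simp)
  have hDc' : MemLp (fun t => conj (D t)) 2 :=
    hD'.of_le (Complex.continuous_conj.comp_aestronglyMeasurable hD.1)
      (Eventually.of_forall fun t => by simp)
  have h := integral_conj_fourier_mul_fourier hDc hDc' hN hN'
  have h1 : ∀ ξ : ℝ, conj (𝓕 (fun t => conj (D t)) ξ) =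
      ∫ t : ℝ, D t * Complex.exp (2 * Complex.I * (Real.pi * ξ : ℝ) * t) := by
    intro ξ
    rw [Real.fourier_real_eq_integral_exp_smul, ← integral_conj]
    refine integral_congr_ae (Eventually.of_forall fun t => ?_)
    simp only [smul_eq_mul, map_mul, Complex.conj_conj, ← Complex.exp_conj, Complex.conj_I,
      Complex.conj_ofReal]
    rw [mul_comm]
    congr 2
    push_cast
    ring
  have h2 : ∀ ξ : ℝ, 𝓕 N ξ =
      -∫ t : ℝ, N t * Complex.exp (2 * Complex.I * (Real.pi * ξ : ℝ) * t) := by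
    intro ξ
    rw [Real.fourier_real_eq_integral_exp_smul, ← integral_neg_eq_self, ← integral_neg]
    refine integral_congr_ae (Eventually.of_forall fun t => ?_)
    simp only [smul_eq_mul, hodd, mul_neg]
    rw [mul_comm]
    congr 3
    push_cast
    ring
  simp only [h1, h2, Complex.conj_conj, mul_neg] at h
  rw [integral_neg, Measure.integral_comp_mul_left (fun τ : ℝ =>
    (∫ t : ℝ, D t * Complex.exp (2 * Complex.I * τ * t)) *
      (∫ t : ℝ, N t * Complex.exp (2 * Complex.I * τ * t))), abs_inv,
    abs_of_pos Real.pi_pos] at h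
  rw [← h, Complex.real_smul]
  have := Real.pi_ne_zero
  push_cast
  field_simp

lemma integrable_of_norm_le_rpow_mul_exp {D : ℝ → ℂ} {C γ : ℝ} (hD : ContinuousOn D {0}ᶜ)
    (hγ0 : 0 < γ) (hγ : γ < 1)
    (hbd : ∀ t ≠ 0, ‖D t‖ ≤ C * (|t| ^ (-γ) * Real.exp (-(γ / 2 * |t|)))) :
    Integrable D := by
  have h0 : ∀ᵐ t : ℝ, t ≠ 0 := measure_eq_zero_iff_ae_notMem.1 (measure_singleton (0 : ℝ))
  have hm : AEStronglyMeasurable D := by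
    rw [← Measure.restrict_univ (μ := (volume : Measure ℝ)),
      ← Measure.restrict_congr_set (s := {0}ᶜ) (t := univ)]
    · exact hD.aestronglyMeasurable (measurableSet_singleton _).compl
    · filter_upwards [h0] with t ht
      exact propext ⟨fun _ => trivial, fun _ => ht⟩
  exact ((integrable_abs_rpow_mul_exp_neg hγ (δ := γ / 2) (by positivity)).const_mul C).mono' hm
    (h0.mono hbd)

lemma memLp_two_of_norm_le_rpow_mul_exp {D : ℝ → ℂ} {C γ : ℝ} (hD : ContinuousOn D {0}ᶜ)
    (hγ0 : 0 < γ) (hγ : γ < 1 / 2)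
    (hbd : ∀ t ≠ 0, ‖D t‖ ≤ C * (|t| ^ (-γ) * Real.exp (-(γ / 2 * |t|)))) :
    MemLp D 2 := by
  have h0 : ∀ᵐ t : ℝ, t ≠ 0 := measure_eq_zero_iff_ae_notMem.1 (measure_singleton (0 : ℝ))
  have hm := (integrable_of_norm_le_rpow_mul_exp hD hγ0 (by linarith) hbd).1
  rw [memLp_two_iff_integrable_sq_norm hm]
  refine ((integrable_abs_rpow_mul_exp_neg (α := 2 * γ) (by linarith) (δ := γ)
    hγ0).const_mul (C ^ 2)).mono' (hm.norm.pow 2) (h0.mono fun t ht => ?_)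
  rw [Real.norm_eq_abs, abs_of_nonneg (by positivity)]
  refine (pow_le_pow_left₀ (norm_nonneg _) (hbd t ht) 2).trans_eq ?_
  rw [mul_pow, mul_pow, ← Real.rpow_natCast (|t| ^ (-γ)), ← Real.rpow_mul (abs_nonneg t),
    ← Real.exp_nat_mul]
  push_cast
  ring_nf

/-- The jump of `g` across the imaginary axis, at height `w`. -/
noncomputable def jump (g : ℂ → ℂ) (w : ℝ) : ℂ :=
  g (w * Complex.I) - g (-(w * Complex.I))

lemma jump_neg (g : ℂ → ℂ) (w : ℝ) : jump g (-w) = -jump g w := by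
  simp [jump]

section Jump

variable {g : ℂ → ℂ}

lemma continuousOn_comp_mul_I (hg : ∀ z : ℂ, 0 ≤ z.re → z ≠ 0 → DifferentiableAt ℂ g z) :
    ContinuousOn (fun t : ℝ => g (Real.sinh t * Complex.I)) {0}ᶜ ∧
      ContinuousOn (fun t : ℝ => g (-(Real.sinh t * Complex.I))) {0}ᶜ := by
  have hs := Real.continuous_sinh
  refine ⟨fun t ht => ?_, fun t ht => ?_⟩
  · have hne : (Real.sinh t * Complex.I : ℂ) ≠ 0 :=
      mul_ne_zero (Complex.ofReal_ne_zero.2 (Real.sinh_ne_zero.2 ht)) Complex.I_ne_zero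
    exact (ContinuousAt.comp (f := fun t : ℝ => (Real.sinh t * Complex.I : ℂ))
      (hg _ (by simp) hne).continuousAt
      (Continuous.continuousAt (by fun_prop))).continuousWithinAt
  · have hne : (-(Real.sinh t * Complex.I) : ℂ) ≠ 0 :=
      neg_ne_zero.2 (mul_ne_zero (Complex.ofReal_ne_zero.2 (Real.sinh_ne_zero.2 ht))
        Complex.I_ne_zero)
    exact (ContinuousAt.comp (f := fun t : ℝ => (-(Real.sinh t * Complex.I) : ℂ))
      (hg _ (by simp) hne).continuousAt
      (Continuous.continuousAt (by fun_prop))).continuousWithinAt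

lemma continuousOn_jump_sinh (hg : ∀ z : ℂ, 0 ≤ z.re → z ≠ 0 → DifferentiableAt ℂ g z) :
    ContinuousOn (fun t : ℝ => jump g (Real.sinh t)) {0}ᶜ :=
  (continuousOn_comp_mul_I hg).1.sub (continuousOn_comp_mul_I hg).2

variable {C γ : ℝ}

lemma norm_jump_sinh_mul_cosh_le
    (hbd : ∀ t : ℝ, t ≠ 0 → ∀ z : ℂ, 0 ≤ z.re → |Real.sinh t| ≤ ‖z‖ →
      ‖g z‖ * Real.cosh t ≤ C * (|t| ^ (-γ) * Real.exp (-(γ / 2 * |t|)))) {t : ℝ} (ht : t ≠ 0) :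
    ‖jump g (Real.sinh t) * Complex.cosh t‖ ≤
      2 * C * (|t| ^ (-γ) * Real.exp (-(γ / 2 * |t|))) := by
  have h1 := hbd t ht (Real.sinh t * Complex.I) (by simp) (by simp [-Complex.ofReal_sinh])
  have h2 := hbd t ht (-(Real.sinh t * Complex.I)) (by simp) (by simp [-Complex.ofReal_sinh])
  rw [norm_mul, ← Complex.ofReal_cosh, Complex.norm_real, Real.norm_eq_abs,
    abs_of_pos (Real.cosh_pos t)]
  refine (mul_le_mul_of_nonneg_right (norm_sub_le _ _) (Real.cosh_pos t).le).trans ?_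
  linarith

lemma integral_jump_sinh_mul_cosh
    (hg : ∀ z : ℂ, 0 ≤ z.re → z ≠ 0 → DifferentiableAt ℂ g z) (hγ0 : 0 < γ) (hγ : γ < 1)
    (hbd : ∀ t : ℝ, t ≠ 0 → ∀ z : ℂ, 0 ≤ z.re → |Real.sinh t| ≤ ‖z‖ →
      ‖g z‖ * Real.cosh t ≤ C * (|t| ^ (-γ) * Real.exp (-(γ / 2 * |t|)))) (τ : ℝ) :
    ∫ t : ℝ, jump g (Real.sinh t) * Complex.cosh t * Complex.exp (2 * Complex.I * τ * t) =
      -(2 * Complex.I * Complex.cosh (Real.pi * τ) *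
        ∫ t : ℝ, g (Complex.cosh t) * Complex.sinh t * Complex.exp (2 * Complex.I * τ * t)) := by
  have hB := (integrable_abs_rpow_mul_exp_neg hγ (δ := γ / 2) (by positivity)).const_mul C
  have hbd' : ∀ t : ℝ, t ≠ 0 → ∀ y : ℝ, |y| < Real.pi / 2 →
      ‖g (Complex.cosh (t + y * Complex.I)) * Complex.sinh (t + y * Complex.I)‖ ≤
        C * (|t| ^ (-γ) * Real.exp (-(γ / 2 * |t|))) := by
    intro t ht y hy
    rw [norm_mul]
    exact (mul_le_mul_of_nonneg_left (norm_sinh_add_mul_I_le t y) (norm_nonneg _)).trans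
      (hbd t ht _ (cosh_add_mul_I_re_nonneg t hy.le) (abs_sinh_le_norm_cosh_add_mul_I t y))
  obtain ⟨e1, e2⟩ := integral_comp_cosh_boundary hg Complex.differentiable_sinh hB hbd' τ
  have hsp : ∀ t : ℝ, Complex.sinh (t + (Real.pi / 2 : ℝ) * Complex.I) =
      Complex.I * Complex.cosh t := fun t => by
    rw [sinh_add_mul_I]; simp [mul_comm]
  have hsm : ∀ t : ℝ, Complex.sinh (t - (Real.pi / 2 : ℝ) * Complex.I) =
      -(Complex.I * Complex.cosh t) := fun t => by
    have := sinh_add_mul_I t (-(Real.pi / 2))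
    rw [Complex.ofReal_neg, neg_mul, ← sub_eq_add_neg] at this
    rw [this]; simp [mul_comm]
  have hcos : Continuous fun t : ℝ => Complex.cosh t :=
    Complex.continuous_cosh.comp Complex.continuous_ofReal
  have hn : ∀ t : ℝ, ‖Complex.exp (2 * Complex.I * τ * t)‖ = 1 := fun t => by
    rw [show 2 * Complex.I * τ * t = ((2 * τ * t : ℝ) : ℂ) * Complex.I by push_cast; ring,
      Complex.norm_exp_ofReal_mul_I]
  have hE : ContinuousOn (fun t : ℝ => Complex.cosh t * Complex.exp (2 * Complex.I * τ * t))
      {0}ᶜ := (hcos.mul (by fun_prop)).continuousOn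
  have hnc : ∀ t : ℝ, ‖Complex.cosh t * Complex.exp (2 * Complex.I * τ * t)‖ =
      Real.cosh t := fun t => by
    rw [norm_mul, hn, mul_one, ← Complex.ofReal_cosh, Complex.norm_real, Real.norm_eq_abs,
      abs_of_pos (Real.cosh_pos t)]
  have i1 : Integrable fun t : ℝ => g (Real.sinh t * Complex.I) *
      (Complex.cosh t * Complex.exp (2 * Complex.I * τ * t)) :=
    integrable_of_norm_le_rpow_mul_exp ((continuousOn_comp_mul_I hg).1.mul hE) hγ0 hγ
      fun t ht => by
        rw [norm_mul, hnc]
        exact hbd t ht _ (by simp) (by simp [-Complex.ofReal_sinh])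
  have i2 : Integrable fun t : ℝ => g (-(Real.sinh t * Complex.I)) *
      (Complex.cosh t * Complex.exp (2 * Complex.I * τ * t)) :=
    integrable_of_norm_le_rpow_mul_exp ((continuousOn_comp_mul_I hg).2.mul hE) hγ0 hγ
      fun t ht => by
        rw [norm_mul, hnc]
        exact hbd t ht _ (by simp) (by simp [-Complex.ofReal_sinh])
  have e1' : ∫ t : ℝ, g (Real.sinh t * Complex.I) *
      (Complex.cosh t * Complex.exp (2 * Complex.I * τ * t)) = -Complex.I * (Complex.exp
      (Real.pi * τ) * ∫ t : ℝ, g (Complex.cosh t) * Complex.sinh t *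
        Complex.exp (2 * Complex.I * τ * t)) := by
    rw [← e1, ← integral_const_mul]
    refine integral_congr_ae (Eventually.of_forall fun t => ?_)
    simp only [hsp]
    linear_combination (g (Real.sinh t * Complex.I) *
      (Complex.cosh t * Complex.exp (2 * Complex.I * τ * t))) * Complex.I_sq
  have e2' : ∫ t : ℝ, g (-(Real.sinh t * Complex.I)) *
      (Complex.cosh t * Complex.exp (2 * Complex.I * τ * t)) = Complex.I * (Complex.exp
      (-(Real.pi * τ)) * ∫ t : ℝ, g (Complex.cosh t) * Complex.sinh t *
        Complex.exp (2 * Complex.I * τ * t)) := by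
    rw [← e2, ← integral_const_mul]
    refine integral_congr_ae (Eventually.of_forall fun t => ?_)
    simp only [hsm]
    linear_combination (g (-(Real.sinh t * Complex.I)) *
      (Complex.cosh t * Complex.exp (2 * Complex.I * τ * t))) * Complex.I_sq
  have hsub := integral_sub i1 i2
  rw [e1', e2'] at hsub
  refine (integral_congr_ae (Eventually.of_forall fun t => ?_)).trans (hsub.trans ?_)
  · simp only [jump]
    ring
  · rw [Complex.cosh]
    ring

lemma integral_jump_sinh
    (hg : ∀ z : ℂ, 0 ≤ z.re → z ≠ 0 → DifferentiableAt ℂ g z) (hγ0 : 0 < γ) (hγ : γ < 1)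
    (hbd : ∀ t : ℝ, t ≠ 0 → ∀ z : ℂ, 0 ≤ z.re → |Real.sinh t| ≤ ‖z‖ →
      ‖g z‖ ≤ C * (|t| ^ (-γ) * Real.exp (-(γ / 2 * |t|)))) (τ : ℝ) :
    ∫ t : ℝ, jump g (Real.sinh t) * Complex.exp (2 * Complex.I * τ * t) =
      2 * Complex.sinh (Real.pi * τ) *
        ∫ t : ℝ, g (Complex.cosh t) * Complex.exp (2 * Complex.I * τ * t) := by
  have hB := (integrable_abs_rpow_mul_exp_neg hγ (δ := γ / 2) (by positivity)).const_mul C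
  obtain ⟨e1, e2⟩ := integral_comp_cosh_boundary (k := fun _ => 1) hg
    (differentiable_const _) hB (fun t ht y hy => by
      rw [mul_one]
      exact hbd t ht _ (cosh_add_mul_I_re_nonneg t hy.le) (abs_sinh_le_norm_cosh_add_mul_I t y)) τ
  have hn : ∀ t : ℝ, ‖Complex.exp (2 * Complex.I * τ * t)‖ = 1 := fun t => by
    rw [show 2 * Complex.I * τ * t = ((2 * τ * t : ℝ) : ℂ) * Complex.I by push_cast; ring,
      Complex.norm_exp_ofReal_mul_I]
  have hE : ContinuousOn (fun t : ℝ => Complex.exp (2 * Complex.I * τ * t)) {0}ᶜ :=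
    Continuous.continuousOn (by fun_prop)
  have i1 := integrable_of_norm_le_rpow_mul_exp ((continuousOn_comp_mul_I hg).1.mul hE) hγ0 hγ
    fun t ht => by
      rw [Pi.mul_apply, norm_mul, hn, mul_one]
      exact hbd t ht _ (by simp) (by simp [-Complex.ofReal_sinh])
  have i2 := integrable_of_norm_le_rpow_mul_exp ((continuousOn_comp_mul_I hg).2.mul hE) hγ0 hγ
    fun t ht => by
      rw [Pi.mul_apply, norm_mul, hn, mul_one]
      exact hbd t ht _ (by simp) (by simp [-Complex.ofReal_sinh])
  simp only [mul_one] at e1 e2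
  simp only [jump, sub_mul]
  refine (integral_sub i1 i2).trans ?_
  simp only [Pi.mul_apply]
  rw [e1, e2, Complex.sinh]
  ring

end Jump

section IndexTransform

variable {f : ℝ → ℝ} {a b : ℝ}

lemma exists_norm_stripTransform_derivSymbol_le (hf : LocallyIntegrableOn f (Ioi 0))
    (hO0 : f =O[nhdsWithin 0 (Ioi 0)] fun x => x ^ (-a)) (hOinf : f =O[atTop] fun x => x ^ (-b))
    (ha : a < 3 / 4) (hb : 5 / 4 < b) (hb' : b < 3 / 2) (hm1 : mellinT f 1 = 0) :
    ∃ C γ : ℝ, 0 < γ ∧ γ < 1 / 2 ∧ ∀ t : ℝ, t ≠ 0 → ∀ z : ℂ, 0 ≤ z.re → |Real.sinh t| ≤ ‖z‖ →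
      ‖stripTransform (derivSymbol f) (3 / 4) z‖ * Real.cosh t ≤
        C * (|t| ^ (-γ) * Real.exp (-(γ / 2 * |t|))) := by
  obtain ⟨C, -, hC⟩ := (stripDecay_derivSymbol hf hO0 hOinf (by linarith) (by linarith) hb'.le
    hm1).norm_stripTransform_mul_cosh_le ha (by linarith) (by linarith [Real.pi_pos])
    (γ := 7 / 4 - b) (by linarith) (by linarith) (by linarith)
  exact ⟨C, 7 / 4 - b, by linarith, by linarith, hC⟩

lemma differentiableAt_stripTransform_derivSymbol (hf : LocallyIntegrableOn f (Ioi 0))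
    (hO0 : f =O[nhdsWithin 0 (Ioi 0)] fun x => x ^ (-a)) (hOinf : f =O[atTop] fun x => x ^ (-b))
    (ha : a < 3 / 4) (hb : 1 < b) (hb' : b ≤ 3 / 2) (hm1 : mellinT f 1 = 0) {z : ℂ}
    (hz : 0 ≤ z.re) (hz0 : z ≠ 0) :
    DifferentiableAt ℂ (stripTransform (derivSymbol f) (3 / 4)) z :=
  (stripDecay_derivSymbol hf hO0 hOinf (by linarith) hb hb' hm1).differentiableAt_stripTransform ha
    (by linarith) (by linarith [Real.pi_pos]) hz hz0

lemma mul_cosh_mul_indexF (hf : LocallyIntegrableOn f (Ioi 0))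
    (hO0 : f =O[nhdsWithin 0 (Ioi 0)] fun x => x ^ (-a)) (hOinf : f =O[atTop] fun x => x ^ (-b))
    (ha : a < 3 / 4) (hb : 5 / 4 < b) (hb' : b < 3 / 2) (hm1 : mellinT f 1 = 0) (τ : ℝ) :
    τ * Complex.cosh (Real.pi * τ) * indexF f τ = -(1 / 8) *
      ∫ t : ℝ, jump (stripTransform (derivSymbol f) (3 / 4)) (Real.sinh t) * Complex.cosh t *
        Complex.exp (2 * Complex.I * τ * t) := by
  obtain ⟨C, γ, hγ0, hγ, hC⟩ := exists_norm_stripTransform_derivSymbol_le hf hO0 hOinf ha hb hb' hm1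
  have hg := fun z : ℂ => differentiableAt_stripTransform_derivSymbol (z := z) hf hO0 hOinf ha
    (by linarith) hb'.le hm1
  have hd : Integrable fun t : ℝ =>
      stripTransform (derivSymbol f) (3 / 4) (Complex.cosh t) * Complex.sinh t := by
    have hre : ∀ t : ℝ, 0 < (Complex.cosh t).re := fun t => by
      rw [← Complex.ofReal_cosh, Complex.ofReal_re]
      exact Real.cosh_pos t
    refine integrable_of_norm_le_rpow_mul_exp (C := C) (Continuous.continuousOn ?_) hγ0
      (by linarith) fun t ht => ?_
    · refine continuous_iff_continuousAt.2 fun t => ContinuousAt.mul ?_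
        (Complex.continuous_sinh.comp Complex.continuous_ofReal).continuousAt
      refine ContinuousAt.comp (f := fun t : ℝ => Complex.cosh t) (hg _ (hre t).le ?_).continuousAt
        (Complex.continuous_cosh.comp Complex.continuous_ofReal).continuousAt
      intro h
      have := hre t
      simp [h] at this
    · refine le_trans ?_ (hC t ht (Complex.cosh t) (hre t).le ?_)
      · rw [norm_mul, ← Complex.ofReal_sinh, Complex.norm_real, Real.norm_eq_abs]
        gcongr
        exact abs_le_of_sq_le_sq (by nlinarith [Real.cosh_sq t]) (Real.cosh_pos t).le
      · simpa using abs_sinh_le_norm_cosh_add_mul_I t 0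
  have h1 := integral_exp_mul_deriv_eq
    (hasDerivAt_verticalIntegral_cosh hf hO0 hOinf ha (by linarith) hb'.le hm1)
    (integrable_verticalIntegral_cosh hf hO0 hOinf ha (by linarith) hb'.le hm1) hd τ
  rw [integral_jump_sinh_mul_cosh hg hγ0 (by linarith) hC,
    indexF_eq_integral hf hO0 hOinf ha (by linarith)]
  linear_combination (-(Complex.I / 4) * Complex.cosh (Real.pi * τ)) * h1 + (τ * Complex.cosh
    (Real.pi * τ) / 2 * ∫ t : ℝ, verticalIntegral (mellinSymbol f) (3 / 4)
      (2 * Real.log (Real.cosh t) : ℝ) * Complex.exp (-(2 * Real.log (Real.cosh t) : ℝ)) *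
        Complex.exp (2 * Complex.I * τ * t)) * Complex.I_sq

end IndexTransform

section MacdonaldJump

variable {x : ℝ}

lemma norm_macdonaldK0_mul_le (hx : 0 < x) {t : ℝ} (ht : t ≠ 0) {z : ℂ} (hz : 0 ≤ z.re)
    (h : |Real.sinh t| ≤ ‖z‖) :
    ‖macdonaldK0 (2 * √x * z)‖ ≤ Real.Gamma (1 / 4) * (4 * √x) ^ (-(1 / 4) : ℝ) *
      2 ^ (1 / 4 : ℝ) * (|t| ^ (-(1 / 4) : ℝ) * Real.exp (-(1 / 4 / 2 * |t|))) := by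
  have hs : 0 < |Real.sinh t| := abs_pos.2 (Real.sinh_ne_zero.2 ht)
  have hsx : 0 < √x := Real.sqrt_pos.2 hx
  have hz0 : z ≠ 0 := norm_pos_iff.1 (hs.trans_le h)
  have hG : 0 < Real.Gamma (1 / 4) := Real.Gamma_pos_of_pos (by norm_num)
  have hre : 0 ≤ (2 * √x * z).re := by
    rw [show (2 * √x * z : ℂ) = ((2 * √x : ℝ) : ℂ) * z by push_cast; ring, Complex.re_ofReal_mul]
    positivity
  have hne : (2 * √x * z : ℂ) ≠ 0 := by
    have : (√x : ℂ) ≠ 0 := Complex.ofReal_ne_zero.2 hsx.ne'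
    simp [this, hz0]
  have hn : 2 * ‖(2 * √x * z : ℂ)‖ = 4 * √x * ‖z‖ := by
    rw [norm_mul, norm_mul, Complex.norm_real, Real.norm_eq_abs, abs_of_pos hsx]
    norm_num
    ring
  refine (norm_macdonaldK0_le hre hne (ε := 1 / 4) (by norm_num) (by norm_num)).trans ?_
  rw [hn]
  calc _ ≤ Real.Gamma (1 / 4) * (4 * √x * ‖z‖) ^ (-(1 / 4) : ℝ) * 1 := by
        gcongr
        exact Real.exp_le_one_iff.2 (by linarith)
    _ = Real.Gamma (1 / 4) * (4 * √x) ^ (-(1 / 4) : ℝ) * ‖z‖ ^ (-(1 / 4) : ℝ) := by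
        rw [Real.mul_rpow (by positivity) (norm_nonneg z)]
        ring
    _ ≤ Real.Gamma (1 / 4) * (4 * √x) ^ (-(1 / 4) : ℝ) *
          (2 ^ (1 / 4 : ℝ) * (|t| ^ (-(1 / 4) : ℝ) * Real.exp (-(1 / 4 / 2 * |t|)))) := by
        gcongr
        exact (Real.rpow_le_rpow_of_nonpos hs h (by norm_num)).trans
          (abs_sinh_rpow_neg_le (by norm_num) ht)
    _ = _ := by ring

lemma differentiableAt_macdonaldK0_mul (hx : 0 < x) {z : ℂ} (hz : 0 ≤ z.re) (hz0 : z ≠ 0) :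
    DifferentiableAt ℂ (fun z => macdonaldK0 (2 * √x * z)) z := by
  have hsx : 0 < √x := Real.sqrt_pos.2 hx
  have hre : 0 ≤ (2 * √x * z).re := by
    rw [show (2 * √x * z : ℂ) = ((2 * √x : ℝ) : ℂ) * z by push_cast; ring, Complex.re_ofReal_mul]
    positivity
  have hne : (2 * √x * z : ℂ) ≠ 0 := by
    have : (√x : ℂ) ≠ 0 := Complex.ofReal_ne_zero.2 hsx.ne'
    simp [this, hz0]
  exact DifferentiableAt.comp (f := fun z : ℂ => 2 * √x * z) z
    (differentiableAt_macdonaldK0 hre hne) (by fun_prop)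

lemma two_mul_sinh_mul_besselKi_sq (hx : 0 < x) (τ : ℝ) :
    2 * Complex.sinh (Real.pi * τ) * (besselKi τ (√x) ^ 2 : ℝ) =
      ∫ t : ℝ, jump (fun z => macdonaldK0 (2 * √x * z)) (Real.sinh t) *
        Complex.exp (2 * Complex.I * τ * t) := by
  rw [integral_jump_sinh (fun z hz hz0 => differentiableAt_macdonaldK0_mul hx hz hz0)
    (γ := 1 / 4) (by norm_num) (by norm_num)
    (fun t ht z hz h => norm_macdonaldK0_mul_le hx ht hz h),
    besselKi_sq_eq_integral (Real.sqrt_pos.2 hx)]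

end MacdonaldJump

lemma kernelK_neg (x τ : ℝ) : kernelK x (-τ) = kernelK x τ := by
  have h : ∀ z : ℂ, besselK (2 * Complex.I * (-τ : ℝ)) z = besselK (2 * Complex.I * τ) z := by
    intro z
    simp only [besselK, Complex.ofReal_neg, mul_neg, neg_mul, Complex.cosh_neg]
  simp only [kernelK, h]

lemma indexF_neg (f : ℝ → ℝ) (τ : ℝ) : indexF f (-τ) = indexF f τ := by
  simp only [indexF, kernelK_neg]

lemma besselKi_neg (τ x : ℝ) : besselKi (-τ) x = besselKi τ x := by
  simp only [besselKi, neg_mul, Real.cos_neg]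

section Parseval

variable {f : ℝ → ℝ} {a b x : ℝ}

lemma integral_index_eq_integral_jump (hf : LocallyIntegrableOn f (Ioi 0))
    (hO0 : f =O[nhdsWithin 0 (Ioi 0)] fun x => x ^ (-a)) (hOinf : f =O[atTop] fun x => x ^ (-b))
    (ha : a < 3 / 4) (hb : 5 / 4 < b) (hb' : b < 3 / 2) (hm1 : mellinT f 1 = 0) (hx : 0 < x) :
    ((16 / Real.pi ^ 2 * ∫ τ in Ioi (0 : ℝ), τ * Real.sinh (2 * Real.pi * τ) *
      besselKi τ (√x) ^ 2 * indexF f τ : ℝ) : ℂ) =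
      1 / Real.pi * ∫ t : ℝ, Real.cosh t • (jump (fun z => macdonaldK0 (2 * √x * z)) (Real.sinh t) *
        jump (stripTransform (derivSymbol f) (3 / 4)) (Real.sinh t)) := by
  have heven := integral_even_eq_two_mul (f := fun τ : ℝ => τ * Real.sinh (2 * Real.pi * τ) *
      besselKi τ (√x) ^ 2 * indexF f τ) (fun τ => by
    rw [mul_neg, Real.sinh_neg, besselKi_neg, indexF_neg]; ring)
  obtain ⟨C, γ, hγ0, hγ, hC⟩ := exists_norm_stripTransform_derivSymbol_le hf hO0 hOinf ha hb hb' hm1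
  have hg := fun z : ℂ => differentiableAt_stripTransform_derivSymbol (z := z) hf hO0 hOinf ha
    (by linarith) hb'.le hm1
  have hcN : ContinuousOn (fun t : ℝ => jump (stripTransform (derivSymbol f) (3 / 4))
      (Real.sinh t) * Complex.cosh t) {0}ᶜ :=
    (continuousOn_jump_sinh hg).mul
      (Complex.continuous_cosh.comp Complex.continuous_ofReal).continuousOn
  have hbN := fun (t : ℝ) (ht : t ≠ 0) => norm_jump_sinh_mul_cosh_le hC ht
  have hgD := fun (z : ℂ) (hz : 0 ≤ z.re) (hz0 : z ≠ 0) =>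
    differentiableAt_macdonaldK0_mul hx hz hz0
  have hcD := continuousOn_jump_sinh hgD
  have hbD : ∀ t : ℝ, t ≠ 0 → ‖jump (fun z => macdonaldK0 (2 * √x * z)) (Real.sinh t)‖ ≤
      2 * (Real.Gamma (1 / 4) * (4 * √x) ^ (-(1 / 4) : ℝ) * 2 ^ (1 / 4 : ℝ)) *
        (|t| ^ (-(1 / 4) : ℝ) * Real.exp (-(1 / 4 / 2 * |t|))) := by
    intro t ht
    have h1 := norm_macdonaldK0_mul_le hx ht (z := Real.sinh t * Complex.I) (by simp)
      (by simp [-Complex.ofReal_sinh])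
    have h2 := norm_macdonaldK0_mul_le hx ht (z := -(Real.sinh t * Complex.I)) (by simp)
      (by simp [-Complex.ofReal_sinh])
    refine (norm_sub_le _ _).trans ?_
    linarith
  have hP := integral_mul_integral_mul_cexp
    (integrable_of_norm_le_rpow_mul_exp hcD (γ := 1 / 4) (by norm_num) (by norm_num) hbD)
    (memLp_two_of_norm_le_rpow_mul_exp hcD (γ := 1 / 4) (by norm_num) (by norm_num) hbD)
    (integrable_of_norm_le_rpow_mul_exp hcN hγ0 (by linarith) hbN)
    (memLp_two_of_norm_le_rpow_mul_exp hcN hγ0 hγ hbN)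
    (fun t => by rw [Real.sinh_neg, jump_neg, Complex.ofReal_neg, Complex.cosh_neg, neg_mul])
  have hI : ∀ τ : ℝ, ((τ * Real.sinh (2 * Real.pi * τ) * besselKi τ (√x) ^ 2 * indexF f τ : ℝ) : ℂ)
      = -(1 / 8) * ((∫ t : ℝ, jump (fun z => macdonaldK0 (2 * √x * z)) (Real.sinh t) *
        Complex.exp (2 * Complex.I * τ * t)) *
      ∫ t : ℝ, jump (stripTransform (derivSymbol f) (3 / 4)) (Real.sinh t) * Complex.cosh t *
        Complex.exp (2 * Complex.I * τ * t)) := by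
    intro τ
    have h := mul_cosh_mul_indexF hf hO0 hOinf ha hb hb' hm1 τ
    rw [← two_mul_sinh_mul_besselKi_sq hx, mul_left_comm, ← h, mul_assoc 2 Real.pi τ,
      Real.sinh_two_mul]
    push_cast
    ring
  have hJ : ∫ τ : ℝ, ((τ * Real.sinh (2 * Real.pi * τ) * besselKi τ (√x) ^ 2 * indexF f τ : ℝ) : ℂ)
      = Real.pi / 8 * ∫ t : ℝ, Real.cosh t • (jump (fun z => macdonaldK0 (2 * √x * z))
        (Real.sinh t) * jump (stripTransform (derivSymbol f) (3 / 4)) (Real.sinh t)) := by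
    simp only [hI]
    rw [integral_const_mul, hP]
    have : ∀ t : ℝ, Real.cosh t • (jump (fun z => macdonaldK0 (2 * √x * z)) (Real.sinh t) *
        jump (stripTransform (derivSymbol f) (3 / 4)) (Real.sinh t)) =
        jump (fun z => macdonaldK0 (2 * √x * z)) (Real.sinh t) *
        (jump (stripTransform (derivSymbol f) (3 / 4)) (Real.sinh t) * Complex.cosh t) := by
      intro t
      rw [Complex.real_smul, Complex.ofReal_cosh]
      ring
    simp only [this]
    ring
  rw [integral_complex_ofReal, heven] at hJ
  push_cast at hJ ⊢
  have hpi : (Real.pi : ℂ) ≠ 0 := Complex.ofReal_ne_zero.2 Real.pi_ne_zero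
  rw [show ∀ I : ℂ, 16 / (Real.pi : ℂ) ^ 2 * I = 8 / (Real.pi : ℂ) ^ 2 * (2 * I) from
    fun I => by ring, hJ]
  field_simp

end Parseval

lemma integral_cosh_smul_comp_sinh (J : ℝ → ℂ) :
    ∫ t : ℝ, Real.cosh t • J (Real.sinh t) = ∫ w : ℝ, J w := by
  have h := integral_image_eq_integral_abs_deriv_smul (s := univ) (f := Real.sinh)
    (f' := Real.cosh) MeasurableSet.univ (fun t _ => (Real.hasDerivAt_sinh t).hasDerivWithinAt)
    Real.sinh_injective.injOn J
  rw [image_univ, Real.sinh_surjective.range_eq] at h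
  simp only [Measure.restrict_univ] at h
  rw [h]
  simp only [abs_of_pos (Real.cosh_pos _)]

lemma integral_eq_two_mul_integral_exp {J : ℝ → ℂ} (hJ : ∀ w, J (-w) = J w)
    (hi : Integrable fun u : ℝ => Real.exp u • J (Real.exp u)) :
    ∫ w, J w = 2 * ∫ u : ℝ, Real.exp u • J (Real.exp u) := by
  have h1 : IntegrableOn J (Ioi 0) := (integrableOn_Ioi_iff_integrable_exp J).2 hi
  have h2 : IntegrableOn J (Iic 0) := by
    rw [← neg_zero, ← integrableOn_Ici_iff_integrableOn_Ioi] at *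
    simpa [hJ] using h1.comp_neg
  rw [← intervalIntegral.integral_Iic_add_Ioi h2 h1, ← integral_Ioi_eq_integral_exp,
    two_mul]
  congr 1
  rw [← neg_zero, ← integral_comp_neg_Ioi]
  simp [hJ]

lemma integrable_jump_macdonaldK0_mul_exp {p : ℂ} (hp : 0 < p.re) (hp' : p.re < 1 / 2) :
    (Integrable fun u : ℝ => macdonaldK0 (Complex.exp u * Complex.I) * Complex.exp (p * u)) ∧
    Integrable fun u : ℝ => macdonaldK0 (-(Complex.exp u * Complex.I)) * Complex.exp (p * u) := by
  obtain ⟨C, δ, hδ, hC⟩ := norm_macdonaldK0_exp_mul_exp_le hp hp'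
  have hpi := Real.pi_pos
  have key : ∀ y : ℝ, |y| ≤ Real.pi / 2 → Integrable fun u : ℝ =>
      macdonaldK0 (Complex.exp (u + y * Complex.I)) * Complex.exp (p * (u + y * Complex.I)) := by
    intro y hy
    refine ((integrable_exp_neg_mul_abs hδ).const_mul C).mono' ?_
      (Eventually.of_forall fun u => hC u y hy)
    refine Continuous.aestronglyMeasurable (continuous_iff_continuousAt.2 fun u => ?_)
    refine ContinuousAt.mul (ContinuousAt.comp (f := fun u : ℝ => Complex.exp (u + y * Complex.I))
      (differentiableAt_macdonaldK0 (Complex.exp_re_nonneg ?_)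
        (Complex.exp_ne_zero _)).continuousAt ?_) ?_
    · simpa using hy
    · exact Continuous.continuousAt (by fun_prop)
    · exact Continuous.continuousAt (by fun_prop)
  constructor
  · refine ((key (Real.pi / 2) (by rw [abs_of_pos (by positivity)])).const_mul
      (Complex.exp (-(p * (Real.pi / 2 * Complex.I))))).congr (Eventually.of_forall fun u => ?_)
    simp only
    push_cast
    rw [Complex.exp_add, Complex.exp_pi_div_two_mul_I, mul_left_comm, ← Complex.exp_add]
    ring_nf
  · refine ((key (-(Real.pi / 2)) (by rw [abs_neg, abs_of_pos (by positivity)])).const_mul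
      (Complex.exp (p * (Real.pi / 2 * Complex.I)))).congr (Eventually.of_forall fun u => ?_)
    simp only
    push_cast
    rw [neg_mul, Complex.exp_add, Complex.exp_neg, Complex.exp_pi_div_two_mul_I, mul_left_comm,
      ← Complex.exp_add, Complex.inv_I]
    ring_nf

lemma jump_macdonaldK0_exp {x : ℝ} (hx : 0 < x) (u : ℝ) :
    jump (fun z => macdonaldK0 (2 * √x * z)) (Real.exp u) =
      macdonaldK0 (Complex.exp (u + Real.log (2 * √x) : ℝ) * Complex.I) -
        macdonaldK0 (-(Complex.exp (u + Real.log (2 * √x) : ℝ) * Complex.I)) := by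
  have h : Complex.exp (u + Real.log (2 * √x) : ℝ) = 2 * √x * Real.exp u := by
    rw [← Complex.ofReal_exp, Real.exp_add, Real.exp_log (by positivity)]
    push_cast
    ring
  simp only [jump, h, mul_assoc, mul_neg]

lemma jump_macdonaldK0_mellin {x : ℝ} (hx : 0 < x) {p : ℂ} (hp : 0 < p.re) (hp' : p.re < 1 / 2) :
    (Integrable fun u : ℝ => jump (fun z => macdonaldK0 (2 * √x * z)) (Real.exp u) *
      Complex.exp (p * u)) ∧
    ∫ u : ℝ, jump (fun z => macdonaldK0 (2 * √x * z)) (Real.exp u) * Complex.exp (p * u) =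
      -(Complex.I / 2) * Complex.exp (-(p / 2) * Real.log x) *
        (Complex.sin (Real.pi * (p / 2)) * Complex.Gamma (p / 2) ^ 2) := by
  obtain ⟨i1, i2⟩ := integrable_jump_macdonaldK0_mul_exp hp hp'
  obtain ⟨e1, e2⟩ := integral_macdonaldK0_mul_I hp hp'
  set G : ℝ → ℂ := fun u => macdonaldK0 (Complex.exp u * Complex.I) * Complex.exp (p * u) -
    macdonaldK0 (-(Complex.exp u * Complex.I)) * Complex.exp (p * u) with hG
  have hGi : Integrable G := i1.sub i2
  have hGe : ∫ u, G u = _ := integral_sub i1 i2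
  have hcongr : ∀ u : ℝ, jump (fun z => macdonaldK0 (2 * √x * z)) (Real.exp u) *
      Complex.exp (p * u) = Complex.exp (-(p * Real.log (2 * √x))) *
        G (u + Real.log (2 * √x)) := by
    intro u
    have : Complex.exp (p * u) = Complex.exp (-(p * Real.log (2 * √x))) *
        Complex.exp (p * (u + Real.log (2 * √x) : ℝ)) := by
      rw [← Complex.exp_add]
      push_cast
      ring_nf
    rw [jump_macdonaldK0_exp hx, this, hG]
    ring
  simp only [hcongr]
  refine ⟨(hGi.comp_add_right _).const_mul _, ?_⟩
  rw [integral_const_mul, integral_add_right_eq_self, hGe, e1, e2]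
  have hlog : Real.log (2 * √x) = Real.log 2 + Real.log x / 2 := by
    rw [Real.log_mul two_ne_zero (Real.sqrt_pos.2 hx).ne', Real.log_sqrt hx.le]
  have h2 : (2 : ℂ) ^ (p - 2) = Complex.exp (p * Real.log 2) / 4 := by
    rw [Complex.cpow_sub _ _ two_ne_zero, Complex.cpow_def_of_ne_zero two_ne_zero,
      Complex.ofReal_log two_pos.le, mul_comm]
    norm_num
  have h3 : Complex.exp (-(p * Real.log (2 * √x))) * Complex.exp (p * Real.log 2) =
      Complex.exp (-(p / 2) * Real.log x) := by
    rw [hlog, ← Complex.exp_add]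
    push_cast
    ring_nf
  rw [h2, ← h3, Complex.sin]
  have e3 : -(Real.pi * (p / 2)) * Complex.I = -(p * (Real.pi / 2 * Complex.I)) := by ring
  have e4 : Real.pi * (p / 2) * Complex.I = p * (Real.pi / 2 * Complex.I) := by ring
  rw [e3, e4]
  linear_combination (Complex.exp (-(p * Real.log (2 * √x))) * Complex.exp (p * Real.log 2) *
    Complex.Gamma (p / 2) ^ 2 / 4 * (Complex.exp (-(p * (Real.pi / 2 * Complex.I))) -
      Complex.exp (p * (Real.pi / 2 * Complex.I)))) * Complex.I_sq

lemma StripDecay.jump_stripTransform {V : ℂ → ℂ} {α β κ σ σ' : ℝ} (hV : StripDecay V α β κ)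
    (h1 : α < σ) (h2 : σ < β) (h1' : α < σ') (h2' : σ' < β) (hκ : Real.pi < κ) (u : ℝ) :
    jump (stripTransform V σ) (Real.exp u) = 2 * Complex.I * Complex.exp (-(3 * u)) *
      verticalIntegral (fun s => V s * Complex.cos (Real.pi * s)) σ' (2 * u) := by
  have hpi := Real.pi_pos
  have l1 : Complex.log (Real.exp u * Complex.I) = u + Real.pi / 2 * Complex.I := by
    rw [Complex.log_ofReal_mul (Real.exp_pos u) Complex.I_ne_zero, Real.log_exp, Complex.log_I]
  have l2 : Complex.log (-(Real.exp u * Complex.I)) = u - Real.pi / 2 * Complex.I := by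
    rw [← mul_neg, Complex.log_ofReal_mul (Real.exp_pos u) (neg_ne_zero.2 Complex.I_ne_zero),
      Real.log_exp, Complex.log_neg_I]
    ring
  have x1 : Complex.exp (-(3 * (u + Real.pi / 2 * Complex.I))) =
      Complex.I * Complex.exp (-(3 * u)) := by
    rw [show -(3 * (u + Real.pi / 2 * Complex.I)) = -(3 * u) + (Real.pi / 2 * Complex.I -
      2 * Real.pi * Complex.I) by ring, Complex.exp_add, Complex.exp_sub,
      Complex.exp_two_pi_mul_I, Complex.exp_pi_div_two_mul_I]
    ring
  have x2 : Complex.exp (-(3 * (u - Real.pi / 2 * Complex.I))) =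
      -(Complex.I * Complex.exp (-(3 * u))) := by
    rw [show -(3 * (u - Real.pi / 2 * Complex.I)) = -(3 * u) + (2 * Real.pi * Complex.I -
      Real.pi / 2 * Complex.I) by ring, Complex.exp_add, Complex.exp_sub,
      Complex.exp_two_pi_mul_I, Complex.exp_pi_div_two_mul_I, one_div, Complex.inv_I]
    ring
  have im1 : |(2 * (u + Real.pi / 2 * Complex.I) : ℂ).im| < κ := by
    have : (2 * (u + Real.pi / 2 * Complex.I) : ℂ).im = Real.pi := by
      rw [show (2 * (u + Real.pi / 2 * Complex.I) : ℂ) = (2 * u : ℝ) + (Real.pi : ℝ) * Complex.I by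
        push_cast; ring]
      simp
    rwa [this, abs_of_pos hpi]
  have im2 : |(2 * (u - Real.pi / 2 * Complex.I) : ℂ).im| < κ := by
    have : (2 * (u - Real.pi / 2 * Complex.I) : ℂ).im = -Real.pi := by
      rw [show (2 * (u - Real.pi / 2 * Complex.I) : ℂ) =
        (2 * u : ℝ) + (-Real.pi : ℝ) * Complex.I by push_cast; ring]
      simp
    rwa [this, abs_neg, abs_of_pos hpi]
  have hcos : verticalIntegral (fun s => V s * Complex.cos (Real.pi * s)) σ' (2 * u) =
      1 / 2 * (verticalIntegral V σ' (2 * (u + Real.pi / 2 * Complex.I)) +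
        verticalIntegral V σ' (2 * (u - Real.pi / 2 * Complex.I))) := by
    simp only [verticalIntegral]
    rw [← mul_add, ← integral_add (hV.integrable h1' h2' im1) (hV.integrable h1' h2' im2),
      mul_left_comm, ← integral_const_mul (1 / 2 : ℂ)]
    refine congrArg (1 / (2 * (Real.pi : ℂ)) * ·) (integral_congr_ae
      (Eventually.of_forall fun r => ?_))
    simp only
    generalize (σ' + r * Complex.I : ℂ) = s
    rw [show s * (2 * (u + Real.pi / 2 * Complex.I)) = Real.pi * s * Complex.I + s * (2 * u) by
      ring, show s * (2 * (u - Real.pi / 2 * Complex.I)) = -(Real.pi * s) * Complex.I +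
      s * (2 * u) by ring, Complex.exp_add, Complex.exp_add, Complex.cos]
    ring
  simp only [jump, stripTransform]
  rw [l1, l2, x1, x2, hV.verticalIntegral_eq h1 h2 h1' h2' im1,
    hV.verticalIntegral_eq h1 h2 h1' h2' im2, hcos]
  ring

lemma integral_integral_mul_swap {μ : Measure ℝ} [SFinite μ] {B : ℝ → ℂ} {k : ℝ → ℝ → ℂ}
    {w : ℝ → ℝ} (hk : AEStronglyMeasurable (Function.uncurry k) (μ.prod volume))
    (hkw : ∀ u r, ‖k u r‖ ≤ w u) (hw : Integrable w μ) (hB : Integrable B) :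
    Integrable (fun u => ∫ r, B r * k u r) μ ∧
      ∫ u, (∫ r, B r * k u r) ∂μ = ∫ r, B r * ∫ u, k u r ∂μ := by
  have h : Integrable (Function.uncurry fun u r => B r * k u r) (μ.prod volume) := by
    refine (hw.mul_prod hB.norm).mono' (hB.1.comp_snd.mul hk) (Eventually.of_forall fun p => ?_)
    simp only [Function.uncurry, norm_mul]
    rw [mul_comm]
    gcongr
    exact hkw _ _
  refine ⟨h.integral_prod_left, ?_⟩
  rw [integral_integral_swap h]
  simp only [integral_const_mul]

lemma StripDecay.integrable_line {V : ℂ → ℂ} {α β κ σ : ℝ} (hV : StripDecay V α β κ)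
    (h1 : α < σ) (h2 : σ < β) (hκ : 0 < κ) : Integrable fun r : ℝ => V (σ + r * Complex.I) := by
  simpa using hV.integrable h1 h2 (ζ := 0) (by simpa)

lemma StripDecay.integral_jump_mul_jump {V : ℂ → ℂ} {α β κ σ σ' x : ℝ} (hV : StripDecay V α β κ)
    (h1 : α < σ) (h2 : σ < β) (h1' : α < σ') (h2' : σ' < β) (hκ : Real.pi < κ) (hx : 0 < x)
    (hσ : 1 < σ') (hσ' : σ' < 5 / 4) :
    ∫ t : ℝ, Real.cosh t • (jump (fun z => macdonaldK0 (2 * √x * z)) (Real.sinh t) *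
        jump (stripTransform V σ) (Real.sinh t)) =
      -2 * verticalIntegral (fun s => V s * Complex.cos (Real.pi * s) *
        (Complex.sin (Real.pi * s) * Complex.Gamma (s - 1) ^ 2)) σ' (-Real.log x) * x := by
  have hpi : (Real.pi : ℂ) ≠ 0 := Complex.ofReal_ne_zero.2 Real.pi_ne_zero
  set A : ℝ → ℂ := fun u => jump (fun z => macdonaldK0 (2 * √x * z)) (Real.exp u) with hA
  have hre : ∀ r : ℝ, (2 * (σ' + r * Complex.I) - 2 : ℂ).re = 2 * σ' - 2 := fun r => by simp
  have hM := fun r : ℝ => jump_macdonaldK0_mellin hx (p := 2 * (σ' + r * Complex.I) - 2)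
    (by rw [hre]; linarith) (by rw [hre]; linarith)
  have hM0 := (hM 0).1
  have hB := (hV.mul (StripDecay.cos_pi_mul)).integrable_line h1' h2' (by linarith)
  have hmeas : AEStronglyMeasurable (Function.uncurry fun u r : ℝ =>
      A u * Complex.exp ((2 * (σ' + r * Complex.I) - 2) * u)) (volume.prod volume) := by
    have hc : AEStronglyMeasurable (fun p : ℝ × ℝ => Complex.exp (2 * p.2 * Complex.I * p.1))
        ((volume : Measure ℝ).prod volume) := Continuous.aestronglyMeasurable (by fun_prop)
    refine (hM0.1.comp_fst.mul hc).congr (Eventually.of_forall fun p => ?_)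
    simp only [Pi.mul_apply, Function.uncurry, hA]
    rw [mul_assoc, ← Complex.exp_add]
    push_cast
    ring_nf
  have hnorm : ∀ u r : ℝ, ‖A u * Complex.exp ((2 * (σ' + r * Complex.I) - 2) * u)‖ ≤
      ‖A u * Complex.exp ((2 * (σ' + (0 : ℝ) * Complex.I) - 2) * u)‖ := by
    intro u r
    refine le_of_eq ?_
    simp only [norm_mul, Complex.norm_exp]
    simp
  obtain ⟨hi, hs⟩ := integral_integral_mul_swap (μ := volume) hmeas hnorm hM0.norm hB
  have hu : ∀ u : ℝ, Real.exp u • (A u * jump (stripTransform V σ) (Real.exp u)) =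
      Complex.I / Real.pi * ∫ r : ℝ, V (σ' + r * Complex.I) *
        Complex.cos (Real.pi * (σ' + r * Complex.I)) *
        (A u * Complex.exp ((2 * (σ' + r * Complex.I) - 2) * u)) := by
    intro u
    have : ∀ r : ℝ, V (σ' + r * Complex.I) * Complex.cos (Real.pi * (σ' + r * Complex.I)) *
        (A u * Complex.exp ((2 * (σ' + r * Complex.I) - 2) * u)) =
        Complex.exp u * Complex.exp (-(3 * u)) * A u *
        (V (σ' + r * Complex.I) * Complex.cos (Real.pi * (σ' + r * Complex.I)) *
        Complex.exp ((σ' + r * Complex.I) * (2 * u))) := by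
      intro r
      have : Complex.exp ((2 * (σ' + r * Complex.I) - 2) * u) = Complex.exp u *
          Complex.exp (-(3 * u)) * Complex.exp ((σ' + r * Complex.I) * (2 * u)) := by
        rw [← Complex.exp_add, ← Complex.exp_add]
        ring_nf
      rw [this]
      ring
    simp only [this]
    rw [integral_const_mul, hV.jump_stripTransform h1 h2 h1' h2' hκ, Complex.real_smul,
      verticalIntegral, Complex.ofReal_exp]
    field_simp
  rw [integral_cosh_smul_comp_sinh (fun w => jump (fun z => macdonaldK0 (2 * √x * z)) w *
    jump (stripTransform V σ) w), integral_eq_two_mul_integral_exp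
    (fun w => by rw [jump_neg, jump_neg, neg_mul_neg])
    ((hi.const_mul (Complex.I / Real.pi)).congr (Eventually.of_forall fun u => (hu u).symm)),
    integral_congr_ae (Eventually.of_forall hu), integral_const_mul, hs]
  have hxl : (x : ℂ) = Complex.exp (Real.log x) := by
    rw [← Complex.ofReal_exp, Real.exp_log hx]
  have hr : ∀ r : ℝ, V (σ' + r * Complex.I) * Complex.cos (Real.pi * (σ' + r * Complex.I)) *
      (∫ u : ℝ, A u * Complex.exp ((2 * (σ' + r * Complex.I) - 2) * u)) = Complex.I / 2 * x *
      (V (σ' + r * Complex.I) * Complex.cos (Real.pi * (σ' + r * Complex.I)) *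
        (Complex.sin (Real.pi * (σ' + r * Complex.I)) *
          Complex.Gamma (σ' + r * Complex.I - 1) ^ 2) *
            Complex.exp ((σ' + r * Complex.I) * (-Real.log x))) := by
    intro r
    rw [(hM r).2]
    generalize (σ' + r * Complex.I : ℂ) = s
    rw [show (2 * s - 2) / 2 = s - 1 by ring, mul_sub, mul_one, Complex.sin_sub_pi, hxl,
      show -(s - 1) * (Real.log x : ℂ) = Real.log x + s * (-Real.log x) by ring, Complex.exp_add]
    ring
  simp only [hr]
  rw [integral_const_mul, verticalIntegral]
  have hJ : ∀ J : ℂ, 2 * (Complex.I / Real.pi * (Complex.I / 2 * x * J)) =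
      -2 * (1 / (2 * (Real.pi : ℂ)) * J) * x := by
    intro J
    field_simp
    rw [Complex.I_sq]
    ring
  exact hJ _

lemma integral_Ioi_verticalIntegral {V : ℂ → ℂ} {σ x : ℝ} (hσ : 1 < σ) (hx : 0 < x)
    (hV : Integrable fun r : ℝ => V (σ + r * Complex.I)) :
    ∫ y in Ioi x, verticalIntegral V σ (-Real.log y) =
      verticalIntegral (fun s => V s / (s - 1)) σ (-Real.log x) * x := by
  have hnorm : ∀ y ∈ Ioi x, ∀ r : ℝ, Complex.exp ((σ + r * Complex.I) * (-Real.log y)) =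
      (y : ℂ) ^ (-(σ + r * Complex.I)) := by
    intro y hy r
    have hy0 : 0 < y := hx.trans hy
    rw [Complex.cpow_def_of_ne_zero (Complex.ofReal_ne_zero.2 hy0.ne'),
      Complex.ofReal_log hy0.le]
    ring_nf
  have hw : IntegrableOn (fun y : ℝ => Real.exp (-(σ * Real.log y))) (Ioi x) := by
    refine (integrableOn_Ioi_rpow_of_lt (by linarith : -σ < -1) hx).congr_fun (fun y hy => ?_)
      measurableSet_Ioi
    simp only
    rw [Real.rpow_def_of_pos (hx.trans hy)]
    ring_nf
  have hs := (integral_integral_mul_swap (μ := volume.restrict (Ioi x))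
    (k := fun y r => Complex.exp ((σ + r * Complex.I) * (-Real.log y)))
    (Measurable.aestronglyMeasurable (by unfold Function.uncurry; fun_prop))
    (fun y r => by
      rw [Complex.norm_exp]
      simp) hw hV).2
  have hk : ∀ r : ℝ, ∫ y in Ioi x, Complex.exp ((σ + r * Complex.I) * (-Real.log y)) =
      Complex.exp ((σ + r * Complex.I) * (-Real.log x)) * x / (σ + r * Complex.I - 1) := by
    intro r
    rw [setIntegral_congr_fun measurableSet_Ioi fun y hy => hnorm y hy r,
      integral_Ioi_cpow_of_lt (by simpa using hσ) hx,
      Complex.cpow_add _ _ (Complex.ofReal_ne_zero.2 hx.ne'), Complex.cpow_one,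
      Complex.cpow_def_of_ne_zero (Complex.ofReal_ne_zero.2 hx.ne'), Complex.ofReal_log hx.le,
      ← neg_div_neg_eq]
    ring_nf
  simp only [verticalIntegral]
  rw [integral_const_mul, hs, mul_assoc, ← integral_mul_const]
  refine congrArg _ (integral_congr_ae (Eventually.of_forall fun r => ?_))
  simp only [hk]
  ring

lemma Gamma_three_halves_sub_mul_Gamma_two_sub (s : ℂ) :
    Complex.Gamma (3 / 2 - s) * Complex.Gamma (2 - s) =
      √Real.pi / 4 * Complex.exp (Real.log 4 * s) * Complex.Gamma (2 * (3 / 2 - s)) := by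
  have h := Complex.Gamma_mul_Gamma_add_half (3 / 2 - s)
  rw [show (3 / 2 - s + 1 / 2 : ℂ) = 2 - s by ring] at h
  have h4 : Real.log 4 = 2 * Real.log 2 := by
    rw [show (4 : ℝ) = 2 ^ 2 by norm_num, Real.log_pow]
    norm_num
  have h2 : (2 : ℂ) ^ (1 - 2 * (3 / 2 - s)) = Complex.exp (Real.log 4 * s) / 4 := by
    rw [show (1 - 2 * (3 / 2 - s) : ℂ) = 2 * s - 2 by ring, Complex.cpow_sub _ _ two_ne_zero,
      Complex.cpow_def_of_ne_zero two_ne_zero, h4]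
    push_cast
    rw [Complex.ofReal_log two_pos.le]
    norm_num
    ring_nf
  rw [h, h2]
  ring

section Symbols

variable {f : ℝ → ℝ} {s : ℂ}

lemma phiSymbol_eq (hm1 : mellinT f 1 = 0) (h0 : 0 < s.re) (h1 : s.re < 1 / 2) :
    Complex.Gamma (1 - s) * Complex.Gamma (3 / 2 - s) * Complex.Gamma s * mellinT f s /
      Complex.Gamma (s - 1 / 2) = phiSymbol f s := by
  have hs1 : s ≠ 1 := by
    rintro rfl
    norm_num at h1
  have hG : Complex.Gamma (s - 1 / 2) ≠ 0 := by
    refine Complex.Gamma_ne_zero fun m hm => ?_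
    have := congrArg Complex.re hm
    have h2 : s.re - 1 / 2 = -m := by simpa using this
    have h3 : (m : ℝ) < 1 := by linarith
    have h4 : m = 0 := by
      have : m < 1 := by exact_mod_cast h3
      omega
    rw [h4] at h2
    norm_num at h2
    linarith
  have hG' : Complex.Gamma (3 / 2 - s) ≠ 0 :=
    Complex.Gamma_ne_zero_of_re_pos (by norm_num; linarith)
  have hpi : (Real.pi : ℂ) ≠ 0 := Complex.ofReal_ne_zero.2 Real.pi_ne_zero
  have hr := Complex.Gamma_mul_Gamma_one_sub (s - 1 / 2)
  rw [show (1 - (s - 1 / 2) : ℂ) = 3 / 2 - s by ring,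
    show (Real.pi * (s - 1 / 2) : ℂ) = Real.pi * s - Real.pi / 2 by ring,
    Complex.sin_sub_pi_div_two] at hr
  have hc : Complex.cos (Real.pi * s) ≠ 0 := by
    intro h
    rw [h, neg_zero, div_zero] at hr
    exact mul_ne_zero hG hG' hr
  have hsub : s - 1 ≠ 0 := sub_ne_zero.2 hs1
  have h2 : Complex.Gamma (2 - s) = (1 - s) * Complex.Gamma (1 - s) := by
    rw [← Complex.Gamma_add_one _ (sub_ne_zero.2 hs1.symm)]
    ring_nf
  have hd := Gamma_three_halves_sub_mul_Gamma_two_sub s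
  rw [h2] at hd
  rw [div_eq_iff hG, phiSymbol, dslope_of_ne _ (by simpa using hs1), slope_def_module]
  simp only [Complex.ofReal_one, Complex.ofReal_div, Complex.ofReal_ofNat, hm1, sub_zero, one_mul,
    Complex.ofReal_mul, smul_eq_mul]
  rw [eq_div_iff (neg_ne_zero.2 hc)] at hr
  have : Complex.Gamma (1 - s) * (s - 1) * Real.pi = √Real.pi / 4 * Complex.exp (Real.log 4 * s) *
      Complex.Gamma (2 * (3 / 2 - s)) * Complex.cos (Real.pi * s) * Complex.Gamma (s - 1 / 2) := by
    rw [← hd]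
    linear_combination ((1 - s) * Complex.Gamma (1 - s)) * hr
  generalize Complex.Gamma (3 / 2 - s) = G, Complex.Gamma (s - 1 / 2) = H,
    Complex.Gamma (2 * (3 / 2 - s)) = J, Complex.cos (Real.pi * s) = c,
    Complex.exp (Real.log 4 * s) = E at *
  field_simp
  linear_combination (4 * Complex.Gamma s * mellinT f s) * this

lemma phiSymbol_div_eq (h1 : 1 < s.re) (h2 : s.re < 3 / 2) :
    phiSymbol f s / (s - 1) = -(2 / Real.pi) * (derivSymbol f s * Complex.cos (Real.pi * s) *
      (Complex.sin (Real.pi * s) * Complex.Gamma (s - 1) ^ 2)) := by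
  have hs1 : s - 1 ≠ 0 := by
    intro h
    have := congrArg Complex.re h
    simp at this
    linarith
  have hpi : (Real.pi : ℂ) ≠ 0 := Complex.ofReal_ne_zero.2 Real.pi_ne_zero
  have hsq : (√Real.pi : ℂ) * √Real.pi = Real.pi := by
    rw [← Complex.ofReal_mul, Real.mul_self_sqrt Real.pi_pos.le]
  have hsq0 : (√Real.pi : ℂ) ≠ 0 := by
    intro h
    rw [h, mul_zero] at hsq
    exact hpi hsq.symm
  have hG1 : Complex.Gamma (s - 1) ≠ 0 := Complex.Gamma_ne_zero_of_re_pos (by simpa using h1)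
  have hG2 : Complex.Gamma (2 - s) ≠ 0 := Complex.Gamma_ne_zero_of_re_pos (by
    norm_num; linarith)
  have hr := Complex.Gamma_mul_Gamma_one_sub (s - 1)
  rw [show (1 - (s - 1) : ℂ) = 2 - s by ring, mul_sub, mul_one, Complex.sin_sub_pi] at hr
  have hsin : Complex.sin (Real.pi * s) ≠ 0 := by
    intro h
    rw [h, neg_zero, div_zero] at hr
    exact mul_ne_zero hG1 hG2 hr
  rw [eq_div_iff (neg_ne_zero.2 hsin)] at hr
  have hd := Gamma_three_halves_sub_mul_Gamma_two_sub s
  have hG : Complex.Gamma s = (s - 1) * Complex.Gamma (s - 1) := by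
    rw [← Complex.Gamma_add_one _ hs1]
    ring_nf
  have h16 : Complex.exp (Real.log 16 * s) = Complex.exp (Real.log 4 * s) ^ 2 := by
    rw [← Complex.exp_nat_mul, show (16 : ℝ) = 4 ^ 2 by norm_num, Real.log_pow]
    push_cast
    ring_nf
  have key : Complex.Gamma (3 / 2 - s) * √Real.pi = -(1 / 4 * Complex.exp (Real.log 4 * s) *
      Complex.Gamma (2 * (3 / 2 - s)) * Complex.sin (Real.pi * s) * Complex.Gamma (s - 1)) := by
    refine mul_right_cancel₀ (mul_ne_zero hG2 hsq0) ?_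
    linear_combination (√Real.pi * √Real.pi) * hd + (√Real.pi / 4 * Complex.exp (Real.log 4 * s) *
      Complex.Gamma (2 * (3 / 2 - s))) * (hsq - hr)
  simp only [phiSymbol, derivSymbol, hG, h16, Complex.ofReal_one, Complex.ofReal_div,
    Complex.ofReal_ofNat, one_mul, Complex.ofReal_mul]
  generalize Complex.Gamma (3 / 2 - s) = G, Complex.Gamma (2 * (3 / 2 - s)) = J,
    Complex.Gamma (s - 1) = H, Complex.exp (Real.log 4 * s) = E at *
  field_simp
  linear_combination (32 * E * J * Complex.cos (Real.pi * s) * dslope (mellinT f) 1 s) * key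

end Symbols

/-- Equality (2.9). -/
theorem phi_antiderivative_expansion (ν a b : ℝ) (hν1 : 0 < ν) (hν2 : ν < 1/2)
    (f : ℝ → ℝ) (hf : MeasureTheory.LocallyIntegrableOn f (Set.Ioi 0))
    (ha : a < ν) (hb1 : 5/4 < b) (hb2 : b < 3/2)
    (hO0 : f =O[nhdsWithin 0 (Set.Ioi 0)] fun x => x ^ (-a))
    (hOinf : f =O[atTop] fun x => x ^ (-b))
    (hm1 : mellinT f 1 = 0) (hm2 : deriv (mellinT f) 1 = 0) :
    ∀ x : ℝ, 0 < x →
      (∫ y in Set.Ioi x, phiFn f ν y) =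
        (((16/Real.pi^2) * ∫ τ in Set.Ioi (0:ℝ),
            τ * Real.sinh (2*Real.pi*τ) * (besselKi τ (Real.sqrt x))^2 * indexF f τ : ℝ) : ℂ) := by
  intro x hx
  have hpi := Real.pi_pos
  have hphi := stripDecay_phiSymbol hf hO0 hOinf (by linarith) (by linarith) hb2.le hm1
  have hder := stripDecay_derivSymbol hf hO0 hOinf (by linarith) (by linarith) hb2.le hm1
  have hν : max a 0 < ν := max_lt ha hν1
  have h98 : max a 0 < 9 / 8 := by linarith
  have hshift : ∀ y ∈ Ioi x, phiFn f ν y = verticalIntegral (phiSymbol f) (9 / 8 : ℝ)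
      (-Real.log y) := by
    intro y hy
    have hy0 : 0 < y := hx.trans hy
    have him : |(-(Real.log y : ℂ)).im| < Real.pi / 2 := by
      simpa using hpi
    rw [hphi.verticalIntegral_eq h98 (by linarith) hν (by linarith) him, phiFn, verticalIntegral]
    refine congrArg _ (integral_congr_ae (Eventually.of_forall fun t => ?_))
    simp only
    rw [phiSymbol_eq hm1 (by simpa using hν1) (by simpa using hν2),
      Complex.cpow_def_of_ne_zero (Complex.ofReal_ne_zero.2 hy0.ne'), Complex.ofReal_log hy0.le]
    ring_nf
  rw [setIntegral_congr_fun measurableSet_Ioi hshift, integral_Ioi_verticalIntegral (by norm_num) hx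
    (hphi.integrable_line h98 (by linarith) (by linarith)),
    integral_index_eq_integral_jump hf hO0 hOinf (by linarith) hb1 hb2 hm1 hx,
    hder.integral_jump_mul_jump (σ' := 9 / 8) (by linarith) (by linarith) (by linarith)
      (by linarith) (by linarith) hx (by norm_num) (by norm_num)]
  have hV : verticalIntegral (fun s => phiSymbol f s / (s - 1)) (9 / 8 : ℝ) (-Real.log x) =
      -(2 / Real.pi) * verticalIntegral (fun s => derivSymbol f s * Complex.cos (Real.pi * s) *
        (Complex.sin (Real.pi * s) * Complex.Gamma (s - 1) ^ 2)) (9 / 8 : ℝ) (-Real.log x) := by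
    simp only [verticalIntegral]
    rw [mul_left_comm, ← integral_const_mul (-(2 / (Real.pi : ℂ)))]
    refine congrArg _ (integral_congr_ae (Eventually.of_forall fun r => ?_))
    simp only
    rw [phiSymbol_div_eq (by norm_num) (by norm_num)]
    ring
  rw [hV]
  ring
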